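/- Let m ≥ 1 and ν ≥ 1 be integers and let N ⊆ ℝ^ν be a nonempty compact set admitting a C^1 retraction Π as in the context. There exist constants A, B, δ ∈ (0,∞), depending only on m, ν, N, ρ_N and Π, with the following property. Let u : S^m → ℝ^ν be Borel measurable with u(x) ∈ N for H^m-almost every x ∈ S^m and with finite Gagliardo energy E := ∬_{S^m×S^m} |u(x)−u(y)|^{m+1}/|x−y|^{2m} dH^m(x) dH^m(y) < ∞, and set G := ∬_{{(x,y)∈S^m×S^m : |u(x)−u(y)| ≥ δ}} |x−y|^{−2m} dH^m(x) dH^m(y). Then there exist a finite set S ⊆ B^{m+1}_1 with card S ≤ A·e^{B·G}·E and a map U : B^{m+1}_1 → ℝ^ν such that: (i) U(x) ∈ N for every x ∈ B^{m+1}_1; (ii) U is continuous on B^{m+1}_1 \ S; (iii) U is differentiable at Lebesgue-almost every point of B^{m+1}_1; (iv) for every t ∈ (0,∞), t^{m+1}·L^{m+1}({x ∈ B^{m+1}_1 : U is differentiable at x and ‖DU(x)‖ ≥ t}) ≤ A·e^{B·G}·E; (v) u is the trace of U in the sense that lim_{ε→0⁺} (1/ε)·∫_{{x ∈ ℝ^{m+1}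 : 1−ε < |x| < 1}} |U(x) − u(x/|x|)| dx = 0. -/

import Mathlib

open MeasureTheory Metric Set Filter
open scoped ENNReal Topology

noncomputable section

abbrev Euc (m : ℕ) : Type := EuclideanSpace ℝ (Fin m)

/-- The gap potential `∬_{{(x,y) ∈ S^m × S^m : |u(x) - u(y)| ≥ δ}} |x - y|^{-2m}`
of a map `u` on the unit sphere `S^m ⊆ ℝ^{m+1}`, with respect to the
`m`-dimensional Hausdorff measure. -/
def gapPotentialSphere (m ν : ℕ) (δ : ℝ) (u : Euc (m + 1) → Euc ν) : ℝ≥0∞ :=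
  ∫⁻ x in sphere (0 : Euc (m + 1)) 1, ∫⁻ y in sphere (0 : Euc (m + 1)) 1,
    (if δ ≤ dist (u x) (u y) then (ENNReal.ofReal (dist x y ^ (2 * m)))⁻¹ else 0)
      ∂ μH[(m : ℝ)] ∂ μH[(m : ℝ)]

/-- The Gagliardo energy `∬_{S^m × S^m} |u(x) - u(y)|^{m+1} / |x - y|^{2m}` of a
map `u` on the unit sphere, with respect to the `m`-dimensional Hausdorff
measure. -/
def gagliardoEnergySphere (m ν : ℕ) (u : Euc (m + 1) → Euc ν) : ℝ≥0∞ :=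
  ∫⁻ x in sphere (0 : Euc (m + 1)) 1, ∫⁻ y in sphere (0 : Euc (m + 1)) 1,
    ENNReal.ofReal (dist (u x) (u y) ^ (m + 1)) /
      ENNReal.ofReal (dist x y ^ (2 * m)) ∂ μH[(m : ℝ)] ∂ μH[(m : ℝ)]

/-- The right-hand side `A · e^{B·G} · E` of the weak-type estimates. -/
def gapBoundSphere (m ν : ℕ) (A B δ : ℝ) (u : Euc (m + 1) → Euc ν) : ℝ≥0∞ :=
  ENNReal.ofReal (A * Real.exp (B * (gapPotentialSphere m ν δ u).toReal)) *
    gagliardoEnergySphere m ν u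

section HyperbolicBall

variable {E : Type*} [NormedAddCommGroup E]

/-- The hyperbolic distance in the Poincaré ball model (meaningful on the open unit ball). -/
def hypDist (x y : E) : ℝ :=
  2 * Real.arsinh (‖x - y‖ / √((1 - ‖x‖ ^ 2) * (1 - ‖y‖ ^ 2)))

lemma one_sub_norm_sq_pos {x : E} (hx : x ∈ ball (0 : E) 1) : 0 < 1 - ‖x‖ ^ 2 := by
  have h1 : ‖x‖ < 1 := by simpa using hx
  nlinarith [norm_nonneg x]

lemma mem_unitBall_of_pos {x : E} (hx : 0 < 1 - ‖x‖ ^ 2) : x ∈ ball (0 : E) 1 := by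
  have : ‖x‖ < 1 := by nlinarith [norm_nonneg x]
  simpa using this

lemma hypDist_comm (x y : E) : hypDist x y = hypDist y x := by
  unfold hypDist
  rw [norm_sub_rev, mul_comm (1 - ‖x‖ ^ 2)]

lemma hypDist_self (x : E) : hypDist x x = 0 := by simp [hypDist]

lemma hypDist_nonneg (x y : E) : 0 ≤ hypDist x y := by
  unfold hypDist
  have := Real.arsinh_nonneg_iff.2
    (div_nonneg (norm_nonneg (x - y)) (Real.sqrt_nonneg ((1 - ‖x‖ ^ 2) * (1 - ‖y‖ ^ 2))))
  linarith

/-- `|x - y|² = sinh(d/2)² (1 - |x|²)(1 - |y|²)` for the hyperbolic distance `d`. -/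
lemma norm_sub_sq_eq_sinh {x y : E} (hx : x ∈ ball (0 : E) 1) (hy : y ∈ ball (0 : E) 1) :
    ‖x - y‖ ^ 2 = Real.sinh (hypDist x y / 2) ^ 2 * ((1 - ‖x‖ ^ 2) * (1 - ‖y‖ ^ 2)) := by
  have h := mul_pos (one_sub_norm_sq_pos hx) (one_sub_norm_sq_pos hy)
  unfold hypDist
  rw [mul_div_cancel_left₀ _ two_ne_zero, Real.sinh_arsinh, div_pow, Real.sq_sqrt h.le,
    div_mul_cancel₀ _ h.ne']

lemma hypDist_lt_iff {x y : E} (hx : x ∈ ball (0 : E) 1) (hy : y ∈ ball (0 : E) 1) {r : ℝ}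
    (hr : 0 ≤ r) : hypDist x y < r ↔
      ‖x - y‖ ^ 2 < Real.sinh (r / 2) ^ 2 * ((1 - ‖x‖ ^ 2) * (1 - ‖y‖ ^ 2)) := by
  have h := mul_pos (one_sub_norm_sq_pos hx) (one_sub_norm_sq_pos hy)
  rw [norm_sub_sq_eq_sinh hx hy, mul_lt_mul_iff_left₀ h, pow_lt_pow_iff_left₀ _ _ two_ne_zero,
    Real.sinh_lt_sinh]
  · constructor <;> intro <;> linarith
  · exact Real.sinh_nonneg_iff.2 (by linarith [hypDist_nonneg x y])
  · exact Real.sinh_nonneg_iff.2 (by linarith)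

lemma hypDist_le_iff {x y : E} (hx : x ∈ ball (0 : E) 1) (hy : y ∈ ball (0 : E) 1) {r : ℝ}
    (hr : 0 ≤ r) : hypDist x y ≤ r ↔
      ‖x - y‖ ^ 2 ≤ Real.sinh (r / 2) ^ 2 * ((1 - ‖x‖ ^ 2) * (1 - ‖y‖ ^ 2)) := by
  have h := mul_pos (one_sub_norm_sq_pos hx) (one_sub_norm_sq_pos hy)
  rw [norm_sub_sq_eq_sinh hx hy, mul_le_mul_iff_left₀ h, pow_le_pow_iff_left₀ _ _ two_ne_zero,
    Real.sinh_le_sinh]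
  · constructor <;> intro <;> linarith
  · exact Real.sinh_nonneg_iff.2 (by linarith [hypDist_nonneg x y])
  · exact Real.sinh_nonneg_iff.2 (by linarith)

lemma hypDist_lt_one {x y : E} (hx : x ∈ ball (0 : E) 1) (hy : y ∈ ball (0 : E) 1)
    (h : ‖x - y‖ < (1 - ‖x‖ ^ 2) / 16 + (1 - ‖y‖ ^ 2) / 16) : hypDist x y < 1 := by
  have hX := one_sub_norm_sq_pos hx
  have hY := one_sub_norm_sq_pos hy
  rw [hypDist_lt_iff hx hy zero_le_one]
  have hsinh : (1 / 2 : ℝ) ≤ Real.sinh (1 / 2) := Real.self_le_sinh_iff.2 (by norm_num)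
  have hs2 : (1 / 4 : ℝ) ≤ Real.sinh (1 / 2) ^ 2 := by nlinarith
  have hx1 : ‖x‖ < 1 := by simpa using hx
  have hy1 : ‖y‖ < 1 := by simpa using hy
  have t1 := norm_sub_norm_le x y
  have t2 := norm_sub_norm_le y x
  rw [norm_sub_rev] at t2
  have hd := norm_nonneg (x - y)
  have h1 : (1 - ‖x‖ ^ 2) - (1 - ‖y‖ ^ 2) ≤ 2 * ‖x - y‖ := by
    nlinarith [norm_nonneg x, norm_nonneg y]
  have h2 : (1 - ‖y‖ ^ 2) - (1 - ‖x‖ ^ 2) ≤ 2 * ‖x - y‖ := by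
    nlinarith [norm_nonneg x, norm_nonneg y]
  generalize 1 - ‖x‖ ^ 2 = p at *
  generalize 1 - ‖y‖ ^ 2 = q at *
  have h3 : ‖x - y‖ ^ 2 < (p / 16 + q / 16) ^ 2 := by gcongr
  have h4 : p ≤ 2 * q := by linarith
  have h5 : q ≤ 2 * p := by linarith
  have h6 : (p / 16 + q / 16) ^ 2 ≤ 1 / 4 * (p * q) := by nlinarith
  have h7 := mul_le_mul_of_nonneg_right hs2 (mul_pos hX hY).le
  linarith

end HyperbolicBall

section HyperbolicBallInner

variable {E : Type*} [NormedAddCommGroup E] [InnerProductSpace ℝ E]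

/-- A form of Ptolemy's inequality for a point and its inverse in the unit sphere. -/
lemma norm_sub_mul_le_of_ptolemy (x z : E) {y : E} (hy : y ∈ ball (0 : E) 1) :
    ‖x - z‖ * (1 - ‖y‖ ^ 2) ≤
      ‖x - y‖ * √(‖z - y‖ ^ 2 + (1 - ‖z‖ ^ 2) * (1 - ‖y‖ ^ 2)) +
      ‖z - y‖ * √(‖x - y‖ ^ 2 + (1 - ‖x‖ ^ 2) * (1 - ‖y‖ ^ 2)) := by
  have hy' := one_sub_norm_sq_pos hy
  rcases eq_or_ne y 0 with rfl | h0
  · have := norm_sub_le x z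
    simpa using this
  have hn : 0 < ‖y‖ := norm_pos_iff.2 h0
  have key : ∀ w : E, √(‖w - y‖ ^ 2 + (1 - ‖w‖ ^ 2) * (1 - ‖y‖ ^ 2)) =
      ‖y‖ * dist w ((‖y‖ ^ 2)⁻¹ • y) := by
    intro w
    have : ‖w - y‖ ^ 2 + (1 - ‖w‖ ^ 2) * (1 - ‖y‖ ^ 2) =
        (‖y‖ * dist w ((‖y‖ ^ 2)⁻¹ • y)) ^ 2 := by
      rw [mul_pow, dist_eq_norm, norm_sub_sq_real, norm_sub_sq_real, inner_smul_right, norm_smul,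
        norm_inv, norm_pow, norm_norm]
      field_simp
      ring
    rw [this, Real.sqrt_sq (by positivity)]
  have hyy : ‖y‖ * dist y ((‖y‖ ^ 2)⁻¹ • y) = 1 - ‖y‖ ^ 2 := by
    rw [← key y]
    simp [Real.sqrt_mul_self hy'.le]
  rw [key, key, ← hyy]
  have h := EuclideanGeometry.mul_dist_le_mul_dist_add_mul_dist x y z ((‖y‖ ^ 2)⁻¹ • y)
  rw [dist_eq_norm x z, dist_eq_norm x y, dist_comm y z, dist_eq_norm z y] at h
  nlinarith

lemma hypDist_triangle {x y z : E} (hx : x ∈ ball (0 : E) 1) (hy : y ∈ ball (0 : E) 1)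
    (hz : z ∈ ball (0 : E) 1) : hypDist x z ≤ hypDist x y + hypDist y z := by
  have hX := one_sub_norm_sq_pos hx
  have hY := one_sub_norm_sq_pos hy
  have hZ := one_sub_norm_sq_pos hz
  rw [hypDist_comm y z]
  have hpt := norm_sub_mul_le_of_ptolemy x z hy
  unfold hypDist
  rw [← mul_add]
  refine mul_le_mul_of_nonneg_left ?_ two_pos.le
  rw [← Real.sinh_le_sinh, Real.sinh_add, Real.sinh_arsinh, Real.sinh_arsinh, Real.sinh_arsinh,
    Real.cosh_arsinh, Real.cosh_arsinh]
  have hsq : ∀ w : E, 0 < 1 - ‖w‖ ^ 2 →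
      √(1 + (‖w - y‖ / √((1 - ‖w‖ ^ 2) * (1 - ‖y‖ ^ 2))) ^ 2) =
      √(‖w - y‖ ^ 2 + (1 - ‖w‖ ^ 2) * (1 - ‖y‖ ^ 2)) / √((1 - ‖w‖ ^ 2) * (1 - ‖y‖ ^ 2)) := by
    intro w hw
    have hwy := mul_pos hw hY
    rw [div_pow, Real.sq_sqrt hwy.le, ← Real.sqrt_div (by positivity)]
    congr 1
    field_simp
    ring
  rw [hsq x hX, hsq z hZ, Real.sqrt_mul hX.le, Real.sqrt_mul hX.le, Real.sqrt_mul hZ.le]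
  have h1 := Real.sqrt_pos.2 hX
  have h2 := Real.sqrt_pos.2 hY
  have h3 := Real.sqrt_pos.2 hZ
  have h4 := Real.sq_sqrt hY.le
  rw [div_mul_div_comm, div_mul_div_comm, show √(1 - ‖x‖ ^ 2) * √(1 - ‖y‖ ^ 2) *
    (√(1 - ‖z‖ ^ 2) * √(1 - ‖y‖ ^ 2)) = √(1 - ‖x‖ ^ 2) * √(1 - ‖z‖ ^ 2) * (1 - ‖y‖ ^ 2) by
      linear_combination √(1 - ‖x‖ ^ 2) * √(1 - ‖z‖ ^ 2) * h4, ← add_div, div_le_div_iff₀ (by positivity) (by positivity)]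
  have h5 : 0 < √(1 - ‖x‖ ^ 2) * √(1 - ‖z‖ ^ 2) := by positivity
  nlinarith

lemma hypDist_le_of_hyperboloid {x Z : E} {Z₀ a : ℝ} (hx : x ∈ ball (0 : E) 1) (hZ₀ : 0 ≤ Z₀)
    (hZ : Z₀ ^ 2 = 1 + ‖Z‖ ^ 2) (ha : 0 ≤ a)
    (h : (1 + ‖x‖ ^ 2) * Z₀ - 2 * inner ℝ x Z = (1 - ‖x‖ ^ 2) * Real.cosh a) :
    (1 + Z₀)⁻¹ • Z ∈ ball (0 : E) 1 ∧ hypDist x ((1 + Z₀)⁻¹ • Z) ≤ a := by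
  have hp : 0 < 1 + Z₀ := by linarith
  have hc : 1 - ‖(1 + Z₀)⁻¹ • Z‖ ^ 2 = 2 / (1 + Z₀) := by
    rw [norm_smul, mul_pow, norm_inv, Real.norm_of_nonneg hp.le,
      show ‖Z‖ ^ 2 = Z₀ ^ 2 - 1 by linarith]
    field_simp
    ring
  have hm : (1 + Z₀)⁻¹ • Z ∈ ball (0 : E) 1 := mem_unitBall_of_pos (by rw [hc]; positivity)
  refine ⟨hm, (hypDist_le_iff hx hm ha).2 (le_of_eq ?_)⟩
  have hch : Real.sinh (a / 2) ^ 2 = (Real.cosh a - 1) / 2 := by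
    have := Real.cosh_two_mul (a / 2)
    rw [mul_div_cancel₀ _ two_ne_zero, Real.cosh_sq'] at this
    linarith
  rw [hc, norm_sub_sq_real, inner_smul_right,
    show ‖(1 + Z₀)⁻¹ • Z‖ ^ 2 = 1 - 2 / (1 + Z₀) by linarith, hch]
  field_simp
  linarith

/-- The hyperbolic distance is geodesic. -/
lemma exists_hypDist_le {x y : E} (hx : x ∈ ball (0 : E) 1) (hy : y ∈ ball (0 : E) 1)
    {r s : ℝ} (hr : 0 ≤ r) (hs : 0 ≤ s) (h : hypDist x y ≤ r + s) :
    ∃ c ∈ ball (0 : E) 1, hypDist x c ≤ s ∧ hypDist y c ≤ r := by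
  rcases le_or_gt (hypDist x y) s with hds | hds
  · exact ⟨y, hy, hds, by rwa [hypDist_self]⟩
  have hX := one_sub_norm_sq_pos hx
  have hY := one_sub_norm_sq_pos hy
  set d := hypDist x y with hd
  have hd0 : 0 < d := lt_of_le_of_lt hs hds
  have hσ : ‖x - y‖ ^ 2 = (Real.cosh d - 1) / 2 * ((1 - ‖x‖ ^ 2) * (1 - ‖y‖ ^ 2)) := by
    rw [norm_sub_sq_eq_sinh hx hy, ← hd]
    have := Real.cosh_two_mul (d / 2)
    rw [mul_div_cancel₀ _ two_ne_zero, Real.cosh_sq'] at this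
    congr 1
    linarith
  rw [norm_sub_sq_real] at hσ
  have hsd : 0 < Real.sinh d := Real.sinh_pos_iff.2 hd0
  set α := Real.sinh (d - s) / Real.sinh d with hα
  set β := Real.sinh s / Real.sinh d with hβ
  have hα0 : 0 ≤ α := div_nonneg (Real.sinh_nonneg_iff.2 (by linarith)) hsd.le
  have hβ0 : 0 ≤ β := div_nonneg (Real.sinh_nonneg_iff.2 hs) hsd.le
  have e1 : α + β * Real.cosh d = Real.cosh s := by
    rw [hα, hβ, Real.sinh_sub]; field_simp; ring
  have e2 : α * Real.cosh d + β = Real.cosh (d - s) := by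
    rw [hα, hβ, Real.sinh_sub, Real.cosh_sub]; field_simp
    linear_combination (-Real.sinh s) * Real.cosh_sq d
  have e3 : α ^ 2 + β ^ 2 + 2 * α * β * Real.cosh d = 1 := by
    have h1 : α * Real.sinh d = Real.sinh (d - s) := div_mul_cancel₀ _ hsd.ne'
    have h2 : β * Real.sinh d = Real.sinh s := div_mul_cancel₀ _ hsd.ne'
    have h3 : (α + β * Real.cosh d) ^ 2 - (β * Real.sinh d) ^ 2 = 1 := by
      rw [e1, h2]; linarith [Real.cosh_sq s]
    linear_combination h3 - β ^ 2 * Real.cosh_sq d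
  set Z₀ := α * ((1 + ‖x‖ ^ 2) / (1 - ‖x‖ ^ 2)) + β * ((1 + ‖y‖ ^ 2) / (1 - ‖y‖ ^ 2)) with hZ₀
  set Z := (2 * α / (1 - ‖x‖ ^ 2)) • x + (2 * β / (1 - ‖y‖ ^ 2)) • y with hZ
  have hZ₀0 : 0 ≤ Z₀ := by positivity
  have hi : inner ℝ x y = (‖x‖ ^ 2 + ‖y‖ ^ 2 -
      (Real.cosh d - 1) / 2 * ((1 - ‖x‖ ^ 2) * (1 - ‖y‖ ^ 2))) / 2 := by linarith
  have hnorm : Z₀ ^ 2 = 1 + ‖Z‖ ^ 2 := by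
    rw [← sub_eq_iff_eq_add, ← e3, hZ, norm_add_sq_real, norm_smul, norm_smul, inner_smul_left,
      inner_smul_right, hi, mul_pow, mul_pow, Real.norm_eq_abs, Real.norm_eq_abs, sq_abs, sq_abs,
      hZ₀]
    simp only [conj_trivial]
    have hx1 : ‖x‖ ^ 2 = 1 - (1 - ‖x‖ ^ 2) := by ring
    have hy1 : ‖y‖ ^ 2 = 1 - (1 - ‖y‖ ^ 2) := by ring
    generalize 1 - ‖x‖ ^ 2 = p at *
    generalize 1 - ‖y‖ ^ 2 = q at *
    rw [hx1, hy1]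
    field_simp
    ring
  obtain ⟨hm, h1⟩ := hypDist_le_of_hyperboloid (a := s) hx hZ₀0 hnorm hs (by
    rw [hZ, inner_add_right, inner_smul_right, inner_smul_right, real_inner_self_eq_norm_sq, hi,
      hZ₀, ← e1]
    field_simp
    ring)
  obtain ⟨-, h2⟩ := hypDist_le_of_hyperboloid (a := d - s) hy hZ₀0 hnorm (by linarith) (by
    rw [hZ, inner_add_right, inner_smul_right, inner_smul_right, real_inner_self_eq_norm_sq,
      real_inner_comm, hi, hZ₀, ← e2]
    field_simp
    ring)
  exact ⟨_, hm, h1, by linarith⟩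

/-- Hyperbolic balls are Euclidean balls whose radius is controlled by the distance to the unit
sphere. -/
lemma exists_euclidean_ball {c : E} (hc : c ∈ ball (0 : E) 1) {r : ℝ} (hr : 0 < r) :
    ∃ (a : E) (R : ℝ), 0 < R ∧ ball a R = {x | x ∈ ball (0 : E) 1 ∧ hypDist x c < r} ∧
      closedBall a R = {x | x ∈ ball (0 : E) 1 ∧ hypDist x c ≤ r} ∧
      ∀ x ∈ closedBall a R, R ≤ 16 * Real.exp (2 * r) * (1 - ‖x‖ ^ 2) := by
  have hC := one_sub_norm_sq_pos hc
  set A := 1 - ‖c‖ ^ 2 with hA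
  set σ := Real.sinh (r / 2) ^ 2 with hσ
  have hσ0 : 0 < σ := by have : 0 < Real.sinh (r / 2) := Real.sinh_pos_iff.2 (by linarith)
                         positivity
  set R := A * √(σ * (1 + σ)) / (1 + σ * A) with hR
  have hp : 0 < 1 + σ * A := by positivity
  have hR0 : 0 < R := by positivity
  have hR2 : R ^ 2 = A ^ 2 * (σ * (1 + σ)) / (1 + σ * A) ^ 2 := by
    rw [hR, div_pow, mul_pow, Real.sq_sqrt (by positivity)]
  have hid : ∀ x : E, (1 + σ * A) * (‖x - (1 + σ * A)⁻¹ • c‖ ^ 2 - R ^ 2) =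
      ‖x - c‖ ^ 2 - σ * ((1 - ‖x‖ ^ 2) * A) := by
    intro x
    rw [norm_sub_sq_real, norm_sub_sq_real, inner_smul_right, norm_smul, mul_pow, norm_inv,
      Real.norm_of_nonneg hp.le, hR2, show ‖c‖ ^ 2 = 1 - A by linarith]
    field_simp
    ring
  have hball : ∀ x : E, ‖x - c‖ ^ 2 ≤ σ * ((1 - ‖x‖ ^ 2) * A) → x ∈ ball (0 : E) 1 := by
    intro x hx
    refine mem_unitBall_of_pos ?_
    by_contra hcon
    have h1 : σ * ((1 - ‖x‖ ^ 2) * A) ≤ 0 :=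
      mul_nonpos_of_nonneg_of_nonpos hσ0.le (mul_nonpos_of_nonpos_of_nonneg (by linarith) hC.le)
    have h2 : ‖x - c‖ = 0 := by nlinarith [norm_nonneg (x - c)]
    rw [sub_eq_zero.1 (norm_eq_zero.1 h2)] at hcon
    exact hcon hC
  have h1 : ∀ x : E, x ∈ ball ((1 + σ * A)⁻¹ • c) R ↔ ‖x - c‖ ^ 2 < σ * ((1 - ‖x‖ ^ 2) * A) := by
    intro x
    rw [mem_ball, dist_eq_norm, ← pow_lt_pow_iff_left₀ (norm_nonneg _) hR0.le two_ne_zero,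
      ← sub_neg, ← sub_neg (b := σ * _), ← hid]
    constructor <;> intro h
    · exact mul_neg_of_pos_of_neg hp h
    · exact neg_of_mul_neg_right h hp.le
  have h2 : ∀ x : E, x ∈ closedBall ((1 + σ * A)⁻¹ • c) R ↔
      ‖x - c‖ ^ 2 ≤ σ * ((1 - ‖x‖ ^ 2) * A) := by
    intro x
    rw [mem_closedBall, dist_eq_norm, ← pow_le_pow_iff_left₀ (norm_nonneg _) hR0.le two_ne_zero,
      ← sub_nonpos, ← sub_nonpos (b := σ * _), ← hid]
    constructor <;> intro h
    · exact mul_nonpos_of_nonneg_of_nonpos hp.le h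
    · exact nonpos_of_mul_nonpos_right h hp
  refine ⟨(1 + σ * A)⁻¹ • c, R, hR0, ?_, ?_, ?_⟩
  · ext x
    rw [h1]
    constructor
    · intro h
      exact ⟨hball x h.le, (hypDist_lt_iff (hball x h.le) hc hr.le).2 h⟩
    · rintro ⟨hx, h⟩
      exact (hypDist_lt_iff hx hc hr.le).1 h
  · ext x
    rw [h2]
    constructor
    · intro h
      exact ⟨hball x h, (hypDist_le_iff (hball x h) hc hr.le).2 h⟩
    · rintro ⟨hx, h⟩
      exact (hypDist_le_iff hx hc hr.le).1 h
  · intro x hx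
    have hx2 := (h2 x).1 hx
    have hxb := hball x hx2
    have hX := one_sub_norm_sq_pos hxb
    set b := 1 - ‖x‖ ^ 2 with hb
    have hn1 : ‖c‖ < 1 := by simpa using hc
    have hn2 : ‖x‖ < 1 := by simpa using hxb
    have t1 : ‖x‖ ≤ ‖c‖ + ‖x - c‖ := by
      have := norm_add_le c (x - c); simpa using this
    have hxc := norm_nonneg (x - c)
    -- comparison of the two heights
    have hAb : A ≤ (4 + 16 * σ) * b := by
      by_contra hcon
      push Not at hcon
      have s1 : ‖x - c‖ ≤ A / 4 := by
        refine le_of_sq_le_sq ?_ (by positivity)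
        nlinarith
      have t2 : ‖x‖ ≤ ‖c‖ + A / 4 := by linarith
      have t3 : A / 2 ≤ 1 - ‖c‖ := by nlinarith [sq_nonneg (1 - ‖c‖)]
      have t4 : 1 - ‖x‖ ≤ b := by nlinarith [norm_nonneg x]
      nlinarith
    have hRA : R ≤ A * (1 + σ) := by
      have : √(σ * (1 + σ)) ≤ 1 + σ := by
        rw [Real.sqrt_le_left (by positivity)]; nlinarith
      rw [hR, div_le_iff₀ hp]
      have : A * √(σ * (1 + σ)) ≤ A * (1 + σ) := by gcongr
      nlinarith [show 0 ≤ A * (1 + σ) * (σ * A) by positivity]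
    have hσe : (1 + σ) ^ 2 ≤ Real.exp (2 * r) := by
      have h3 : 1 + σ = Real.cosh (r / 2) ^ 2 := by rw [Real.cosh_sq]; ring
      have h4 : Real.cosh (r / 2) ≤ Real.exp (r / 2) := by
        rw [Real.cosh_eq]
        have := Real.exp_le_exp.2 (show -(r / 2) ≤ r / 2 by linarith)
        linarith
      calc (1 + σ) ^ 2 = Real.cosh (r / 2) ^ 4 := by rw [h3]; ring
        _ ≤ Real.exp (r / 2) ^ 4 := by gcongr
        _ = Real.exp (2 * r) := by rw [← Real.exp_nat_mul]; congr 1; push_cast; ring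
    calc R ≤ A * (1 + σ) := hRA
      _ ≤ ((4 + 16 * σ) * b) * (1 + σ) := by gcongr
      _ ≤ 16 * (1 + σ) ^ 2 * b := by nlinarith [mul_pos hX hσ0]
      _ ≤ 16 * Real.exp (2 * r) * b := by gcongr

/-- Merging of hyperbolic balls: finitely many balls can be covered by pairwise disjoint closed
balls without increasing the sum of the radii. -/
lemma exists_separated_cover (s : Finset (E × ℝ))
    (hs : ∀ p ∈ s, p.1 ∈ ball (0 : E) 1 ∧ 0 < p.2) :
    ∃ t : Finset (E × ℝ), (∀ p ∈ t, p.1 ∈ ball (0 : E) 1 ∧ 0 < p.2) ∧ t.card ≤ s.card ∧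
      ∑ p ∈ t, p.2 ≤ ∑ p ∈ s, p.2 ∧
      (∀ p ∈ t, ∀ q ∈ t, p ≠ q → p.2 + q.2 < hypDist p.1 q.1) ∧
      ∀ x ∈ ball (0 : E) 1, (∃ p ∈ s, hypDist x p.1 < p.2) → ∃ p ∈ t, hypDist x p.1 < p.2 := by
  classical
  induction hn : s.card using Nat.strong_induction_on generalizing s with
  | _ n ih =>
  by_cases hsep : ∀ p ∈ s, ∀ q ∈ s, p ≠ q → p.2 + q.2 < hypDist p.1 q.1
  · exact ⟨s, hs, hn.le, le_rfl, hsep, fun x _ h => h⟩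
  push Not at hsep
  obtain ⟨p, hp, q, hq, hpq, hle⟩ := hsep
  obtain ⟨hp1, hp2⟩ := hs p hp
  obtain ⟨hq1, hq2⟩ := hs q hq
  obtain ⟨c, hc, hpc, hqc⟩ := exists_hypDist_le hp1 hq1 hp2.le hq2.le hle
  have hq' : q ∈ s.erase p := Finset.mem_erase.2 ⟨hpq.symm, hq⟩
  set s' := insert (c, p.2 + q.2) ((s.erase p).erase q) with hs'
  have hcard : s'.card < n := by
    have h1 : s'.card ≤ _ := Finset.card_insert_le (c, p.2 + q.2) ((s.erase p).erase q)
    rw [Finset.card_erase_of_mem hq', Finset.card_erase_of_mem hp] at h1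
    have h2 : 2 ≤ s.card := by
      have := Finset.one_lt_card.2 ⟨p, hp, q, hq, hpq⟩
      omega
    omega
  have hs'pos : ∀ r ∈ s', r.1 ∈ ball (0 : E) 1 ∧ 0 < r.2 := by
    intro r hr
    rcases Finset.mem_insert.1 hr with rfl | hr
    · exact ⟨hc, by positivity⟩
    · exact hs r (Finset.mem_of_mem_erase (Finset.mem_of_mem_erase hr))
  have hsum : ∑ r ∈ s', r.2 ≤ ∑ r ∈ s, r.2 := by
    have h1 : ∑ r ∈ s', r.2 ≤ (p.2 + q.2) + ∑ r ∈ (s.erase p).erase q, r.2 := by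
      by_cases hmem : (c, p.2 + q.2) ∈ (s.erase p).erase q
      · rw [hs', Finset.insert_eq_of_mem hmem]
        linarith
      · rw [hs', Finset.sum_insert hmem]
    have h2 := Finset.add_sum_erase _ (fun r : E × ℝ => r.2) hq'
    have h3 := Finset.add_sum_erase _ (fun r : E × ℝ => r.2) hp
    linarith
  obtain ⟨t, ht1, ht2, ht3, ht4, ht5⟩ := ih _ hcard s' hs'pos rfl
  refine ⟨t, ht1, by omega, ht3.trans hsum, ht4, fun x hx hxs => ht5 x hx ?_⟩
  obtain ⟨r, hr, hxr⟩ := hxs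
  by_cases hrp : r = p
  · subst hrp
    refine ⟨_, Finset.mem_insert_self _ _, ?_⟩
    have := hypDist_triangle hx hp1 hc
    simp only
    linarith
  by_cases hrq : r = q
  · subst hrq
    refine ⟨_, Finset.mem_insert_self _ _, ?_⟩
    have := hypDist_triangle hx hq1 hc
    simp only
    linarith
  · exact ⟨r, Finset.mem_insert_of_mem (Finset.mem_erase.2 ⟨hrq, Finset.mem_erase.2 ⟨hrp, hr⟩⟩),
      hxr⟩

end HyperbolicBallInner

section Pushout

variable {E : Type*} [NormedAddCommGroup E]

lemma norm_normalize_sub_le [NormedSpace ℝ E] (u : E) {v : E} (hv : v ≠ 0) :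
    ‖‖u‖⁻¹ • u - ‖v‖⁻¹ • v‖ ≤ 2 / ‖v‖ * ‖u - v‖ := by
  have hv' : 0 < ‖v‖ := norm_pos_iff.2 hv
  rcases eq_or_ne u 0 with rfl | hu
  · simp [norm_smul, hv]
  have hu' : 0 < ‖u‖ := norm_pos_iff.2 hu
  have h1 : ‖u‖⁻¹ • u - ‖v‖⁻¹ • v = ‖v‖⁻¹ • (u - v) + (‖u‖⁻¹ - ‖v‖⁻¹) • u := by
    rw [smul_sub, sub_smul]; abel
  have h2 : ‖(‖u‖⁻¹ - ‖v‖⁻¹) • u‖ ≤ ‖v‖⁻¹ * ‖u - v‖ := by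
    rw [norm_smul, Real.norm_eq_abs, ← abs_of_pos hu', ← abs_mul, abs_of_pos hu', sub_mul,
      inv_mul_cancel₀ hu'.ne', show 1 - ‖v‖⁻¹ * ‖u‖ = ‖v‖⁻¹ * (‖v‖ - ‖u‖) by field_simp,
      abs_mul, abs_of_pos (inv_pos.2 hv'), norm_sub_rev]
    gcongr
    exact abs_norm_sub_norm_le v u
  have h3 := norm_add_le (‖v‖⁻¹ • (u - v)) ((‖u‖⁻¹ - ‖v‖⁻¹) • u)
  rw [norm_smul ‖v‖⁻¹, norm_inv, norm_norm] at h3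
  rw [h1]
  calc _ ≤ ‖v‖⁻¹ * ‖u - v‖ + ‖v‖⁻¹ * ‖u - v‖ := h3.trans (by gcongr)
    _ = _ := by ring

/-- Displacement of the radial projection of `ball a R` onto its boundary sphere. -/
def radialPush [NormedSpace ℝ E] (a : E) (R : ℝ) (x : E) : E := max (R / ‖x - a‖ - 1) 0 • (x - a)

lemma radialPush_eq_zero [NormedSpace ℝ E] {a : E} {R : ℝ} {x : E} (hx : x ∉ ball a R) :
    radialPush a R x = 0 := by
  rw [mem_ball, dist_eq_norm, not_lt] at hx
  have : R / ‖x - a‖ - 1 ≤ 0 := by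
    linarith [div_le_one_of_le₀ hx (norm_nonneg _)]
  rw [radialPush, max_eq_right this, zero_smul]

lemma add_radialPush [NormedSpace ℝ E] {a : E} {R : ℝ} {x : E} (hx : x ∈ ball a R)
    (hxa : x ≠ a) : x + radialPush a R x = a + R • (‖x - a‖⁻¹ • (x - a)) := by
  rw [mem_ball, dist_eq_norm] at hx
  have h0 : 0 < ‖x - a‖ := norm_pos_iff.2 (sub_ne_zero.2 hxa)
  have : 0 ≤ R / ‖x - a‖ - 1 := by
    linarith [(one_le_div h0).2 hx.le]
  rw [radialPush, max_eq_left this, sub_smul, one_smul, smul_smul, ← div_eq_mul_inv]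
  abel

lemma continuousAt_radialPush [NormedSpace ℝ E] {a : E} {R : ℝ} {x : E} (hxa : x ≠ a) :
    ContinuousAt (radialPush a R) x := by
  have h0 : ‖x - a‖ ≠ 0 := norm_ne_zero_iff.2 (sub_ne_zero.2 hxa)
  unfold radialPush
  fun_prop (disch := assumption)

/-- A continuous map pushing finitely many disjoint balls, minus their centres, radially onto
their boundary spheres. -/
lemma exists_radial_pushout [InnerProductSpace ℝ E] {ι : Type*} (t : Finset ι) (a : ι → E)
    (R : ι → ℝ) (hR : ∀ i ∈ t, 0 < R i)
    (hdisj : ∀ i ∈ t, ∀ j ∈ t, i ≠ j →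
      Disjoint (closedBall (a i) (R i)) (closedBall (a j) (R j))) :
    ∃ P : E → E, (∀ x, (∀ i ∈ t, x ≠ a i) → ContinuousAt P x) ∧
      (∀ x, (∀ i ∈ t, x ∉ ball (a i) (R i)) → P x = x) ∧
      (∀ x, (∀ i ∈ t, x ≠ a i) → ∀ i ∈ t, P x ∉ ball (a i) (R i)) ∧
      ∀ i ∈ t, ∀ x ∈ ball (a i) (R i), x ≠ a i → P x ∈ sphere (a i) (R i) ∧
        ∃ P' : E →L[ℝ] E, HasFDerivAt P P' x ∧ ‖P'‖ ≤ 2 * R i / ‖x - a i‖ := by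
  classical
  set P : E → E := fun x => x + ∑ i ∈ t, radialPush (a i) (R i) x with hP
  have hout : ∀ x, (∀ i ∈ t, x ∉ ball (a i) (R i)) → P x = x := by
    intro x hx
    simp only [hP]
    rw [Finset.sum_eq_zero fun i hi => radialPush_eq_zero (hx i hi), add_zero]
  have hin : ∀ i ∈ t, ∀ x ∈ ball (a i) (R i), x ≠ a i →
      P x = a i + R i • (‖x - a i‖⁻¹ • (x - a i)) := by
    intro i hi x hx hxa
    rw [← add_radialPush hx hxa]
    simp only [hP]
    rw [Finset.sum_eq_single_of_mem i hi]
    intro j hj hji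
    refine radialPush_eq_zero fun hxj => ?_
    exact Set.disjoint_left.1 (hdisj i hi j hj hji.symm) (ball_subset_closedBall hx)
      (ball_subset_closedBall hxj)
  have hsph : ∀ i ∈ t, ∀ x ∈ ball (a i) (R i), x ≠ a i → P x ∈ sphere (a i) (R i) := by
    intro i hi x hx hxa
    have h0 : ‖x - a i‖ ≠ 0 := norm_ne_zero_iff.2 (sub_ne_zero.2 hxa)
    rw [hin i hi x hx hxa, mem_sphere, dist_eq_norm, add_sub_cancel_left, norm_smul, norm_smul,
      norm_inv, norm_norm, inv_mul_cancel₀ h0, mul_one, Real.norm_of_nonneg (hR i hi).le]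
  refine ⟨P, ?_, hout, ?_, ?_⟩
  · intro x hx
    exact continuousAt_id.add (tendsto_finsetSum _ fun i hi => continuousAt_radialPush (hx i hi))
  · intro x hx i hi
    by_cases h : ∃ j ∈ t, x ∈ ball (a j) (R j)
    · obtain ⟨j, hj, hxj⟩ := h
      have hs := hsph j hj x hxj (hx j hj)
      by_cases hij : i = j
      · subst hij
        exact fun hb => (mem_ball.1 hb).ne (mem_sphere.1 hs)
      · exact fun hb => Set.disjoint_left.1 (hdisj i hi j hj hij) (ball_subset_closedBall hb)
          (sphere_subset_closedBall hs)
    · push Not at h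
      rw [hout x h]
      exact h i hi
  · intro i hi x hx hxa
    refine ⟨hsph i hi x hx hxa, ?_⟩
    have h0 : x - a i ≠ 0 := sub_ne_zero.2 hxa
    have hev : P =ᶠ[𝓝 x] fun y => a i + R i • (‖y - a i‖⁻¹ • (y - a i)) := by
      filter_upwards [isOpen_ball.mem_nhds hx, isOpen_ne.mem_nhds hxa] with y hy hya
      exact hin i hi y hy hya
    have hd : DifferentiableAt ℝ (fun y => a i + R i • (‖y - a i‖⁻¹ • (y - a i))) x := by
      have h1 : DifferentiableAt ℝ (fun y => ‖y - a i‖) x :=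
        (differentiableAt_id.sub_const _).norm ℝ h0
      have h2 := h1.inv (norm_ne_zero_iff.2 h0)
      exact ((h2.smul (differentiableAt_id.sub_const _)).const_smul _).const_add _
    refine ⟨_, hd.hasFDerivAt.congr_of_eventuallyEq hev, ?_⟩
    refine hd.hasFDerivAt.le_of_lip' (by have := hR i hi; positivity) (Eventually.of_forall ?_)
    intro y
    have h3 := norm_normalize_sub_le (y - a i) h0
    rw [sub_sub_sub_cancel_right] at h3
    rw [add_sub_add_left_eq_sub, ← smul_sub, norm_smul, Real.norm_of_nonneg (hR i hi).le]
    calc _ ≤ R i * (2 / ‖x - a i‖ * ‖y - x‖) := by have := (hR i hi).le; gcongr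
      _ = _ := by ring

end Pushout

section RadialProjection

variable {m : ℕ}

theorem measurable_normalize : Measurable fun z : Euc (m + 1) => ‖z‖⁻¹ • z := by fun_prop

theorem volume_shell_cone_le {a b : ℝ} (ha : 0 ≤ a) (hb : b ≤ 1) {θ₀ : Euc (m + 1)}
    {d : ℝ} (hd : 0 < d) (hdab : d ≤ b - a) (hθ₀ : ‖θ₀‖ = 1) :
    volume {z : Euc (m + 1) | (a < ‖z‖ ∧ ‖z‖ < b) ∧ ‖‖z‖⁻¹ • z - θ₀‖ ≤ d} ≤
      ENNReal.ofReal (2 ^ (m + 2) * (b - a) * d ^ m) *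
        volume (closedBall (0 : Euc (m + 1)) 1) := by
  set n : ℕ := ⌊(b - a) / d⌋₊ + 1
  have hn : (n : ℝ) ≤ 2 * (b - a) / d := by
    have h1 : (⌊(b - a) / d⌋₊ : ℝ) ≤ (b - a) / d := Nat.floor_le (by
      apply div_nonneg <;> linarith)
    have h2 : 1 ≤ (b - a) / d := by rwa [le_div_iff₀ hd, one_mul]
    push_cast [n]
    rw [mul_div_assoc]
    linarith
  have hcover : {z : Euc (m + 1) | (a < ‖z‖ ∧ ‖z‖ < b) ∧ ‖‖z‖⁻¹ • z - θ₀‖ ≤ d} ⊆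
      ⋃ k ∈ Finset.range n, closedBall ((a + k * d) • θ₀) (2 * d) := by
    rintro z ⟨⟨h1, h2⟩, h3⟩
    have hz : 0 < ‖z‖ := ha.trans_lt h1
    simp only [mem_iUnion, Finset.mem_range, mem_closedBall, dist_eq_norm]
    have hk1 : (⌊(‖z‖ - a) / d⌋₊ : ℝ) ≤ (‖z‖ - a) / d := Nat.floor_le (by
      apply div_nonneg <;> linarith)
    have hk2 := Nat.lt_floor_add_one ((‖z‖ - a) / d)
    refine ⟨⌊(‖z‖ - a) / d⌋₊, ?_, ?_⟩
    · exact Nat.lt_succ_of_le (Nat.floor_le_floor (by gcongr))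
    · set k := ⌊(‖z‖ - a) / d⌋₊
      rw [le_div_iff₀ hd] at hk1
      rw [div_lt_iff₀ hd] at hk2
      have : z - (a + k * d) • θ₀ = ‖z‖ • (‖z‖⁻¹ • z - θ₀) + (‖z‖ - (a + k * d)) • θ₀ := by
        rw [smul_sub, smul_smul, mul_inv_cancel₀ hz.ne', one_smul, sub_smul]; abel
      rw [this]
      refine (norm_add_le _ _).trans ?_
      rw [norm_smul, norm_smul, hθ₀, norm_norm, mul_one, Real.norm_eq_abs]
      have h4 : ‖z‖ * ‖‖z‖⁻¹ • z - θ₀‖ ≤ 1 * d := by gcongr; linarith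
      have h5 : |‖z‖ - (a + k * d)| ≤ d := by rw [abs_le]; constructor <;> linarith
      linarith
  calc _ ≤ _ := measure_mono hcover
    _ ≤ ∑ k ∈ Finset.range n, volume (closedBall ((a + k * d) • θ₀) (2 * d)) :=
      measure_biUnion_finset_le _ _
    _ = n * (ENNReal.ofReal ((2 * d) ^ (m + 1)) * volume (closedBall (0 : Euc (m + 1)) 1)) := by
      simp [Measure.addHaar_closedBall' volume _ (by positivity : 0 ≤ 2 * d)]
    _ ≤ ENNReal.ofReal (2 * (b - a) / d) *
        (ENNReal.ofReal ((2 * d) ^ (m + 1)) * volume (closedBall (0 : Euc (m + 1)) 1)) := by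
      gcongr
      rw [← ENNReal.ofReal_natCast]
      exact ENNReal.ofReal_le_ofReal hn
    _ = _ := by
      rw [← mul_assoc, ← ENNReal.ofReal_mul (by apply div_nonneg <;> linarith)]
      congr 2
      field_simp
      ring

theorem map_normalize_shell_apply_le {a b : ℝ} (ha : 0 ≤ a) (hab : a < b) (hb : b ≤ 1)
    {s : Set (Euc (m + 1))} (hs : ediam s ≤ ENNReal.ofReal ((b - a) / 2)) :
    (volume.restrict {z : Euc (m + 1) | a < ‖z‖ ∧ ‖z‖ < b}).map (fun z => ‖z‖⁻¹ • z) s ≤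
      ENNReal.ofReal (2 ^ (m + 2) * (b - a)) * volume (closedBall (0 : Euc (m + 1)) 1) *
        ediam s ^ (m : ℝ) := by
  have hfin : ediam s ≠ ⊤ := ne_top_of_le_ne_top ENNReal.ofReal_ne_top hs
  set D := (ediam s).toReal with hD
  have hsD : ediam s = ENNReal.ofReal D := (ENNReal.ofReal_toReal hfin).symm
  have hD0 : 0 ≤ D := ENNReal.toReal_nonneg
  have hDb : D ≤ (b - a) / 2 := ENNReal.toReal_le_of_le_ofReal (by linarith) hs
  have key : ∀ d, D < d → d ≤ b - a →
      (volume.restrict {z : Euc (m + 1) | a < ‖z‖ ∧ ‖z‖ < b}).map (fun z => ‖z‖⁻¹ • z) s ≤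
      ENNReal.ofReal (2 ^ (m + 2) * (b - a) * d ^ m) *
        volume (closedBall (0 : Euc (m + 1)) 1) := by
    intro d hd hdab
    refine (measure_mono subset_closure).trans ?_
    rw [Measure.map_apply measurable_normalize isClosed_closure.measurableSet,
      Measure.restrict_apply (measurable_normalize isClosed_closure.measurableSet)]
    rcases eq_empty_or_nonempty
      ((fun z : Euc (m + 1) => ‖z‖⁻¹ • z) ⁻¹' closure s ∩ {z | a < ‖z‖ ∧ ‖z‖ < b}) with h | h
    · simp [h]
    · obtain ⟨z₀, hz₀, hz₀'⟩ := h
      have hz₀n : 0 < ‖z₀‖ := ha.trans_lt hz₀'.1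
      refine (measure_mono ?_).trans (volume_shell_cone_le ha hb (hD0.trans_lt hd) hdab
        (θ₀ := ‖z₀‖⁻¹ • z₀) (by rw [norm_smul, norm_inv, norm_norm, inv_mul_cancel₀ hz₀n.ne']))
      rintro z ⟨hz, hz'⟩
      refine ⟨hz', ?_⟩
      rw [← dist_eq_norm]
      have : edist (‖z‖⁻¹ • z) (‖z₀‖⁻¹ • z₀) ≤ ediam (closure s) :=
        edist_le_ediam_of_mem hz hz₀
      rw [ediam_closure, hsD, edist_le_ofReal hD0] at this
      linarith
  have hlim : Tendsto (fun d : ℝ => ENNReal.ofReal (2 ^ (m + 2) * (b - a) * d ^ m) *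
      volume (closedBall (0 : Euc (m + 1)) 1)) (𝓝[>] D)
      (𝓝 (ENNReal.ofReal (2 ^ (m + 2) * (b - a) * D ^ m) *
        volume (closedBall (0 : Euc (m + 1)) 1))) := by
    refine ENNReal.Tendsto.mul_const (ENNReal.tendsto_ofReal ?_)
      (Or.inr measure_closedBall_lt_top.ne)
    exact (Continuous.tendsto (by fun_prop) D).mono_left nhdsWithin_le_nhds
  have := ge_of_tendsto hlim (b := (volume.restrict
      {z : Euc (m + 1) | a < ‖z‖ ∧ ‖z‖ < b}).map (fun z => ‖z‖⁻¹ • z) s) (by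
    filter_upwards [Ioc_mem_nhdsGT (show D < b - a by linarith)] with d hd using key d hd.1 hd.2)
  refine this.trans_eq ?_
  rw [hsD, ENNReal.rpow_natCast, ← ENNReal.ofReal_pow hD0,
    ENNReal.ofReal_mul (by have := sub_pos.2 hab; positivity)]
  ring

def shellConst (m : ℕ) : ℝ≥0∞ := 2 ^ (m + 2) * volume (closedBall (0 : Euc (m + 1)) 1)

theorem shellConst_ne_top : shellConst m ≠ ⊤ :=
  ENNReal.mul_ne_top (by finiteness) measure_closedBall_lt_top.ne

theorem shellConst_ne_zero : shellConst m ≠ 0 :=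
  mul_ne_zero (by positivity) (measure_closedBall_pos _ _ one_pos).ne'

theorem map_normalize_shell_le {a b : ℝ} (ha : 0 ≤ a) (hab : a < b) (hb : b ≤ 1) :
    (volume.restrict {z : Euc (m + 1) | a < ‖z‖ ∧ ‖z‖ < b}).map (fun z => ‖z‖⁻¹ • z) ≤
      (shellConst m * ENNReal.ofReal (b - a)) • (μH[(m : ℝ)] : Measure (Euc (m + 1))) := by
  have hc0 : shellConst m * ENNReal.ofReal (b - a) ≠ 0 :=
    mul_ne_zero shellConst_ne_zero (by simpa using hab)
  have hct : shellConst m * ENNReal.ofReal (b - a) ≠ ⊤ :=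
    ENNReal.mul_ne_top shellConst_ne_top ENNReal.ofReal_ne_top
  have h := Measure.le_hausdorffMeasure (m : ℝ) ((shellConst m * ENNReal.ofReal (b - a))⁻¹ •
    (volume.restrict {z : Euc (m + 1) | a < ‖z‖ ∧ ‖z‖ < b}).map (fun z => ‖z‖⁻¹ • z))
    (ENNReal.ofReal ((b - a) / 2)) (by simpa using hab) (by
      intro s hs
      have := map_normalize_shell_apply_le (m := m) ha hab hb hs
      rw [Measure.smul_apply, smul_eq_mul]
      rw [mul_comm, ← div_eq_mul_inv]
      refine ENNReal.div_le_of_le_mul (this.trans_eq ?_)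
      rw [ENNReal.ofReal_mul (by positivity), shellConst, ENNReal.ofReal_pow (by positivity)]
      simp only [ENNReal.ofReal_ofNat]
      ring)
  refine Measure.le_iff'.2 fun s => ?_
  have := Measure.le_iff'.1 h s
  rw [Measure.smul_apply, smul_eq_mul, mul_comm, ← div_eq_mul_inv,
    ENNReal.div_le_iff hc0 hct] at this
  rwa [Measure.smul_apply, smul_eq_mul, mul_comm]

theorem lintegral_shell_normalize_le {a b : ℝ} (ha : 0 ≤ a) (hb : b ≤ 1)
    {g : Euc (m + 1) → ℝ≥0∞} (hg : Measurable g) :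
    ∫⁻ z in {z : Euc (m + 1) | a < ‖z‖ ∧ ‖z‖ < b}, g (‖z‖⁻¹ • z) ≤
      shellConst m * ENNReal.ofReal (b - a) *
        ∫⁻ θ in sphere (0 : Euc (m + 1)) 1, g θ ∂μH[(m : ℝ)] := by
  rcases le_or_gt b a with hab | hab
  · have : {z : Euc (m + 1) | a < ‖z‖ ∧ ‖z‖ < b} = ∅ := by
      ext z; simp only [mem_ofPred_eq, mem_empty_iff_false, iff_false]; intro h; linarith [h.1, h.2]
    simp [this]
  have hg' : Measurable ((sphere (0 : Euc (m + 1)) 1).indicator g) :=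
    hg.indicator isClosed_sphere.measurableSet
  have hS : MeasurableSet {z : Euc (m + 1) | a < ‖z‖ ∧ ‖z‖ < b} :=
    (measurableSet_lt measurable_const measurable_norm).inter
      (measurableSet_lt measurable_norm measurable_const)
  calc _ = ∫⁻ z in {z : Euc (m + 1) | a < ‖z‖ ∧ ‖z‖ < b},
        (sphere (0 : Euc (m + 1)) 1).indicator g (‖z‖⁻¹ • z) := by
        refine setLIntegral_congr_fun hS fun z hz => ?_
        have : 0 < ‖z‖ := ha.trans_lt hz.1
        rw [indicator_of_mem]
        rw [mem_sphere_zero_iff_norm, norm_smul, norm_inv, norm_norm, inv_mul_cancel₀ this.ne']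
    _ = ∫⁻ θ, (sphere (0 : Euc (m + 1)) 1).indicator g θ
          ∂((volume.restrict {z : Euc (m + 1) | a < ‖z‖ ∧ ‖z‖ < b}).map
            (fun z => ‖z‖⁻¹ • z)) := (lintegral_map hg' measurable_normalize).symm
    _ ≤ _ := lintegral_mono' (map_normalize_shell_le ha hab hb) le_rfl
    _ = _ := by rw [lintegral_smul_measure, lintegral_indicator isClosed_sphere.measurableSet,
      smul_eq_mul]

end RadialProjection

section SphereMeasure

variable {m : ℕ}

/-- The `m`-dimensional Hausdorff measure restricted to the unit sphere of `ℝ^{m+1}`. -/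
abbrev sphereMeasure (m : ℕ) : Measure (Euc (m + 1)) :=
  (μH[(m : ℝ)]).restrict (sphere (0 : Euc (m + 1)) 1)

/-- The inclusion of the hyperplane `{x | x i = c}` into `ℝ^{m+1}`. -/
def hyperplaneMap (i : Fin (m + 1)) (c : ℝ) (y : Fin m → ℝ) : Euc (m + 1) :=
  WithLp.toLp 2 (i.insertNth (α := fun _ => ℝ) c y)

theorem lipschitzWith_hyperplaneMap (i : Fin (m + 1)) (c : ℝ) :
    ∃ K, LipschitzWith K (hyperplaneMap i c) := by
  refine ⟨_, (PiLp.lipschitzWith_toLp 2 (fun _ : Fin (m + 1) => ℝ)).comp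
    (LipschitzWith.mk_one (f := fun y : Fin m → ℝ => i.insertNth (α := fun _ => ℝ) c y) ?_)⟩
  intro y y'
  refine (dist_pi_le_iff dist_nonneg).2 fun j => ?_
  refine Fin.succAboveCases i ?_ ?_ j
  · simp
  · intro k
    simpa using dist_le_pi_dist y y' k

theorem one_le_norm_hyperplaneMap (i : Fin (m + 1)) {c : ℝ} (hc : |c| = 1) (y : Fin m → ℝ) :
    1 ≤ ‖hyperplaneMap i c y‖ := by
  have := PiLp.norm_apply_le (hyperplaneMap i c y) i
  simpa [hyperplaneMap, hc] using this

theorem hausdorffMeasure_normalize_face_lt_top (i : Fin (m + 1)) {c : ℝ} (hc : |c| = 1) :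
    μH[(m : ℝ)] ((fun y => ‖hyperplaneMap i c y‖⁻¹ • hyperplaneMap i c y) ''
      closedBall (0 : Fin m → ℝ) 1) < ⊤ := by
  obtain ⟨K, hK⟩ := lipschitzWith_hyperplaneMap i c
  have hlip : LipschitzWith (2 * K)
      (fun y => ‖hyperplaneMap i c y‖⁻¹ • hyperplaneMap i c y) := by
    refine LipschitzWith.of_dist_le_mul fun y y' => ?_
    have h1 := one_le_norm_hyperplaneMap i hc y'
    have h2 := norm_normalize_sub_le (hyperplaneMap i c y) (v := hyperplaneMap i c y')
      (norm_pos_iff.1 (by linarith))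
    have h3 := hK.dist_le_mul y y'
    rw [dist_eq_norm] at h3 ⊢
    refine h2.trans ?_
    push_cast
    rw [mul_assoc]
    gcongr
    exact div_le_self zero_le_two h1
  refine (hlip.lipschitzOnWith.hausdorffMeasure_image_le (by positivity)).trans_lt ?_
  have : (μH[(m : ℝ)] : Measure (Fin m → ℝ)) = volume := by
    simpa using hausdorffMeasure_pi_real (ι := Fin m)
  rw [this]
  exact ENNReal.mul_lt_top (by finiteness) measure_closedBall_lt_top

theorem sphere_subset_iUnion_faces :
    sphere (0 : Euc (m + 1)) 1 ⊆ ⋃ (i : Fin (m + 1)) (b : Bool),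
      (fun y => ‖hyperplaneMap i (if b then 1 else -1) y‖⁻¹ •
        hyperplaneMap i (if b then 1 else -1) y) '' closedBall (0 : Fin m → ℝ) 1 := by
  intro x hx
  rw [mem_sphere_zero_iff_norm] at hx
  obtain ⟨i, -, hi⟩ := Finset.exists_max_image Finset.univ (fun i => |x i|) Finset.univ_nonempty
  have hxi : 0 < |x i| := by
    rw [abs_pos]
    intro h0
    have : x = 0 := by
      ext j
      simpa [h0] using hi j (Finset.mem_univ j)
    simp [this] at hx
  simp only [mem_iUnion]
  refine ⟨i, decide (0 < x i), fun k => |x i|⁻¹ * x (i.succAbove k), ?_, ?_⟩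
  · rw [mem_closedBall_zero_iff, pi_norm_le_iff_of_nonneg zero_le_one]
    intro k
    rw [norm_mul, norm_inv, Real.norm_eq_abs, Real.norm_eq_abs, abs_abs,
      inv_mul_le_iff₀ hxi, mul_one]
    exact hi _ (Finset.mem_univ _)
  · have : hyperplaneMap i (if decide (0 < x i) then 1 else -1)
        (fun k => |x i|⁻¹ * x (i.succAbove k)) = |x i|⁻¹ • x := by
      ext j
      refine Fin.succAboveCases i ?_ ?_ j
      · rcases lt_or_ge 0 (x i) with h | h
        · simp [hyperplaneMap, h, abs_of_pos h, h.ne']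
        · have h' : x i ≠ 0 := abs_pos.1 hxi
          simp [hyperplaneMap, not_lt.2 h, abs_of_nonpos h]
          field_simp
      · intro k
        simp [hyperplaneMap]
    simp only [this]
    rw [norm_smul, hx, norm_inv, Real.norm_eq_abs, abs_abs, mul_one, inv_inv, smul_smul,
      mul_inv_cancel₀ hxi.ne', one_smul]

instance : IsFiniteMeasure (sphereMeasure m) := by
  refine ⟨?_⟩
  rw [Measure.restrict_apply_univ]
  refine (measure_mono sphere_subset_iUnion_faces).trans_lt ?_
  refine (measure_iUnion_le _).trans_lt ?_
  rw [tsum_fintype]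
  refine ENNReal.sum_lt_top.2 fun i _ => (measure_iUnion_le _).trans_lt ?_
  rw [tsum_fintype]
  refine ENNReal.sum_lt_top.2 fun b _ => hausdorffMeasure_normalize_face_lt_top i ?_
  cases b <;> simp

end SphereMeasure

section LocalEnergy

variable {m : ℕ}

/-- A smooth function on the unit ball comparable to the distance to the sphere. -/
def bdHeight {E : Type*} [NormedAddCommGroup E] (x : E) : ℝ := (1 - ‖x‖ ^ 2) / 4

theorem bdHeight_pos {E : Type*} [NormedAddCommGroup E] {x : E} (hx : x ∈ ball (0 : E) 1) :
    0 < bdHeight x := by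
  have := one_sub_norm_sq_pos hx
  unfold bdHeight; linarith

theorem two_mul_bdHeight_lt {E : Type*} [NormedAddCommGroup E] {x : E}
    (hx : x ∈ ball (0 : E) 1) : 2 * bdHeight x < 1 - ‖x‖ := by
  rw [mem_ball_zero_iff] at hx
  unfold bdHeight; nlinarith [norm_nonneg x]

theorem one_sub_norm_le_bdHeight {E : Type*} [NormedAddCommGroup E] {x : E}
    (hx : x ∈ ball (0 : E) 1) : 1 - ‖x‖ ≤ 4 * bdHeight x := by
  rw [mem_ball_zero_iff] at hx
  unfold bdHeight; nlinarith [norm_nonneg x]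

theorem closedBall_bdHeight_subset {E : Type*} [NormedAddCommGroup E] {x : E}
    (hx : x ∈ ball (0 : E) 1) : closedBall x (2 * bdHeight x) ⊆ ball 0 1 := by
  intro z hz
  have h1 := two_mul_bdHeight_lt hx
  rw [mem_closedBall, dist_eq_norm] at hz
  rw [mem_ball_zero_iff]
  have := norm_le_norm_add_norm_sub x z
  rw [norm_sub_rev] at this
  linarith

theorem measurable_bdHeight : Measurable fun x : Euc (m + 1) => bdHeight x := by
  unfold bdHeight; fun_prop

theorem dist_normalize_le {x z : Euc (m + 1)} (hx : x ∈ ball (0 : Euc (m + 1)) 1)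
    (hz : dist z x ≤ 2 * bdHeight x) (hz0 : z ≠ 0) :
    dist (‖z‖⁻¹ • z) x ≤ 8 * bdHeight x := by
  have hzb := closedBall_bdHeight_subset hx (mem_closedBall.2 hz)
  rw [mem_ball_zero_iff] at hzb
  have hzp : 0 < ‖z‖ := norm_pos_iff.2 hz0
  have h1 : dist (‖z‖⁻¹ • z) z = 1 - ‖z‖ := by
    have : ‖z‖⁻¹ • z - z = (1 - ‖z‖) • (‖z‖⁻¹ • z) := by
      rw [sub_smul, one_smul, smul_smul, mul_inv_cancel₀ hzp.ne', one_smul]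
    rw [dist_eq_norm, this, norm_smul, norm_smul, norm_inv, norm_norm,
      inv_mul_cancel₀ hzp.ne', mul_one, Real.norm_eq_abs, abs_of_pos (by linarith)]
  have h2 := one_sub_norm_le_bdHeight hx
  have h3 : ‖x‖ - ‖z‖ ≤ dist z x := by
    rw [dist_comm, dist_eq_norm]; exact norm_sub_norm_le x z
  have := dist_triangle (‖z‖⁻¹ • z) z x
  linarith

theorem lintegral_closedBall_normalize_le {x : Euc (m + 1)} (hx : x ∈ ball (0 : Euc (m + 1)) 1)
    {g : Euc (m + 1) → ℝ≥0∞} (hg : Measurable g) :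
    ∫⁻ z in closedBall x (2 * bdHeight x), g (‖z‖⁻¹ • z) ≤
      shellConst m * ENNReal.ofReal (6 * bdHeight x) *
        ∫⁻ θ in closedBall x (8 * bdHeight x), g θ ∂(sphereMeasure m) := by
  set h := bdHeight x
  have hh : 0 < h := bdHeight_pos hx
  have hg' : Measurable ((closedBall x (8 * h)).indicator g) :=
    hg.indicator isClosed_closedBall.measurableSet
  set a := max 0 (‖x‖ - 3 * h)
  set b := min 1 (‖x‖ + 3 * h)
  have hae : ∀ᵐ z ∂(volume : Measure (Euc (m + 1))), z ≠ 0 := by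
    simp [ae_iff]
  calc _ = ∫⁻ z in closedBall x (2 * h), (closedBall x (8 * h)).indicator g (‖z‖⁻¹ • z) := by
        refine setLIntegral_congr_fun_ae isClosed_closedBall.measurableSet ?_
        filter_upwards [hae] with z hz0 hz
        rw [indicator_of_mem]
        exact dist_normalize_le hx hz hz0
    _ ≤ ∫⁻ z in {z : Euc (m + 1) | a < ‖z‖ ∧ ‖z‖ < b},
        (closedBall x (8 * h)).indicator g (‖z‖⁻¹ • z) := by
        refine lintegral_mono_set' ?_
        filter_upwards [hae] with z hz0 hz
        have h1 : ‖z‖ < 1 := by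
          simpa using closedBall_bdHeight_subset hx hz
        have h2 : |‖z‖ - ‖x‖| ≤ 2 * h :=
          (abs_norm_sub_norm_le z x).trans (by rw [← dist_eq_norm]; exact hz)
        rw [abs_le] at h2
        exact ⟨max_lt (norm_pos_iff.2 hz0) (by linarith), lt_min h1 (by linarith)⟩
    _ ≤ shellConst m * ENNReal.ofReal (b - a) *
        ∫⁻ θ in sphere (0 : Euc (m + 1)) 1, (closedBall x (8 * h)).indicator g θ ∂μH[(m : ℝ)] :=
        lintegral_shell_normalize_le (le_max_left _ _) (min_le_left _ _) hg'
    _ ≤ _ := by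
        rw [lintegral_indicator isClosed_closedBall.measurableSet]
        gcongr
        have h1 : ‖x‖ - 3 * h ≤ a := le_max_right _ _
        have h2 : b ≤ ‖x‖ + 3 * h := min_le_right _ _
        linarith

/-- The localisation at scale `bdHeight x` near `x` of an energy on pairs of points of the
sphere. -/
def sphereEnergy (F : Euc (m + 1) × Euc (m + 1) → ℝ≥0∞) (x : Euc (m + 1)) : ℝ≥0∞ :=
  ∫⁻ p, {q : Euc (m + 1) × Euc (m + 1) × Euc (m + 1) |
      dist q.2.1 q.1 ≤ 8 * bdHeight q.1 ∧ dist q.2.2 q.1 ≤ 8 * bdHeight q.1}.indicator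
    (fun q => F q.2) (x, p) ∂((sphereMeasure m).prod (sphereMeasure m))

theorem measurableSet_near : MeasurableSet {q : Euc (m + 1) × Euc (m + 1) × Euc (m + 1) |
    dist q.2.1 q.1 ≤ 8 * bdHeight q.1 ∧ dist q.2.2 q.1 ≤ 8 * bdHeight q.1} := by
  have h : Measurable fun q : Euc (m + 1) × Euc (m + 1) × Euc (m + 1) => 8 * bdHeight q.1 :=
    (measurable_bdHeight.comp measurable_fst).const_mul 8
  exact (measurableSet_le (by fun_prop) h).inter (measurableSet_le (by fun_prop) h)

theorem measurable_sphereEnergy {F : Euc (m + 1) × Euc (m + 1) → ℝ≥0∞} (hF : Measurable F) :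
    Measurable (sphereEnergy F) :=
  Measurable.lintegral_prod_right'
    ((hF.comp measurable_snd).indicator measurableSet_near)

theorem sphereEnergy_eq {F : Euc (m + 1) × Euc (m + 1) → ℝ≥0∞} (hF : Measurable F)
    (x : Euc (m + 1)) :
    sphereEnergy F x = ∫⁻ θ in closedBall x (8 * bdHeight x),
      ∫⁻ θ' in closedBall x (8 * bdHeight x), F (θ, θ') ∂(sphereMeasure m)
        ∂(sphereMeasure m) := by
  rw [← lintegral_prod _ hF.aemeasurable, Measure.prod_restrict,
    ← lintegral_indicator (isClosed_closedBall.measurableSet.prod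
      isClosed_closedBall.measurableSet)]
  rfl

theorem lintegral_pair_normalize_le {F : Euc (m + 1) × Euc (m + 1) → ℝ≥0∞} (hF : Measurable F)
    {x : Euc (m + 1)} (hx : x ∈ ball (0 : Euc (m + 1)) 1) :
    ∫⁻ z in closedBall x (2 * bdHeight x), ∫⁻ z' in closedBall x (2 * bdHeight x),
        F (‖z‖⁻¹ • z, ‖z'‖⁻¹ • z') ≤
      (shellConst m * ENNReal.ofReal (6 * bdHeight x)) ^ 2 * sphereEnergy F x := by
  have hg : Measurable fun θ => ∫⁻ θ' in closedBall x (8 * bdHeight x), F (θ, θ')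
      ∂(sphereMeasure m) := hF.lintegral_prod_right'
  calc _ ≤ ∫⁻ z in closedBall x (2 * bdHeight x),
        shellConst m * ENNReal.ofReal (6 * bdHeight x) *
          ∫⁻ θ' in closedBall x (8 * bdHeight x), F (‖z‖⁻¹ • z, θ') ∂(sphereMeasure m) := by
        refine lintegral_mono fun z => ?_
        exact lintegral_closedBall_normalize_le hx (hF.comp measurable_prodMk_left)
    _ = shellConst m * ENNReal.ofReal (6 * bdHeight x) *
        ∫⁻ z in closedBall x (2 * bdHeight x),
          ∫⁻ θ' in closedBall x (8 * bdHeight x), F (‖z‖⁻¹ • z, θ') ∂(sphereMeasure m) :=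
        lintegral_const_mul _ (hg.comp measurable_normalize)
    _ ≤ _ := by
        rw [sphereEnergy_eq hF, pow_two, mul_assoc (shellConst m * _) (shellConst m * _)]
        exact mul_le_mul' le_rfl (lintegral_closedBall_normalize_le hx hg)

/-- The normalised `L^1` norm of the kernel used in the integration of local energies. -/
def kernelConst (m : ℕ) : ℝ≥0∞ :=
  24 ^ (3 * m + 1) * ∫⁻ x : Euc (m + 1), ENNReal.ofReal ((1 + ‖x‖) ^ (-((3 * m + 1 : ℕ) : ℝ)))

theorem kernelConst_ne_top (hm : 1 ≤ m) : kernelConst m ≠ ⊤ := by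
  refine ENNReal.mul_ne_top (by finiteness) (finite_integral_one_add_norm ?_).ne
  simp only [finrank_euclideanSpace, Fintype.card_fin]
  norm_cast
  lia

theorem lintegral_kernel_eq (θ : Euc (m + 1)) {s : ℝ} (hs : 0 < s) :
    ∫⁻ x : Euc (m + 1), ENNReal.ofReal ((24 / (s + ‖x - θ‖)) ^ (3 * m + 1)) =
      kernelConst m * (ENNReal.ofReal (s ^ (2 * m)))⁻¹ := by
  set f : Euc (m + 1) → ℝ≥0∞ :=
    fun x => ENNReal.ofReal ((1 + ‖x‖) ^ (-((3 * m + 1 : ℕ) : ℝ)))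
  have hf : Measurable f := by fun_prop
  have h1 : ∀ x : Euc (m + 1), ENNReal.ofReal ((24 / (s + ‖x - θ‖)) ^ (3 * m + 1)) =
      ENNReal.ofReal ((24 / s) ^ (3 * m + 1)) * f (s⁻¹ • (x - θ)) := by
    intro x
    rw [← ENNReal.ofReal_mul (by positivity), Real.rpow_neg (by positivity), Real.rpow_natCast,
      ← inv_pow, ← mul_pow]
    congr 2
    rw [norm_smul, Real.norm_eq_abs, abs_of_pos (inv_pos.2 hs)]
    field_simp
  simp_rw [h1]
  rw [lintegral_const_mul _ (by fun_prop),
    lintegral_sub_right_eq_self (fun x => f (s⁻¹ • x)) θ,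
    ← lintegral_map (f := f) hf (by fun_prop : Measurable fun x : Euc (m + 1) => s⁻¹ • x),
    Measure.map_addHaar_smul volume (inv_ne_zero hs.ne'), lintegral_smul_measure, smul_eq_mul,
    ← mul_assoc, ← ENNReal.ofReal_mul (by positivity), kernelConst, mul_right_comm,
    ← ENNReal.ofReal_inv_of_pos (by positivity)]
  congr 1
  rw [← ENNReal.ofReal_ofNat 24, ← ENNReal.ofReal_pow (by norm_num),
    ← ENNReal.ofReal_mul (by positivity), abs_of_pos (by positivity)]
  congr 1
  simp only [finrank_euclideanSpace, Fintype.card_fin]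
  rw [div_pow, show s ^ (3 * m + 1) = s ^ (2 * m) * s ^ (m + 1) by ring, inv_pow]
  field_simp

theorem lintegral_sphereEnergy_le {F : Euc (m + 1) × Euc (m + 1) → ℝ≥0∞} (hF : Measurable F)
    (hF0 : ∀ θ, F (θ, θ) = 0) :
    ∫⁻ x in ball (0 : Euc (m + 1)) 1,
        (ENNReal.ofReal (bdHeight x))⁻¹ ^ (3 * m + 1) * sphereEnergy F x ≤
      kernelConst m * ∫⁻ p, F p * (ENNReal.ofReal (dist p.1 p.2 ^ (2 * m)))⁻¹
        ∂((sphereMeasure m).prod (sphereMeasure m)) := by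
  set near := {q : Euc (m + 1) × Euc (m + 1) × Euc (m + 1) |
    dist q.2.1 q.1 ≤ 8 * bdHeight q.1 ∧ dist q.2.2 q.1 ≤ 8 * bdHeight q.1}
  have hmeas : Measurable fun q : Euc (m + 1) × Euc (m + 1) × Euc (m + 1) =>
      (ENNReal.ofReal (bdHeight q.1))⁻¹ ^ (3 * m + 1) *
        near.indicator (fun q => F q.2) q := by
    have h1 : Measurable fun q : Euc (m + 1) × Euc (m + 1) × Euc (m + 1) => bdHeight q.1 :=
      measurable_bdHeight.comp measurable_fst
    exact (h1.ennreal_ofReal.inv.pow_const _).mul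
      ((hF.comp measurable_snd).indicator measurableSet_near)
  calc _ = ∫⁻ x in ball (0 : Euc (m + 1)) 1, ∫⁻ p,
        (ENNReal.ofReal (bdHeight x))⁻¹ ^ (3 * m + 1) *
          near.indicator (fun q => F q.2) (x, p)
          ∂((sphereMeasure m).prod (sphereMeasure m)) := by
        refine lintegral_congr fun x => ?_
        rw [lintegral_const_mul, sphereEnergy]
        exact ((hF.comp measurable_snd).indicator measurableSet_near).comp measurable_prodMk_left
    _ = ∫⁻ p, (∫⁻ x in ball (0 : Euc (m + 1)) 1,
        (ENNReal.ofReal (bdHeight x))⁻¹ ^ (3 * m + 1) *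
          near.indicator (fun q => F q.2) (x, p))
          ∂((sphereMeasure m).prod (sphereMeasure m)) :=
        lintegral_lintegral_swap hmeas.aemeasurable
    _ ≤ ∫⁻ p, kernelConst m * (F p * (ENNReal.ofReal (dist p.1 p.2 ^ (2 * m)))⁻¹)
        ∂((sphereMeasure m).prod (sphereMeasure m)) := by
        refine lintegral_mono fun p => ?_
        obtain ⟨θ, θ'⟩ := p
        rcases eq_or_ne θ θ' with rfl | hne
        · simp [indicator, hF0]
        · have hs : 0 < dist θ θ' := dist_pos.2 hne
          calc _ ≤ ∫⁻ x in ball (0 : Euc (m + 1)) 1, F (θ, θ') *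
                ENNReal.ofReal ((24 / (dist θ θ' + ‖x - θ‖)) ^ (3 * m + 1)) := by
                refine setLIntegral_mono (by fun_prop) fun x hx => ?_
                by_cases hn : (x, θ, θ') ∈ near
                · rw [indicator_of_mem hn, mul_comm]
                  gcongr
                  rw [← ENNReal.ofReal_inv_of_pos (bdHeight_pos hx),
                    ← ENNReal.ofReal_pow (by have := bdHeight_pos hx; positivity)]
                  have hh := bdHeight_pos hx
                  gcongr
                  rw [inv_eq_one_div, div_le_div_iff₀ hh (by positivity)]
                  have h1 : dist θ x ≤ 8 * bdHeight x := hn.1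
                  have h2 : dist θ' x ≤ 8 * bdHeight x := hn.2
                  have h3 := dist_triangle_right θ θ' x
                  rw [← dist_eq_norm, dist_comm x θ]
                  linarith
                · rw [indicator_of_notMem hn]; simp
            _ ≤ ∫⁻ x, F (θ, θ') *
                ENNReal.ofReal ((24 / (dist θ θ' + ‖x - θ‖)) ^ (3 * m + 1)) :=
                setLIntegral_le_lintegral _ _
            _ = _ := by
                rw [lintegral_const_mul _ (by fun_prop), lintegral_kernel_eq θ hs]
                ring
    _ = _ := by
        refine lintegral_const_mul _ ?_
        fun_prop

end LocalEnergy

section Mollifier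

variable {m : ℕ}

/-- A smooth bump function on `ℝ^{m+1}` supported in the unit ball, of integral one. -/
def mollifier (m : ℕ) : Euc (m + 1) → ℝ :=
  (⟨1 / 2, 1, by norm_num, by norm_num⟩ : ContDiffBump (0 : Euc (m + 1))).normed volume

theorem contDiff_mollifier : ContDiff ℝ 1 (mollifier m) := ContDiffBump.contDiff_normed _

theorem mollifier_nonneg (y : Euc (m + 1)) : 0 ≤ mollifier m y := ContDiffBump.nonneg_normed _ _

theorem integral_mollifier : ∫ y, mollifier m y = 1 := ContDiffBump.integral_normed _

theorem tsupport_mollifier : tsupport (mollifier m) = closedBall 0 1 :=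
  ContDiffBump.tsupport_normed_eq _

theorem mollifier_eq_zero {y : Euc (m + 1)} (hy : 1 < ‖y‖) : mollifier m y = 0 := by
  apply image_eq_zero_of_notMem_tsupport
  rw [tsupport_mollifier]
  simpa using hy

theorem fderiv_mollifier_eq_zero {y : Euc (m + 1)} (hy : 1 < ‖y‖) :
    fderiv ℝ (mollifier m) y = 0 := by
  apply fderiv_of_notMem_tsupport
  rw [tsupport_mollifier]
  simpa using hy

theorem exists_mollifier_bound (m : ℕ) : ∃ M : ℝ, 0 < M ∧ ∀ y : Euc (m + 1),
    mollifier m y ≤ M ∧ ‖fderiv ℝ (mollifier m) y‖ ≤ M := by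
  have hc : HasCompactSupport (mollifier m) := by
    rw [HasCompactSupport, tsupport_mollifier]
    exact isCompact_closedBall _ _
  obtain ⟨M₁, h₁⟩ := hc.exists_bound_of_continuous contDiff_mollifier.continuous
  obtain ⟨M₂, h₂⟩ := (hc.fderiv ℝ).exists_bound_of_continuous
    (contDiff_mollifier.continuous_fderiv one_ne_zero)
  refine ⟨max 1 (max M₁ M₂), by positivity, fun y => ⟨?_, ?_⟩⟩
  · exact ((le_abs_self _).trans (h₁ y)).trans (by simp)
  · exact (h₂ y).trans (by simp)

/-- The averaging kernel at scale `bdHeight x` around `x`. -/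
def avgKernel (x z : Euc (m + 1)) : ℝ :=
  (bdHeight x)⁻¹ ^ (m + 1) * mollifier m ((bdHeight x)⁻¹ • (z - x))

theorem avgKernel_nonneg {x : Euc (m + 1)} (hx : x ∈ ball (0 : Euc (m + 1)) 1)
    (z : Euc (m + 1)) : 0 ≤ avgKernel x z := by
  have := bdHeight_pos hx
  exact mul_nonneg (by positivity) (mollifier_nonneg _)

theorem one_lt_norm_smul_of_notMem {x z : Euc (m + 1)} (hx : x ∈ ball (0 : Euc (m + 1)) 1)
    (hz : z ∉ closedBall x (bdHeight x)) : 1 < ‖(bdHeight x)⁻¹ • (z - x)‖ := by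
  have hh := bdHeight_pos hx
  rw [norm_smul, norm_inv, Real.norm_eq_abs, abs_of_pos hh, lt_inv_mul_iff₀ hh, mul_one,
    ← dist_eq_norm]
  simpa using hz

theorem avgKernel_eq_zero {x z : Euc (m + 1)} (hx : x ∈ ball (0 : Euc (m + 1)) 1)
    (hz : z ∉ closedBall x (bdHeight x)) : avgKernel x z = 0 := by
  rw [avgKernel, mollifier_eq_zero (one_lt_norm_smul_of_notMem hx hz), mul_zero]

theorem closedBall_bdHeight_subset' {x : Euc (m + 1)} (hx : x ∈ ball (0 : Euc (m + 1)) 1) :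
    closedBall x (bdHeight x) ⊆ ball 0 1 :=
  (closedBall_subset_closedBall (by have := bdHeight_pos hx; linarith)).trans
    (closedBall_bdHeight_subset hx)

theorem integral_avgKernel {x : Euc (m + 1)} (hx : x ∈ ball (0 : Euc (m + 1)) 1) :
    ∫ z in ball (0 : Euc (m + 1)) 1, avgKernel x z = 1 := by
  have hh := bdHeight_pos hx
  rw [setIntegral_eq_integral_of_forall_compl_eq_zero fun z hz =>
    avgKernel_eq_zero hx fun h => hz (closedBall_bdHeight_subset' hx h)]
  simp only [avgKernel]
  rw [integral_const_mul, integral_sub_right_eq_self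
    (fun z => mollifier m ((bdHeight x)⁻¹ • z)) x, Measure.integral_comp_inv_smul,
    integral_mollifier]
  simp [abs_of_pos hh, hh.ne']

theorem hasFDerivAt_bdHeight (x : Euc (m + 1)) :
    HasFDerivAt bdHeight ((-(1 / 2) : ℝ) • innerSL ℝ x) x := by
  have h := ((hasStrictFDerivAt_norm_sq x).hasFDerivAt.const_sub 1).mul_const (1 / 4 : ℝ)
  have e : (bdHeight : Euc (m + 1) → ℝ) = fun y => (1 - ‖y‖ ^ 2) * (1 / 4) := by
    funext y; rw [bdHeight]; ring
  rw [e]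
  refine h.congr_fderiv ?_
  ext y
  simp
  ring

theorem continuous_bdHeight : Continuous (bdHeight : Euc (m + 1) → ℝ) := by
  unfold bdHeight; fun_prop

/-- The derivative of `x ↦ (bdHeight x)⁻¹`. -/
def invHeightDeriv (x : Euc (m + 1)) : Euc (m + 1) →L[ℝ] ℝ :=
  (-(bdHeight x ^ 2)⁻¹) • ((-(1 / 2) : ℝ) • innerSL ℝ x)

theorem hasFDerivAt_invHeight {x : Euc (m + 1)} (hx : x ∈ ball (0 : Euc (m + 1)) 1) :
    HasFDerivAt (fun x : Euc (m + 1) => (bdHeight x)⁻¹) (invHeightDeriv x) x :=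
  (hasDerivAt_inv (bdHeight_pos hx).ne').comp_hasFDerivAt x (hasFDerivAt_bdHeight x)

theorem norm_invHeightDeriv_le {x : Euc (m + 1)} (hx : x ∈ ball (0 : Euc (m + 1)) 1) :
    ‖invHeightDeriv x‖ ≤ (bdHeight x)⁻¹ ^ 2 := by
  have hx' : ‖x‖ < 1 := by simpa using hx
  rw [invHeightDeriv, norm_smul, norm_smul, innerSL_apply_norm, norm_neg, norm_inv, norm_pow,
    Real.norm_eq_abs, abs_of_pos (bdHeight_pos hx), inv_pow]
  refine mul_le_of_le_one_right (by positivity) ?_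
  rw [norm_neg]
  norm_num
  linarith

/-- The derivative of `avgKernel` in its first variable. -/
def avgKernelDeriv (x z : Euc (m + 1)) : Euc (m + 1) →L[ℝ] ℝ :=
  (bdHeight x)⁻¹ ^ (m + 1) • (fderiv ℝ (mollifier m) ((bdHeight x)⁻¹ • (z - x))).comp
      ((bdHeight x)⁻¹ • (-ContinuousLinearMap.id ℝ (Euc (m + 1))) +
        (invHeightDeriv x).smulRight (z - x)) +
    mollifier m ((bdHeight x)⁻¹ • (z - x)) •
      (((m + 1 : ℕ) * (bdHeight x)⁻¹ ^ m) • invHeightDeriv x)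

theorem hasFDerivAt_avgKernel {x : Euc (m + 1)} (hx : x ∈ ball (0 : Euc (m + 1)) 1)
    (z : Euc (m + 1)) : HasFDerivAt (fun x => avgKernel x z) (avgKernelDeriv x z) x := by
  have h1 := hasFDerivAt_invHeight hx
  have h2 : HasFDerivAt (fun x : Euc (m + 1) => z - x)
      (-ContinuousLinearMap.id ℝ (Euc (m + 1))) x := (hasFDerivAt_id x).const_sub z
  have h3 := ((contDiff_mollifier (m := m)).differentiable one_ne_zero
    ((bdHeight x)⁻¹ • (z - x))).hasFDerivAt.comp x (h1.smul h2)
  have h4 := h1.pow (m + 1)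
  refine (h4.mul h3).congr_fderiv ?_
  ext y
  simp [avgKernelDeriv]

theorem avgKernelDeriv_eq_zero {x z : Euc (m + 1)} (hx : x ∈ ball (0 : Euc (m + 1)) 1)
    (hz : z ∉ closedBall x (bdHeight x)) : avgKernelDeriv x z = 0 := by
  have := one_lt_norm_smul_of_notMem hx hz
  rw [avgKernelDeriv, mollifier_eq_zero this, fderiv_mollifier_eq_zero this]
  simp

theorem continuous_avgKernel (x : Euc (m + 1)) : Continuous (avgKernel x) := by
  have := (contDiff_mollifier (m := m)).continuous
  unfold avgKernel; fun_prop

theorem continuous_avgKernelDeriv (x : Euc (m + 1)) : Continuous (avgKernelDeriv x) := by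
  have := (contDiff_mollifier (m := m)).continuous
  have := (contDiff_mollifier (m := m)).continuous_fderiv one_ne_zero
  unfold avgKernelDeriv; fun_prop

theorem exists_avgKernel_bound (m : ℕ) : ∃ M : ℝ, 0 < M ∧
    ∀ x ∈ ball (0 : Euc (m + 1)) 1, ∀ z,
      avgKernel x z ≤ M * (bdHeight x)⁻¹ ^ (m + 1) ∧
      ‖avgKernelDeriv x z‖ ≤ M * (bdHeight x)⁻¹ ^ (m + 2) := by
  obtain ⟨M, hM, hb⟩ := exists_mollifier_bound m
  refine ⟨(m + 3) * M, by positivity, fun x hx z => ?_⟩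
  have hh := bdHeight_pos hx
  set a := (bdHeight x)⁻¹ with ha
  have ha0 : 0 < a := inv_pos.2 hh
  obtain ⟨h1, h2⟩ := hb (a • (z - x))
  have hm0 : (0 : ℝ) ≤ m := m.cast_nonneg
  constructor
  · rw [avgKernel, mul_comm]
    gcongr
    nlinarith
  by_cases hz : z ∈ closedBall x (bdHeight x)
  swap
  · rw [avgKernelDeriv_eq_zero hx hz, norm_zero]; positivity
  have hzx : ‖z - x‖ ≤ a⁻¹ := by rwa [ha, inv_inv, ← dist_eq_norm]
  have hd := norm_invHeightDeriv_le hx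
  have h5 : ‖a • (-ContinuousLinearMap.id ℝ (Euc (m + 1))) +
        (invHeightDeriv x).smulRight (z - x)‖ ≤ 2 * a := by
    refine (norm_add_le _ _).trans ?_
    rw [norm_smul, norm_neg, Real.norm_eq_abs, abs_of_pos ha0,
      ContinuousLinearMap.norm_smulRight_apply]
    have : ‖invHeightDeriv x‖ * ‖z - x‖ ≤ a ^ 2 * a⁻¹ := by gcongr
    have e : a ^ 2 * a⁻¹ = a := by field_simp
    have := ContinuousLinearMap.norm_id_le (𝕜 := ℝ) (E := Euc (m + 1))
    nlinarith
  refine (norm_add_le _ _).trans ?_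
  rw [norm_smul, norm_smul, norm_smul, norm_pow, norm_mul, norm_pow, Real.norm_eq_abs,
    abs_of_pos ha0, Real.norm_eq_abs, abs_of_nonneg (mollifier_nonneg _), Real.norm_natCast]
  calc _ ≤ a ^ (m + 1) * (M * (2 * a)) + M * (((m + 1 : ℕ) : ℝ) * a ^ m * a ^ 2) := by
        gcongr
        exact (ContinuousLinearMap.opNorm_comp_le _ _).trans (by gcongr)
    _ = _ := by push_cast; ring

end Mollifier

section BallAverage

variable {m ν : ℕ}

/-- The uniform probability measure on the closed ball of radius `bdHeight x` around `x`. -/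
abbrev ballUniform (x : Euc (m + 1)) : Measure (Euc (m + 1)) :=
  (volume (closedBall x (bdHeight x)))⁻¹ • volume.restrict (closedBall x (bdHeight x))

theorem isProbabilityMeasure_ballUniform {x : Euc (m + 1)} (hx : x ∈ ball (0 : Euc (m + 1)) 1) :
    IsProbabilityMeasure (ballUniform x) :=
  ProbabilityTheory.cond_isProbabilityMeasure_of_finite
    (measure_closedBall_pos _ _ (bdHeight_pos hx)).ne' measure_closedBall_lt_top.ne

theorem volume_closedBall_bdHeight {x : Euc (m + 1)} (hx : x ∈ ball (0 : Euc (m + 1)) 1) :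
    volume (closedBall x (bdHeight x)) =
      ENNReal.ofReal (bdHeight x) ^ (m + 1) * volume (closedBall (0 : Euc (m + 1)) 1) := by
  rw [Measure.addHaar_closedBall' volume _ (bdHeight_pos hx).le,
    ENNReal.ofReal_pow (bdHeight_pos hx).le]
  simp

theorem lintegral_ballUniform {x : Euc (m + 1)} (f : Euc (m + 1) → ℝ≥0∞) :
    ∫⁻ z, f z ∂(ballUniform x) = (volume (closedBall x (bdHeight x)))⁻¹ *
      ∫⁻ z in closedBall x (bdHeight x), f z := by
  rw [lintegral_smul_measure, smul_eq_mul]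

/-- The average of `w` at scale `bdHeight x` around `x`. -/
def ballAverage (w : Euc (m + 1) → Euc ν) (x : Euc (m + 1)) : Euc ν :=
  ∫ z in ball (0 : Euc (m + 1)) 1, avgKernel x z • w z

theorem norm_avgKernel_le {M : ℝ} (hM : ∀ x ∈ ball (0 : Euc (m + 1)) 1, ∀ z,
      avgKernel x z ≤ M * (bdHeight x)⁻¹ ^ (m + 1) ∧
      ‖avgKernelDeriv x z‖ ≤ M * (bdHeight x)⁻¹ ^ (m + 2))
    {x : Euc (m + 1)} (hx : x ∈ ball (0 : Euc (m + 1)) 1) (z : Euc (m + 1)) :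
    ‖avgKernel x z‖ ≤ M * (bdHeight x)⁻¹ ^ (m + 1) := by
  rw [Real.norm_eq_abs, abs_of_nonneg (avgKernel_nonneg hx z)]
  exact (hM x hx z).1

theorem integrable_avgKernel_smul {w : Euc (m + 1) → Euc ν} (hw : Measurable w) {C : ℝ}
    (hC : ∀ z, ‖w z‖ ≤ C) {x : Euc (m + 1)} (hx : x ∈ ball (0 : Euc (m + 1)) 1) :
    Integrable (fun z => avgKernel x z • w z)
      (volume.restrict (ball (0 : Euc (m + 1)) 1)) := by
  obtain ⟨M, hM0, hM⟩ := exists_avgKernel_bound m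
  have : IsFiniteMeasure (volume.restrict (ball (0 : Euc (m + 1)) 1)) :=
    ⟨by simpa using measure_ball_lt_top⟩
  refine Integrable.of_bound (C := M * (bdHeight x)⁻¹ ^ (m + 1) * C)
    ((continuous_avgKernel x).measurable.smul hw).aestronglyMeasurable (ae_of_all _ fun z => ?_)
  rw [norm_smul]
  have := bdHeight_pos hx
  gcongr
  · exact norm_avgKernel_le hM hx z
  · exact hC z

theorem hasFDerivAt_ballAverage {w : Euc (m + 1) → Euc ν} (hw : Measurable w) {C : ℝ}
    (hC : ∀ z, ‖w z‖ ≤ C) {x : Euc (m + 1)} (hx : x ∈ ball (0 : Euc (m + 1)) 1) :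
    HasFDerivAt (ballAverage w)
      (∫ z in ball (0 : Euc (m + 1)) 1, (avgKernelDeriv x z).smulRight (w z)) x := by
  obtain ⟨M, hM0, hM⟩ := exists_avgKernel_bound m
  have : IsFiniteMeasure (volume.restrict (ball (0 : Euc (m + 1)) 1)) :=
    ⟨by simpa using measure_ball_lt_top⟩
  have hh := bdHeight_pos hx
  have hC0 : 0 ≤ C := (norm_nonneg _).trans (hC 0)
  have hs : ball (0 : Euc (m + 1)) 1 ∩ {y | bdHeight x / 2 < bdHeight y} ∈ 𝓝 x :=
    inter_mem (isOpen_ball.mem_nhds hx)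
      ((isOpen_lt continuous_const continuous_bdHeight).mem_nhds (by simpa using hh))
  refine hasFDerivAt_integral_of_dominated_of_fderiv_le
    (F := fun x z => avgKernel x z • w z)
    (F' := fun x z => (avgKernelDeriv x z).smulRight (w z))
    (bound := fun _ => M * (bdHeight x / 2)⁻¹ ^ (m + 2) * C) hs ?_
    (integrable_avgKernel_smul hw hC hx) ?_ ?_ (integrable_const _) ?_
  · filter_upwards with y
    exact ((continuous_avgKernel y).measurable.smul hw).aestronglyMeasurable
  · have h1 : Continuous fun p : (Euc (m + 1) →L[ℝ] ℝ) × Euc ν => p.1.smulRight p.2 := by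
      fun_prop
    exact h1.comp_aestronglyMeasurable (f := fun z => (avgKernelDeriv x z, w z))
      ((continuous_avgKernelDeriv x).aestronglyMeasurable.prodMk hw.aestronglyMeasurable)
  · refine ae_of_all _ fun z y hy => ?_
    rw [ContinuousLinearMap.norm_smulRight_apply]
    have h1 := (hM y hy.1 z).2
    have h2 : (bdHeight y)⁻¹ ≤ (bdHeight x / 2)⁻¹ := by
      have : bdHeight x / 2 < bdHeight y := hy.2
      gcongr
    have := bdHeight_pos hy.1
    calc _ ≤ M * (bdHeight y)⁻¹ ^ (m + 2) * C := by gcongr; exact hC z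
      _ ≤ _ := by gcongr
  · exact ae_of_all _ fun z y hy => (hasFDerivAt_avgKernel hy.1 z).smul_const (w z)

/-- A constant for the local `L^1` estimates of averages. -/
theorem exists_ballAverage_bound (m : ℕ) : ∃ K : ℝ, 0 < K ∧
    ∀ (ν : ℕ) (w : Euc (m + 1) → Euc ν), Measurable w → (∃ C, ∀ z, ‖w z‖ ≤ C) →
      ∀ x ∈ ball (0 : Euc (m + 1)) 1, ∀ c : Euc ν,
        ‖ballAverage w x - c‖ₑ ≤ ENNReal.ofReal K * ∫⁻ z, ‖w z - c‖ₑ ∂(ballUniform x) ∧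
        ‖fderiv ℝ (ballAverage w) x‖ₑ ≤ ENNReal.ofReal K * (ENNReal.ofReal (bdHeight x))⁻¹ *
          ∫⁻ z, ‖w z - c‖ₑ ∂(ballUniform x) := by
  obtain ⟨M, hM0, hM⟩ := exists_avgKernel_bound m
  set ω := volume (closedBall (0 : Euc (m + 1)) 1)
  have hω : ω ≠ ⊤ := measure_closedBall_lt_top.ne
  have hω0 : ω ≠ 0 := (measure_closedBall_pos _ _ one_pos).ne'
  have hωr : 0 < ω.toReal := ENNReal.toReal_pos hω0 hω
  refine ⟨M * ω.toReal, by positivity, fun ν w hw ⟨C, hC⟩ x hx c => ?_⟩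
  have hh := bdHeight_pos hx
  have hH0 : ENNReal.ofReal (bdHeight x) ≠ 0 := by simpa using hh
  have hH : ENNReal.ofReal (bdHeight x) ≠ ⊤ := ENNReal.ofReal_ne_top
  have hK : ENNReal.ofReal (M * ω.toReal) = ENNReal.ofReal M * ω := by
    rw [ENNReal.ofReal_mul hM0.le, ENNReal.ofReal_toReal hω]
  have hnorm : ∀ f : Euc (m + 1) → ℝ≥0∞, (ENNReal.ofReal (bdHeight x))⁻¹ ^ (m + 1) *
      ∫⁻ z in closedBall x (bdHeight x), f z = ω * ∫⁻ z, f z ∂(ballUniform x) := by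
    intro f
    rw [lintegral_ballUniform, volume_closedBall_bdHeight hx, ENNReal.mul_inv
      (Or.inr hω) (Or.inr hω0), ← mul_assoc, mul_left_comm, ENNReal.mul_inv_cancel hω0 hω, mul_one,
      ENNReal.inv_pow]
  have hb1 : ∀ y ∈ ball (0 : Euc (m + 1)) 1, ballAverage (fun z => w z - c) y =
      ballAverage w y - c := by
    intro y hy
    have hk : Integrable (fun z => avgKernel y z • c)
        (volume.restrict (ball (0 : Euc (m + 1)) 1)) :=
      integrable_avgKernel_smul measurable_const (fun _ => le_rfl) hy
    simp only [ballAverage, smul_sub]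
    rw [integral_sub (integrable_avgKernel_smul hw hC hy) hk, integral_smul_const,
      integral_avgKernel hy, one_smul]
  have hwc : Measurable fun z => w z - c := hw.sub_const c
  have hwcb : ∀ z, ‖w z - c‖ ≤ C + ‖c‖ := fun z =>
    (norm_sub_le _ _).trans (by gcongr; exact hC z)
  constructor
  · rw [← hb1 x hx, ballAverage, hK, mul_assoc, ← hnorm]
    refine (enorm_integral_le_lintegral_enorm _).trans ?_
    calc _ ≤ ∫⁻ z in ball (0 : Euc (m + 1)) 1, (closedBall x (bdHeight x)).indicator
          (fun z => ENNReal.ofReal (M * (bdHeight x)⁻¹ ^ (m + 1)) * ‖w z - c‖ₑ) z := by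
          refine lintegral_mono fun z => ?_
          by_cases hz : z ∈ closedBall x (bdHeight x)
          · rw [indicator_of_mem hz, enorm_smul]
            gcongr
            rw [← ofReal_norm]
            exact ENNReal.ofReal_le_ofReal (norm_avgKernel_le hM hx z)
          · simp [avgKernel_eq_zero hx hz]
      _ ≤ _ := setLIntegral_le_lintegral _ _
      _ = _ := by
          rw [lintegral_indicator isClosed_closedBall.measurableSet,
            lintegral_const_mul _ hwc.enorm, ENNReal.ofReal_mul hM0.le,
            ENNReal.ofReal_pow (by positivity), ENNReal.ofReal_inv_of_pos hh, mul_assoc]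
  · have hfd : fderiv ℝ (ballAverage w) x =
        ∫ z in ball (0 : Euc (m + 1)) 1, (avgKernelDeriv x z).smulRight (w z - c) := by
      have h1 := (hasFDerivAt_ballAverage hwc hwcb hx).add_const c
      refine HasFDerivAt.fderiv (h1.congr_of_eventuallyEq ?_)
      filter_upwards [isOpen_ball.mem_nhds hx] with y hy
      rw [hb1 y hy, sub_add_cancel]
    rw [hfd, hK, mul_assoc, mul_assoc, mul_left_comm ω, ← hnorm]
    refine (enorm_integral_le_lintegral_enorm _).trans ?_
    calc _ ≤ ∫⁻ z in ball (0 : Euc (m + 1)) 1, (closedBall x (bdHeight x)).indicator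
          (fun z => ENNReal.ofReal (M * (bdHeight x)⁻¹ ^ (m + 2)) * ‖w z - c‖ₑ) z := by
          refine lintegral_mono fun z => ?_
          by_cases hz : z ∈ closedBall x (bdHeight x)
          · rw [indicator_of_mem hz, ← ofReal_norm,
              ContinuousLinearMap.norm_smulRight_apply, ← ofReal_norm,
              ← ENNReal.ofReal_mul (by positivity)]
            gcongr
            exact (hM x hx z).2
          · rw [← ofReal_norm, ContinuousLinearMap.norm_smulRight_apply,
              avgKernelDeriv_eq_zero hx hz]
            simp
      _ ≤ _ := setLIntegral_le_lintegral _ _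
      _ = _ := by
          rw [lintegral_indicator isClosed_closedBall.measurableSet,
            lintegral_const_mul _ hwc.enorm, ENNReal.ofReal_mul hM0.le,
            ENNReal.ofReal_pow (by positivity), ENNReal.ofReal_inv_of_pos hh]
          ring

end BallAverage

section PairAverage

variable {m ν : ℕ}

theorem pow_lintegral_le_lintegral_pow {α : Type*} [MeasurableSpace α] {μ : Measure α}
    [IsProbabilityMeasure μ] {f : α → ℝ≥0∞} (hf : Measurable f) (n : ℕ) :
    (∫⁻ x, f x ∂μ) ^ (n + 1) ≤ ∫⁻ x, f x ^ (n + 1) ∂μ := by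
  have h := eLpNorm'_le_eLpNorm'_of_exponent_le (p := 1) (q := (n + 1 : ℕ)) zero_lt_one
    (by simp) μ hf.aestronglyMeasurable
  simp only [eLpNorm', enorm_eq_self, ENNReal.rpow_natCast, ENNReal.rpow_one, div_one] at h
  have h2 := pow_le_pow_left' h (n + 1)
  rwa [← ENNReal.rpow_natCast (_ ^ _), ← ENNReal.rpow_mul, one_div,
    inv_mul_cancel₀ (by positivity), ENNReal.rpow_one] at h2

/-- A constant comparing averages over balls with integrals over the sphere. -/
def pairConst (m : ℕ) : ℝ≥0∞ :=
  2 ^ (m + 1) * (volume (closedBall (0 : Euc (m + 1)) 1))⁻¹ * shellConst m * 6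

theorem pairConst_ne_top : pairConst m ≠ ⊤ := by
  have h := (measure_closedBall_pos (volume : Measure (Euc (m + 1))) 0 one_pos).ne'
  have := shellConst_ne_top (m := m)
  unfold pairConst
  finiteness

theorem inv_volume_mul_shell_le {x y : Euc (m + 1)} (hx : x ∈ ball (0 : Euc (m + 1)) 1)
    (hy : y ∈ ball (0 : Euc (m + 1)) 1) (hxy : bdHeight y ≤ 2 * bdHeight x) :
    (volume (closedBall x (bdHeight x)))⁻¹ *
        (shellConst m * ENNReal.ofReal (6 * bdHeight y)) ≤
      pairConst m * (ENNReal.ofReal (bdHeight y))⁻¹ ^ m := by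
  have hhx := bdHeight_pos hx
  have hhy := bdHeight_pos hy
  have hω := (measure_closedBall_pos (volume : Measure (Euc (m + 1))) 0 one_pos).ne'
  have hω' := (measure_closedBall_lt_top (μ := (volume : Measure (Euc (m + 1))))
    (x := 0) (r := 1)).ne
  have h1 : (ENNReal.ofReal (bdHeight x))⁻¹ ≤ 2 * (ENNReal.ofReal (bdHeight y))⁻¹ := by
    rw [← ENNReal.ofReal_inv_of_pos hhx, ← ENNReal.ofReal_inv_of_pos hhy]
    calc _ ≤ ENNReal.ofReal (2 * (bdHeight y)⁻¹) := by
          apply ENNReal.ofReal_le_ofReal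
          field_simp
          linarith
      _ = _ := by rw [ENNReal.ofReal_mul (by norm_num), ENNReal.ofReal_ofNat]
  have hH0 : ENNReal.ofReal (bdHeight y) ≠ 0 := by simpa using hhy
  rw [volume_closedBall_bdHeight hx, ENNReal.mul_inv (Or.inr hω') (Or.inr hω),
    ENNReal.inv_pow, ENNReal.ofReal_mul (by norm_num), pairConst]
  set ω := volume (closedBall (0 : Euc (m + 1)) 1)
  set Hx := ENNReal.ofReal (bdHeight x)
  set Hy := ENNReal.ofReal (bdHeight y)
  calc _ ≤ (2 * Hy⁻¹) ^ (m + 1) * ω⁻¹ * (shellConst m * (ENNReal.ofReal 6 * Hy)) := by gcongr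
    _ = 2 ^ (m + 1) * ω⁻¹ * shellConst m * 6 * Hy⁻¹ ^ m * (Hy⁻¹ * Hy) := by
      rw [ENNReal.ofReal_ofNat]; ring
    _ = _ := by rw [ENNReal.inv_mul_cancel hH0 ENNReal.ofReal_ne_top, mul_one]

theorem pairAverage_le {F : Euc (m + 1) × Euc (m + 1) → ℝ≥0∞} (hF : Measurable F)
    {x y : Euc (m + 1)} (hx : x ∈ ball (0 : Euc (m + 1)) 1)
    (hy : y ∈ ball (0 : Euc (m + 1)) 1) (hxy : bdHeight y ≤ 2 * bdHeight x)
    (hsub : closedBall x (bdHeight x) ⊆ closedBall y (2 * bdHeight y)) :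
    ∫⁻ z, ∫⁻ z', F (‖z‖⁻¹ • z, ‖z'‖⁻¹ • z') ∂(ballUniform x) ∂(ballUniform x) ≤
      pairConst m ^ 2 * (ENNReal.ofReal (bdHeight y))⁻¹ ^ (2 * m) * sphereEnergy F y := by
  simp_rw [lintegral_ballUniform]
  have hm : Measurable fun z : Euc (m + 1) => ∫⁻ z' in closedBall x (bdHeight x),
      F (‖z‖⁻¹ • z, ‖z'‖⁻¹ • z') :=
    Measurable.lintegral_prod_right' (f := fun q : Euc (m + 1) × Euc (m + 1) =>
      F (‖q.1‖⁻¹ • q.1, ‖q.2‖⁻¹ • q.2)) (hF.comp (by fun_prop))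
  rw [lintegral_const_mul _ hm, ← mul_assoc, ← pow_two]
  calc _ ≤ (volume (closedBall x (bdHeight x)))⁻¹ ^ 2 *
        ((shellConst m * ENNReal.ofReal (6 * bdHeight y)) ^ 2 * sphereEnergy F y) := by
        gcongr
        refine le_trans ?_ (lintegral_pair_normalize_le hF hy)
        exact (lintegral_mono fun z => lintegral_mono_set hsub).trans (lintegral_mono_set hsub)
    _ = ((volume (closedBall x (bdHeight x)))⁻¹ *
        (shellConst m * ENNReal.ofReal (6 * bdHeight y))) ^ 2 * sphereEnergy F y := by ring
    _ ≤ (pairConst m * (ENNReal.ofReal (bdHeight y))⁻¹ ^ m) ^ 2 * sphereEnergy F y := by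
        exact mul_le_mul' (pow_le_pow_left' (inv_volume_mul_shell_le hx hy hxy) 2) le_rfl
    _ = _ := by ring

theorem singleAverage_le {g : Euc (m + 1) → ℝ≥0∞} (hg : Measurable g)
    {x : Euc (m + 1)} (hx : x ∈ ball (0 : Euc (m + 1)) 1) :
    ∫⁻ z, g (‖z‖⁻¹ • z) ∂(ballUniform x) ≤
      pairConst m * (ENNReal.ofReal (bdHeight x))⁻¹ ^ m *
        ∫⁻ θ in closedBall x (8 * bdHeight x), g θ ∂(sphereMeasure m) := by
  have hh := bdHeight_pos hx
  rw [lintegral_ballUniform]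
  calc _ ≤ (volume (closedBall x (bdHeight x)))⁻¹ *
        (shellConst m * ENNReal.ofReal (6 * bdHeight x) *
          ∫⁻ θ in closedBall x (8 * bdHeight x), g θ ∂(sphereMeasure m)) := by
        gcongr
        refine le_trans (lintegral_mono_set (closedBall_subset_closedBall (by linarith)))
          (lintegral_closedBall_normalize_le hx hg)
    _ ≤ _ := by
        rw [← mul_assoc]
        exact mul_le_mul' (inv_volume_mul_shell_le hx hx (by linarith)) le_rfl

/-- The numerator of the Gagliardo energy density. -/
def powDiff (u : Euc (m + 1) → Euc ν) (p : Euc (m + 1) × Euc (m + 1)) : ℝ≥0∞ :=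
  ENNReal.ofReal (dist (u p.1) (u p.2) ^ (m + 1))

/-- The indicator function of the gaps of size at least `δ`. -/
def gapIndicator (δ : ℝ) (u : Euc (m + 1) → Euc ν) (p : Euc (m + 1) × Euc (m + 1)) : ℝ≥0∞ :=
  {p : Euc (m + 1) × Euc (m + 1) | δ ≤ dist (u p.1) (u p.2)}.indicator 1 p

theorem measurable_powDiff {u : Euc (m + 1) → Euc ν} (hu : Measurable u) :
    Measurable (powDiff u) := by
  have h1 : Measurable fun p : Euc (m + 1) × Euc (m + 1) => u p.1 := hu.comp measurable_fst
  have h2 : Measurable fun p : Euc (m + 1) × Euc (m + 1) => u p.2 := hu.comp measurable_snd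
  exact ((h1.dist h2).pow_const _).ennreal_ofReal

theorem measurable_gapIndicator (δ : ℝ) {u : Euc (m + 1) → Euc ν} (hu : Measurable u) :
    Measurable (gapIndicator δ u) := by
  have h1 : Measurable fun p : Euc (m + 1) × Euc (m + 1) => u p.1 := hu.comp measurable_fst
  have h2 : Measurable fun p : Euc (m + 1) × Euc (m + 1) => u p.2 := hu.comp measurable_snd
  exact measurable_one.indicator (measurableSet_le measurable_const (h1.dist h2))

theorem measurable_distKernel : Measurable fun p : Euc (m + 1) × Euc (m + 1) =>
    (ENNReal.ofReal (dist p.1 p.2 ^ (2 * m)))⁻¹ := by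
  fun_prop

theorem gagliardoEnergySphere_eq {u : Euc (m + 1) → Euc ν} (hu : Measurable u) :
    gagliardoEnergySphere m ν u =
      ∫⁻ p, powDiff u p * (ENNReal.ofReal (dist p.1 p.2 ^ (2 * m)))⁻¹
        ∂((sphereMeasure m).prod (sphereMeasure m)) := by
  have hm : Measurable fun p : Euc (m + 1) × Euc (m + 1) =>
      powDiff u p * (ENNReal.ofReal (dist p.1 p.2 ^ (2 * m)))⁻¹ :=
    (measurable_powDiff hu).mul measurable_distKernel
  rw [lintegral_prod _ hm.aemeasurable]
  simp only [gagliardoEnergySphere, powDiff, div_eq_mul_inv]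

theorem gapPotentialSphere_eq (δ : ℝ) {u : Euc (m + 1) → Euc ν} (hu : Measurable u) :
    gapPotentialSphere m ν δ u =
      ∫⁻ p, gapIndicator δ u p * (ENNReal.ofReal (dist p.1 p.2 ^ (2 * m)))⁻¹
        ∂((sphereMeasure m).prod (sphereMeasure m)) := by
  have hm : Measurable fun p : Euc (m + 1) × Euc (m + 1) =>
      gapIndicator δ u p * (ENNReal.ofReal (dist p.1 p.2 ^ (2 * m)))⁻¹ :=
    (measurable_gapIndicator δ hu).mul measurable_distKernel
  rw [lintegral_prod _ hm.aemeasurable]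
  refine lintegral_congr fun x => lintegral_congr fun y => ?_
  simp only [gapIndicator, indicator, mem_ofPred_eq]
  split_ifs <;> simp

theorem powDiff_self (u : Euc (m + 1) → Euc ν) (θ : Euc (m + 1)) : powDiff u (θ, θ) = 0 := by
  simp [powDiff]

theorem gapIndicator_self {δ : ℝ} (hδ : 0 < δ) (u : Euc (m + 1) → Euc ν) (θ : Euc (m + 1)) :
    gapIndicator δ u (θ, θ) = 0 := by
  simp [gapIndicator, hδ]

theorem gapIndicator_le {δ : ℝ} (hδ : 0 < δ) (u : Euc (m + 1) → Euc ν)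
    (p : Euc (m + 1) × Euc (m + 1)) :
    gapIndicator δ u p ≤ ENNReal.ofReal (δ⁻¹ ^ (m + 1)) * powDiff u p := by
  rw [gapIndicator, powDiff, ← ENNReal.ofReal_mul (by positivity), ← mul_pow]
  by_cases h : δ ≤ dist (u p.1) (u p.2)
  · rw [indicator_of_mem (by exact h), Pi.one_apply, ENNReal.one_le_ofReal]
    apply one_le_pow₀
    rwa [le_inv_mul_iff₀ hδ, mul_one]
  · rw [indicator_of_notMem (by exact h)]
    simp

theorem gapPotentialSphere_le {δ : ℝ} (hδ : 0 < δ) {u : Euc (m + 1) → Euc ν}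
    (hu : Measurable u) :
    gapPotentialSphere m ν δ u ≤ ENNReal.ofReal (δ⁻¹ ^ (m + 1)) * gagliardoEnergySphere m ν u := by
  have hm : Measurable fun p : Euc (m + 1) × Euc (m + 1) =>
      powDiff u p * (ENNReal.ofReal (dist p.1 p.2 ^ (2 * m)))⁻¹ :=
    (measurable_powDiff hu).mul measurable_distKernel
  rw [gapPotentialSphere_eq δ hu, gagliardoEnergySphere_eq hu, ← lintegral_const_mul _ hm]
  refine lintegral_mono fun p => ?_
  rw [← mul_assoc]
  gcongr
  exact gapIndicator_le hδ u p

theorem enorm_sub_pow_eq (u : Euc (m + 1) → Euc ν) (θ θ' : Euc (m + 1)) :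
    ‖u θ - u θ'‖ₑ ^ (m + 1) = powDiff u (θ, θ') := by
  rw [powDiff, ← edist_eq_enorm_sub, edist_dist, ENNReal.ofReal_pow dist_nonneg]

/-- The radial extension of a map on the sphere. -/
def radialExt (u : Euc (m + 1) → Euc ν) (z : Euc (m + 1)) : Euc ν := u (‖z‖⁻¹ • z)

theorem measurable_radialExt {u : Euc (m + 1) → Euc ν} (hu : Measurable u) :
    Measurable (radialExt u) := hu.comp measurable_normalize

theorem enorm_pow_le_of_forall_le {K : ℝ≥0∞} {x : Euc (m + 1)}
    (hx : x ∈ ball (0 : Euc (m + 1)) 1) {u : Euc (m + 1) → Euc ν} (hu : Measurable u)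
    {a : ℝ≥0∞} (ha : ∀ c, a ≤ K * (ENNReal.ofReal (bdHeight x))⁻¹ *
      ∫⁻ z, ‖radialExt u z - c‖ₑ ∂(ballUniform x)) :
    a ^ (m + 1) ≤ K ^ (m + 1) * pairConst m ^ 2 *
      ((ENNReal.ofReal (bdHeight x))⁻¹ ^ (3 * m + 1) * sphereEnergy (powDiff u) x) := by
  have hw := measurable_radialExt hu
  have hh := bdHeight_pos hx
  have := isProbabilityMeasure_ballUniform hx
  have h1 : ∀ c, a ^ (m + 1) ≤ (K * (ENNReal.ofReal (bdHeight x))⁻¹) ^ (m + 1) *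
      ∫⁻ z, ‖radialExt u z - c‖ₑ ^ (m + 1) ∂(ballUniform x) := by
    intro c
    refine (pow_le_pow_left' (ha c) _).trans ?_
    rw [mul_pow]
    gcongr
    exact pow_lintegral_le_lintegral_pow (hw.sub_const c).enorm m
  have hm : Measurable fun z : Euc (m + 1) =>
      ∫⁻ z', powDiff u (‖z‖⁻¹ • z, ‖z'‖⁻¹ • z') ∂(ballUniform x) :=
    Measurable.lintegral_prod_right' (f := fun q : Euc (m + 1) × Euc (m + 1) =>
      powDiff u (‖q.1‖⁻¹ • q.1, ‖q.2‖⁻¹ • q.2)) ((measurable_powDiff hu).comp (by fun_prop))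
  calc a ^ (m + 1) = ∫⁻ _, a ^ (m + 1) ∂(ballUniform x) := by simp
    _ ≤ ∫⁻ z, (K * (ENNReal.ofReal (bdHeight x))⁻¹) ^ (m + 1) *
        ∫⁻ z', powDiff u (‖z‖⁻¹ • z, ‖z'‖⁻¹ • z') ∂(ballUniform x) ∂(ballUniform x) := by
        refine lintegral_mono fun z => (h1 (radialExt u z)).trans_eq ?_
        congr 1
        refine lintegral_congr fun z' => ?_
        rw [← enorm_sub_pow_eq, enorm_sub_rev]
        rfl
    _ = (K * (ENNReal.ofReal (bdHeight x))⁻¹) ^ (m + 1) * _ := lintegral_const_mul _ hm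
    _ ≤ (K * (ENNReal.ofReal (bdHeight x))⁻¹) ^ (m + 1) *
        (pairConst m ^ 2 * (ENNReal.ofReal (bdHeight x))⁻¹ ^ (2 * m) *
          sphereEnergy (powDiff u) x) := by
        gcongr
        exact pairAverage_le (measurable_powDiff hu) hx hx (by linarith)
          (closedBall_subset_closedBall (by linarith))
    _ = _ := by ring

theorem lintegral_const_mul_add_const_mul {α : Type*} [MeasurableSpace α] {μ : Measure α}
    [IsProbabilityMeasure μ] {f : α → ℝ≥0∞} (hf : Measurable f) (a b c : ℝ≥0∞) :
    ∫⁻ z, a * (b + c * f z) ∂μ = a * (b + c * ∫⁻ z, f z ∂μ) := by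
  rw [lintegral_const_mul _ ((hf.const_mul c).const_add b), lintegral_add_left measurable_const,
    lintegral_const_mul _ hf, lintegral_const, measure_univ, mul_one]

theorem enorm_sub_le_gapIndicator {u : Euc (m + 1) → Euc ν} {N : Set (Euc ν)}
    (huN : ∀ θ, u θ ∈ N) {D : ℝ} (hD : ∀ y ∈ N, ∀ y' ∈ N, dist y y' ≤ D) (δ : ℝ)
    (θ θ' : Euc (m + 1)) :
    ‖u θ' - u θ‖ₑ ≤ ENNReal.ofReal δ + ENNReal.ofReal D * gapIndicator δ u (θ, θ') := by
  rw [← ofReal_norm, ← dist_eq_norm, dist_comm, gapIndicator]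
  by_cases h : δ ≤ dist (u θ) (u θ')
  · rw [indicator_of_mem (by exact h), Pi.one_apply, mul_one]
    exact (ENNReal.ofReal_le_ofReal (hD _ (huN _) _ (huN _))).trans le_add_self
  · exact (ENNReal.ofReal_le_ofReal (not_le.1 h).le).trans le_self_add

theorem infDist_le_gapAverage {K : ℝ≥0∞} {x : Euc (m + 1)} (hx : x ∈ ball (0 : Euc (m + 1)) 1)
    {u : Euc (m + 1) → Euc ν} (hu : Measurable u) {N : Set (Euc ν)} (huN : ∀ θ, u θ ∈ N)
    {δ D : ℝ} (hD : ∀ y ∈ N, ∀ y' ∈ N, dist y y' ≤ D) {v : Euc ν}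
    (hv : ∀ c, ‖v - c‖ₑ ≤ K * ∫⁻ z, ‖radialExt u z - c‖ₑ ∂(ballUniform x)) :
    ENNReal.ofReal (infDist v N) ≤ K * (ENNReal.ofReal δ + ENNReal.ofReal D *
      ∫⁻ z, ∫⁻ z', gapIndicator δ u (‖z‖⁻¹ • z, ‖z'‖⁻¹ • z')
        ∂(ballUniform x) ∂(ballUniform x)) := by
  have := isProbabilityMeasure_ballUniform hx
  have hm2 : Measurable fun q : Euc (m + 1) × Euc (m + 1) =>
      gapIndicator δ u (‖q.1‖⁻¹ • q.1, ‖q.2‖⁻¹ • q.2) :=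
    (measurable_gapIndicator δ hu).comp (by fun_prop)
  have hm1 : ∀ z : Euc (m + 1), Measurable fun z' : Euc (m + 1) =>
      gapIndicator δ u (‖z‖⁻¹ • z, ‖z'‖⁻¹ • z') := by
    intro z
    have h : Measurable fun z' : Euc (m + 1) => (‖z‖⁻¹ • z, ‖z'‖⁻¹ • z') := by fun_prop
    exact (measurable_gapIndicator δ hu).comp h
  rw [← lintegral_const_mul_add_const_mul (Measurable.lintegral_prod_right' hm2)]
  calc ENNReal.ofReal (infDist v N)
      = ∫⁻ _, ENNReal.ofReal (infDist v N) ∂(ballUniform x) := by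
        rw [lintegral_const, measure_univ, mul_one]
    _ ≤ _ := lintegral_mono fun z => ?_
  have h1 : ENNReal.ofReal (infDist v N) ≤ ‖v - radialExt u z‖ₑ := by
    rw [← ofReal_norm, ← dist_eq_norm]
    exact ENNReal.ofReal_le_ofReal (infDist_le_dist_of_mem (huN _))
  refine (h1.trans (hv _)).trans (mul_le_mul' le_rfl ?_)
  have h2 := lintegral_const_mul_add_const_mul (μ := ballUniform x) (hm1 z) 1
    (ENNReal.ofReal δ) (ENNReal.ofReal D)
  simp only [one_mul] at h2
  rw [← h2]
  exact lintegral_mono fun z' => enorm_sub_le_gapIndicator huN hD δ _ _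

end PairAverage

section Counting

variable {m : ℕ}

theorem abs_bdHeight_sub_le {E : Type*} [NormedAddCommGroup E] {x y : E}
    (hx : x ∈ ball (0 : E) 1) (hy : y ∈ ball (0 : E) 1) :
    |bdHeight x - bdHeight y| ≤ ‖x - y‖ / 2 := by
  rw [mem_ball_zero_iff] at hx hy
  have h1 := norm_sub_norm_le x y
  have h2 := norm_sub_norm_le y x
  rw [norm_sub_rev] at h2
  have h3 := norm_nonneg x
  have h4 := norm_nonneg y
  unfold bdHeight
  rw [abs_le]
  constructor <;> nlinarith

/-- The constant of the counting estimate. -/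
def countConst (m : ℕ) : ℝ≥0∞ :=
  8 ^ (m + 1) * (volume (ball (0 : Euc (m + 1)) 1))⁻¹ * (pairConst m ^ 2 * kernelConst m)

theorem countConst_ne_top (hm : 1 ≤ m) : countConst m ≠ ⊤ := by
  have h1 : (volume (ball (0 : Euc (m + 1)) 1))⁻¹ ≠ ⊤ :=
    ENNReal.inv_ne_top.2 (measure_ball_pos _ _ one_pos).ne'
  exact ENNReal.mul_ne_top (ENNReal.mul_ne_top (by simp) h1)
    (ENNReal.mul_ne_top (ENNReal.pow_ne_top pairConst_ne_top) (kernelConst_ne_top hm))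

theorem volume_ball_le_lintegral_bdHeight {x : Euc (m + 1)} (hx : x ∈ ball (0 : Euc (m + 1)) 1) :
    volume (ball (0 : Euc (m + 1)) 1) ≤ 8 ^ (m + 1) *
      ∫⁻ y in ball x (bdHeight x / 4), (ENNReal.ofReal (bdHeight y))⁻¹ ^ (m + 1) := by
  have hh := bdHeight_pos hx
  have hv : volume (ball x (bdHeight x / 4)) = ENNReal.ofReal (bdHeight x / 4) ^ (m + 1) *
      volume (ball (0 : Euc (m + 1)) 1) := by
    rw [Measure.addHaar_ball_of_pos _ _ (by positivity), finrank_euclideanSpace_fin,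
      ENNReal.ofReal_pow (by positivity)]
  have h1 : ∀ y ∈ ball x (bdHeight x / 4), (ENNReal.ofReal (2 * bdHeight x))⁻¹ ^ (m + 1) ≤
      (ENNReal.ofReal (bdHeight y))⁻¹ ^ (m + 1) := by
    intro y hy
    have hyb : y ∈ ball (0 : Euc (m + 1)) 1 := closedBall_bdHeight_subset hx
      (ball_subset_closedBall (ball_subset_ball (by linarith) hy))
    have h2 := abs_bdHeight_sub_le hyb hx
    rw [mem_ball, dist_eq_norm] at hy
    have h3 := (abs_le.1 h2).2
    gcongr
    linarith
  have hc : ENNReal.ofReal (bdHeight x / 4) = 8⁻¹ * ENNReal.ofReal (2 * bdHeight x) := by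
    rw [show bdHeight x / 4 = 8⁻¹ * (2 * bdHeight x) by ring, ENNReal.ofReal_mul (by norm_num),
      ENNReal.ofReal_inv_of_pos (by norm_num)]
    norm_num
  have hpos : ENNReal.ofReal (2 * bdHeight x) ≠ 0 := by simpa using hh
  calc volume (ball (0 : Euc (m + 1)) 1)
      = 8 ^ (m + 1) * ((ENNReal.ofReal (2 * bdHeight x))⁻¹ ^ (m + 1) *
          volume (ball x (bdHeight x / 4))) := by
        rw [hv, hc, mul_pow, ← mul_assoc, ← mul_assoc, ← mul_assoc, ← mul_pow, ← mul_pow, ← mul_pow]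
        have : (8 : ℝ≥0∞) * (ENNReal.ofReal (2 * bdHeight x))⁻¹ * 8⁻¹ *
            ENNReal.ofReal (2 * bdHeight x) = 1 := by
          calc _ = (8 * 8⁻¹) * ((ENNReal.ofReal (2 * bdHeight x))⁻¹ *
              ENNReal.ofReal (2 * bdHeight x)) := by ring
            _ = 1 := by
              rw [ENNReal.mul_inv_cancel (by norm_num) (by norm_num),
                ENNReal.inv_mul_cancel hpos ENNReal.ofReal_ne_top, one_mul]
        rw [this, one_pow, one_mul]
    _ ≤ _ := by
        refine mul_le_mul' le_rfl ?_
        rw [← setLIntegral_const]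
        exact setLIntegral_mono' measurableSet_ball h1

theorem card_mul_le {F : Euc (m + 1) × Euc (m + 1) → ℝ≥0∞} (hF : Measurable F)
    (hF0 : ∀ θ, F (θ, θ) = 0) {s : Finset (Euc (m + 1))}
    (hs : ∀ x ∈ s, x ∈ ball (0 : Euc (m + 1)) 1)
    (hdisj : (s : Set (Euc (m + 1))).PairwiseDisjoint fun x => ball x (bdHeight x / 4))
    {c : ℝ≥0∞} (hc : ∀ x ∈ s, c ≤ ∫⁻ z, ∫⁻ z', F (‖z‖⁻¹ • z, ‖z'‖⁻¹ • z')
      ∂(ballUniform x) ∂(ballUniform x)) :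
    s.card * c ≤ countConst m * ∫⁻ p, F p * (ENNReal.ofReal (dist p.1 p.2 ^ (2 * m)))⁻¹
      ∂((sphereMeasure m).prod (sphereMeasure m)) := by
  have hV0 : volume (ball (0 : Euc (m + 1)) 1) ≠ 0 := (measure_ball_pos _ _ one_pos).ne'
  have hVt : volume (ball (0 : Euc (m + 1)) 1) ≠ ⊤ := measure_ball_lt_top.ne
  have hsub : ∀ x ∈ s, ball x (bdHeight x / 4) ⊆ ball 0 1 := by
    intro x hx
    have := bdHeight_pos (hs x hx)
    exact (ball_subset_closedBall.trans (closedBall_subset_closedBall (by linarith))).trans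
      (closedBall_bdHeight_subset (hs x hx))
  have hmH : Measurable fun y : Euc (m + 1) => (ENNReal.ofReal (bdHeight y))⁻¹ ^ (m + 1) := by
    have := measurable_bdHeight (m := m)
    fun_prop
  have h1 : ∀ x ∈ s, c * volume (ball (0 : Euc (m + 1)) 1) ≤ 8 ^ (m + 1) * pairConst m ^ 2 *
      ∫⁻ y in ball x (bdHeight x / 4), (ENNReal.ofReal (bdHeight y))⁻¹ ^ (3 * m + 1) *
        sphereEnergy F y := by
    intro x hx
    have hh := bdHeight_pos (hs x hx)
    calc c * volume (ball (0 : Euc (m + 1)) 1)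
        ≤ c * (8 ^ (m + 1) *
          ∫⁻ y in ball x (bdHeight x / 4), (ENNReal.ofReal (bdHeight y))⁻¹ ^ (m + 1)) :=
          mul_le_mul' le_rfl (volume_ball_le_lintegral_bdHeight (hs x hx))
      _ = 8 ^ (m + 1) * ∫⁻ y in ball x (bdHeight x / 4),
          c * (ENNReal.ofReal (bdHeight y))⁻¹ ^ (m + 1) := by
          rw [lintegral_const_mul _ hmH]; ring
      _ ≤ 8 ^ (m + 1) * ∫⁻ y in ball x (bdHeight x / 4), pairConst m ^ 2 *
          ((ENNReal.ofReal (bdHeight y))⁻¹ ^ (3 * m + 1) * sphereEnergy F y) := by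
          refine mul_le_mul' le_rfl (setLIntegral_mono' measurableSet_ball fun y hy => ?_)
          have hyb := hsub x hx hy
          have h2 := abs_le.1 (abs_bdHeight_sub_le hyb (hs x hx))
          have hd := mem_ball.1 hy
          rw [dist_eq_norm] at hd
          have h3 : c ≤ pairConst m ^ 2 * (ENNReal.ofReal (bdHeight y))⁻¹ ^ (2 * m) *
              sphereEnergy F y := by
            refine (hc x hx).trans (pairAverage_le hF (hs x hx) hyb (by linarith [h2.2]) ?_)
            refine closedBall_subset_closedBall' ?_
            rw [dist_comm, dist_eq_norm]
            linarith [h2.1]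
          refine (mul_le_mul' h3 le_rfl).trans_eq ?_
          ring
      _ = _ := by
          rw [lintegral_const_mul, mul_assoc]
          have := measurable_bdHeight (m := m)
          have := measurable_sphereEnergy hF
          fun_prop
  have h2 : s.card * c * volume (ball (0 : Euc (m + 1)) 1) ≤ 8 ^ (m + 1) * pairConst m ^ 2 *
      (kernelConst m * ∫⁻ p, F p * (ENNReal.ofReal (dist p.1 p.2 ^ (2 * m)))⁻¹
        ∂((sphereMeasure m).prod (sphereMeasure m))) := by
    calc _ = ∑ x ∈ s, c * volume (ball (0 : Euc (m + 1)) 1) := by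
          rw [Finset.sum_const, nsmul_eq_mul, mul_assoc]
      _ ≤ ∑ x ∈ s, 8 ^ (m + 1) * pairConst m ^ 2 *
          ∫⁻ y in ball x (bdHeight x / 4), (ENNReal.ofReal (bdHeight y))⁻¹ ^ (3 * m + 1) *
            sphereEnergy F y := Finset.sum_le_sum h1
      _ = 8 ^ (m + 1) * pairConst m ^ 2 * ∫⁻ y in ⋃ x ∈ s, ball x (bdHeight x / 4),
          (ENNReal.ofReal (bdHeight y))⁻¹ ^ (3 * m + 1) * sphereEnergy F y := by
          rw [← Finset.mul_sum, lintegral_biUnion_finset hdisj fun x _ => measurableSet_ball]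
      _ ≤ _ := by
          refine mul_le_mul' le_rfl ((lintegral_mono_set (iUnion₂_subset hsub)).trans ?_)
          exact lintegral_sphereEnergy_le hF hF0
  calc s.card * c = s.card * c * volume (ball (0 : Euc (m + 1)) 1) *
        (volume (ball (0 : Euc (m + 1)) 1))⁻¹ := by
        rw [mul_assoc, ENNReal.mul_inv_cancel hV0 hVt, mul_one]
    _ ≤ _ := mul_le_mul' h2 le_rfl
    _ = _ := by unfold countConst; ring

theorem Finset.exists_maximal_of_card_le {α : Type*} {P : Finset α → Prop} (h0 : P ∅) {M : ℕ}
    (hM : ∀ s, P s → s.card ≤ M) : ∃ s, Maximal P s := by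
  classical
  obtain ⟨n, hn⟩ := Nat.findGreatest_spec (P := fun n => ∃ s, P s ∧ s.card = n) (Nat.zero_le M)
    ⟨∅, h0, rfl⟩
  refine ⟨n, hn.1, fun t ht hnt => ?_⟩
  have h1 : t.card ≤ n.card := by
    rw [hn.2]
    exact Nat.le_findGreatest (hM t ht) ⟨t, ht, rfl⟩
  exact (Finset.eq_of_subset_of_card_le hnt h1).ge

/-- The points at which `F` has a large average are contained in finitely many hyperbolic
balls of radius `1`. -/
theorem exists_hypDist_cover (hm : 1 ≤ m) {F : Euc (m + 1) × Euc (m + 1) → ℝ≥0∞}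
    (hF : Measurable F) (hF0 : ∀ θ, F (θ, θ) = 0) {c : ℝ≥0∞} (hc0 : c ≠ 0) (hct : c ≠ ⊤)
    (hfin : ∫⁻ p, F p * (ENNReal.ofReal (dist p.1 p.2 ^ (2 * m)))⁻¹
      ∂((sphereMeasure m).prod (sphereMeasure m)) ≠ ⊤) :
    ∃ s : Finset (Euc (m + 1)), (∀ x ∈ s, x ∈ ball (0 : Euc (m + 1)) 1) ∧
      (s.card * c ≤ countConst m * ∫⁻ p, F p * (ENNReal.ofReal (dist p.1 p.2 ^ (2 * m)))⁻¹
        ∂((sphereMeasure m).prod (sphereMeasure m))) ∧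
      ∀ x ∈ ball (0 : Euc (m + 1)) 1, c ≤ ∫⁻ z, ∫⁻ z', F (‖z‖⁻¹ • z, ‖z'‖⁻¹ • z')
        ∂(ballUniform x) ∂(ballUniform x) → ∃ y ∈ s, hypDist x y < 1 := by
  classical
  set I := ∫⁻ p, F p * (ENNReal.ofReal (dist p.1 p.2 ^ (2 * m)))⁻¹
    ∂((sphereMeasure m).prod (sphereMeasure m)) with hI
  let P : Finset (Euc (m + 1)) → Prop := fun s => (∀ x ∈ s, x ∈ ball (0 : Euc (m + 1)) 1) ∧
    (∀ x ∈ s, c ≤ ∫⁻ z, ∫⁻ z', F (‖z‖⁻¹ • z, ‖z'‖⁻¹ • z') ∂(ballUniform x) ∂(ballUniform x)) ∧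
    (s : Set (Euc (m + 1))).PairwiseDisjoint fun x => ball x (bdHeight x / 4)
  have hcard : ∀ s, P s → s.card * c ≤ countConst m * I := fun s hs =>
    card_mul_le hF hF0 hs.1 hs.2.2 hs.2.1
  have htop : countConst m * I / c ≠ ⊤ :=
    ENNReal.div_ne_top (ENNReal.mul_ne_top (countConst_ne_top hm) hfin) hc0
  obtain ⟨M, hM⟩ := ENNReal.exists_nat_gt htop
  obtain ⟨s, hs⟩ := Finset.exists_maximal_of_card_le (P := P) (M := M) (by simp [P]) (by
    intro s hs
    have h1 := (ENNReal.le_div_iff_mul_le (Or.inl hc0) (Or.inl hct)).2 (hcard s hs)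
    exact_mod_cast (h1.trans hM.le))
  refine ⟨s, hs.prop.1, hcard s hs.prop, fun x hx hcx => ?_⟩
  by_contra! hfar
  have hdis : ∀ y ∈ s, Disjoint (ball x (bdHeight x / 4)) (ball y (bdHeight y / 4)) := by
    intro y hy
    refine ball_disjoint_ball ?_
    by_contra! hlt
    rw [dist_eq_norm] at hlt
    refine absurd (hypDist_lt_one hx (hs.prop.1 y hy) ?_) (not_lt.2 (hfar y hy))
    simp only [bdHeight] at hlt
    linarith
  have hP : P (insert x s) := by
    refine ⟨?_, ?_, ?_⟩
    · rw [Finset.forall_mem_insert]; exact ⟨hx, hs.prop.1⟩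
    · rw [Finset.forall_mem_insert]; exact ⟨hcx, hs.prop.2.1⟩
    · rw [Finset.coe_insert]
      exact hs.prop.2.2.insert fun y hy _ => hdis y hy
  have hxs : x ∈ s := hs.le_of_ge hP (Finset.subset_insert x s) (Finset.mem_insert_self x s)
  refine absurd (hypDist_lt_one hx hx ?_) (not_lt.2 (hfar x hxs))
  have := one_sub_norm_sq_pos hx
  rw [sub_self, norm_zero]
  positivity

/-- The points at which `F` has a large average are contained in finitely many Euclidean balls
with disjoint closures in the unit ball, which have controlled hyperbolic size. -/
theorem exists_ball_cover (hm : 1 ≤ m) {F : Euc (m + 1) × Euc (m + 1) → ℝ≥0∞}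
    (hF : Measurable F) (hF0 : ∀ θ, F (θ, θ) = 0) {c : ℝ≥0∞} (hc0 : c ≠ 0) (hct : c ≠ ⊤)
    (hfin : ∫⁻ p, F p * (ENNReal.ofReal (dist p.1 p.2 ^ (2 * m)))⁻¹
      ∂((sphereMeasure m).prod (sphereMeasure m)) ≠ ⊤) :
    ∃ (n : ℕ) (t : Finset (Euc (m + 1) × ℝ)) (a : Euc (m + 1) × ℝ → Euc (m + 1))
      (R : Euc (m + 1) × ℝ → ℝ),
      (n * c ≤ countConst m * ∫⁻ p, F p * (ENNReal.ofReal (dist p.1 p.2 ^ (2 * m)))⁻¹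
        ∂((sphereMeasure m).prod (sphereMeasure m))) ∧ t.card ≤ n ∧
      (∀ i ∈ t, 0 < R i) ∧
      (∀ i ∈ t, ∀ j ∈ t, i ≠ j → Disjoint (closedBall (a i) (R i)) (closedBall (a j) (R j))) ∧
      (∀ i ∈ t, closedBall (a i) (R i) ⊆ ball 0 1) ∧
      (∀ i ∈ t, ∀ x ∈ closedBall (a i) (R i), R i ≤ 64 * Real.exp (2 * n) * bdHeight x) ∧
      ∀ x ∈ ball (0 : Euc (m + 1)) 1, c ≤ ∫⁻ z, ∫⁻ z', F (‖z‖⁻¹ • z, ‖z'‖⁻¹ • z')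
        ∂(ballUniform x) ∂(ballUniform x) → ∃ i ∈ t, x ∈ ball (a i) (R i) := by
  classical
  obtain ⟨s, hsb, hcard, hcov⟩ := exists_hypDist_cover hm hF hF0 hc0 hct hfin
  have hinj : Function.Injective fun x : Euc (m + 1) => (x, (1 : ℝ)) := fun x y h => by
    simpa using h
  obtain ⟨t, htb, htc, hts, htd, htcov⟩ := exists_separated_cover
    (s.image fun x => (x, (1 : ℝ))) (by
      intro p hp
      obtain ⟨x, hx, rfl⟩ := Finset.mem_image.1 hp
      exact ⟨hsb x hx, one_pos⟩)
  rw [Finset.card_image_of_injective _ hinj] at htc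
  rw [Finset.sum_image hinj.injOn, Finset.sum_const, nsmul_eq_mul, mul_one] at hts
  have hball : ∀ p : Euc (m + 1) × ℝ, ∃ (a : Euc (m + 1)) (R : ℝ), p ∈ t → 0 < R ∧
      ball a R = {x | x ∈ ball 0 1 ∧ hypDist x p.1 < p.2} ∧
      closedBall a R = {x | x ∈ ball 0 1 ∧ hypDist x p.1 ≤ p.2} ∧
      ∀ x ∈ closedBall a R, R ≤ 16 * Real.exp (2 * p.2) * (1 - ‖x‖ ^ 2) := by
    intro p
    by_cases hp : p ∈ t
    · obtain ⟨a, R, h⟩ := exists_euclidean_ball (htb p hp).1 (htb p hp).2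
      exact ⟨a, R, fun _ => h⟩
    · exact ⟨0, 0, fun h => absurd h hp⟩
  choose a R haR using hball
  refine ⟨s.card, t, a, R, hcard, htc, fun i hi => (haR i hi).1, ?_, ?_, ?_, ?_⟩
  · intro i hi j hj hij
    rw [(haR i hi).2.2.1, (haR j hj).2.2.1, Set.disjoint_left]
    rintro x ⟨hx, hxi⟩ ⟨-, hxj⟩
    have h1 := hypDist_triangle (htb i hi).1 hx (htb j hj).1
    rw [hypDist_comm i.1 x] at h1
    have := htd i hi j hj hij
    linarith
  · intro i hi x hx
    rw [(haR i hi).2.2.1] at hx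
    exact hx.1
  · intro i hi x hx
    have h1 := (haR i hi).2.2.2 x hx
    rw [(haR i hi).2.2.1] at hx
    have hpos := one_sub_norm_sq_pos hx.1
    have h2 : i.2 ≤ s.card :=
      (Finset.single_le_sum (f := Prod.snd) (fun p hp => (htb p hp).2.le) hi).trans hts
    have h3 : Real.exp (2 * i.2) ≤ Real.exp (2 * s.card) := Real.exp_le_exp.2 (by linarith)
    unfold bdHeight
    nlinarith
  · intro x hx hcx
    obtain ⟨y, hy, hxy⟩ := hcov x hx hcx
    obtain ⟨p, hp, hxp⟩ := htcov x hx ⟨(y, 1), Finset.mem_image_of_mem _ hy, hxy⟩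
    refine ⟨p, hp, ?_⟩
    rw [(haR p hp).2.1]
    exact ⟨hx, hxp⟩

end Counting

section Retraction

variable {ν : ℕ}

/-- A `C¹` retraction with bounded derivative onto a compact set `N`, extended arbitrarily by
points of `N`, is Lipschitz at the points of `N`. -/
theorem exists_retraction_extension {N : Set (Euc ν)} (hNne : N.Nonempty) (hNcomp : IsCompact N)
    {ρ : ℝ} (hρ : 0 < ρ) {retr : Euc ν → Euc ν}
    (hC1 : ContDiffOn ℝ 1 retr {y | infDist y N < ρ})
    (hbd : ∃ L : ℝ, ∀ y ∈ {y : Euc ν | infDist y N < ρ}, ‖fderiv ℝ retr y‖ ≤ L)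
    (hmaps : ∀ y ∈ {y : Euc ν | infDist y N < ρ}, retr y ∈ N)
    (hid : ∀ y ∈ N, retr y = y) :
    ∃ (T : Euc ν → Euc ν) (L : ℝ), 0 < L ∧ (∀ v, T v ∈ N) ∧
      (∀ v, infDist v N < ρ → DifferentiableAt ℝ T v ∧ ‖fderiv ℝ T v‖ ≤ L) ∧
      ∀ v, ∀ p ∈ N, ‖T v - p‖ ≤ L * ‖v - p‖ := by
  classical
  obtain ⟨n₀, hn₀⟩ := hNne
  obtain ⟨L₀, hL₀⟩ := hbd
  obtain ⟨D, hD⟩ := isBounded_iff.1 hNcomp.isBounded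
  have hopen : IsOpen {y : Euc ν | infDist y N < ρ} :=
    isOpen_lt (continuous_infDist_pt N) continuous_const
  let T : Euc ν → Euc ν := fun v => if infDist v N < ρ then retr v else n₀
  have hT : ∀ v, infDist v N < ρ → T =ᶠ[𝓝 v] retr := fun v hv => by
    filter_upwards [hopen.mem_nhds hv] with y hy
    exact if_pos hy
  have hTN : ∀ v, T v ∈ N := fun v => by
    by_cases h : infDist v N < ρ
    · simpa only [T, if_pos h] using hmaps v h
    · simpa only [T, if_neg h] using hn₀
  have hdiff : ∀ v, infDist v N < ρ → DifferentiableAt ℝ retr v := fun v hv =>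
    (hC1.contDiffAt (hopen.mem_nhds hv)).differentiableAt one_ne_zero
  set L := max 1 (max L₀ (D / ρ)) with hL
  have hL1 : 1 ≤ L := le_max_left _ _
  have hL2 : L₀ ≤ L := (le_max_left _ _).trans (le_max_right _ _)
  have hL3 : D / ρ ≤ L := (le_max_right _ _).trans (le_max_right _ _)
  refine ⟨T, L, by linarith, hTN, fun v hv => ⟨(hdiff v hv).congr_of_eventuallyEq (hT v hv), ?_⟩,
    fun v p hp => ?_⟩
  · rw [(hT v hv).fderiv_eq]
    exact (hL₀ v hv).trans hL2
  · by_cases h : ‖v - p‖ < ρ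
    · have hsub : ∀ y ∈ ball p ρ, infDist y N < ρ := fun y hy =>
        (infDist_le_dist_of_mem hp).trans_lt hy
      have hv : v ∈ ball p ρ := by rwa [mem_ball, dist_eq_norm]
      have h1 := (convex_ball p ρ).norm_image_sub_le_of_norm_fderiv_le (𝕜 := ℝ) (f := retr)
        (fun y hy => hdiff y (hsub y hy)) (fun y hy => (hL₀ y (hsub y hy)).trans hL2)
        (mem_ball_self hρ) hv
      rw [hid p hp] at h1
      simpa only [T, if_pos (hsub v hv)] using h1
    · have h1 := hD (hTN v) hp
      rw [dist_eq_norm] at h1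
      calc ‖T v - p‖ ≤ D := h1
        _ = D / ρ * ρ := by field_simp
        _ ≤ L * ‖v - p‖ := by
          have hD0 : 0 ≤ D := (norm_nonneg _).trans h1
          have : 0 ≤ D / ρ := by positivity
          exact mul_le_mul hL3 (not_lt.1 h) hρ.le (by linarith)

end Retraction

section SingularComposition

variable {m ν : ℕ}

/-- Precomposition with the radial projections of disjoint balls onto their boundary spheres
yields a map satisfying a weak-type estimate. -/
theorem exists_singular_composition {N : Set (Euc ν)} {ρ : ℝ} {T : Euc ν → Euc ν} {L : ℝ}
    (hL : 0 < L) (hT : ∀ v, infDist v N < ρ → DifferentiableAt ℝ T v ∧ ‖fderiv ℝ T v‖ ≤ L)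
    {V : Euc (m + 1) → Euc ν} (hV : ∀ x ∈ ball (0 : Euc (m + 1)) 1, DifferentiableAt ℝ V x)
    {M : ℝ} (hM : 0 < M) (hVM : ∀ x ∈ ball (0 : Euc (m + 1)) 1, ‖fderiv ℝ V x‖ ≤ M / bdHeight x)
    {g : Euc (m + 1) → ℝ≥0∞} (hg : Measurable g)
    (hVg : ∀ x ∈ ball (0 : Euc (m + 1)) 1, ‖fderiv ℝ V x‖ₑ ^ (m + 1) ≤ g x)
    {ι : Type*} {t : Finset ι} {a : ι → Euc (m + 1)} {R : ι → ℝ} (hR : ∀ i ∈ t, 0 < R i)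
    (hdisj : ∀ i ∈ t, ∀ j ∈ t, i ≠ j → Disjoint (closedBall (a i) (R i)) (closedBall (a j) (R j)))
    (hsub : ∀ i ∈ t, closedBall (a i) (R i) ⊆ ball 0 1) {b : ℝ} (hb : 0 < b)
    (hRb : ∀ i ∈ t, ∀ x ∈ closedBall (a i) (R i), R i ≤ b * bdHeight x)
    (hnear : ∀ x ∈ ball (0 : Euc (m + 1)) 1, (∀ i ∈ t, x ∉ ball (a i) (R i)) →
      infDist (V x) N < ρ) :
    ∃ P : Euc (m + 1) → Euc (m + 1),
      (∀ x, (∀ i ∈ t, x ∉ ball (a i) (R i)) → P x = x) ∧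
      ContinuousOn (T ∘ V ∘ P) (ball 0 1 \ a '' t) ∧
      (∀ᵐ x ∂(volume.restrict (ball (0 : Euc (m + 1)) 1)), DifferentiableAt ℝ (T ∘ V ∘ P) x) ∧
      ∀ s : ℝ, 0 < s → ENNReal.ofReal (s ^ (m + 1)) *
        volume {x : Euc (m + 1) | x ∈ ball (0 : Euc (m + 1)) 1 ∧
          DifferentiableAt ℝ (T ∘ V ∘ P) x ∧ s ≤ ‖fderiv ℝ (T ∘ V ∘ P) x‖} ≤
        ENNReal.ofReal (L ^ (m + 1)) * (∫⁻ x in ball (0 : Euc (m + 1)) 1, g x) +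
          t.card * (ENNReal.ofReal ((2 * L * M * b) ^ (m + 1)) *
            volume (ball (0 : Euc (m + 1)) 1)) := by
  classical
  obtain ⟨P, hPc, hPid, hPout, hPin⟩ := exists_radial_pushout t a R hR hdisj
  have hPball : ∀ x ∈ ball (0 : Euc (m + 1)) 1, (∀ i ∈ t, x ≠ a i) → P x ∈ ball 0 1 := by
    intro x hx hxa
    by_cases h : ∀ i ∈ t, x ∉ ball (a i) (R i)
    · rwa [hPid x h]
    · push Not at h
      obtain ⟨i, hi, hxi⟩ := h
      exact hsub i hi (sphere_subset_closedBall (hPin i hi x hxi (hxa i hi)).1)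
  have hPnear : ∀ x ∈ ball (0 : Euc (m + 1)) 1, (∀ i ∈ t, x ≠ a i) → infDist (V (P x)) N < ρ :=
    fun x hx hxa => hnear _ (hPball x hx hxa) (hPout x hxa)
  -- The behaviour away from the balls.
  have hfar : ∀ x ∈ ball (0 : Euc (m + 1)) 1, (∀ i ∈ t, x ∉ closedBall (a i) (R i)) →
      HasFDerivAt (T ∘ V ∘ P) ((fderiv ℝ T (V x)).comp (fderiv ℝ V x)) x := by
    intro x hx hxt
    have hev : T ∘ V ∘ P =ᶠ[𝓝 x] T ∘ V := by
      have h1 : ∀ᶠ y in 𝓝 x, ∀ i ∈ t, y ∉ closedBall (a i) (R i) :=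
        (Filter.eventually_all_finset t).2 fun i hi => isClosed_closedBall.isOpen_compl.mem_nhds (hxt i hi)
      filter_upwards [h1] with y hy
      have := hPid y fun i hi h => hy i hi (ball_subset_closedBall h)
      simp [this]
    have hd := hT _ (hnear x hx fun i hi h => hxt i hi (ball_subset_closedBall h))
    exact (hd.1.hasFDerivAt.comp x (hV x hx).hasFDerivAt).congr_of_eventuallyEq hev
  -- The behaviour inside the balls.
  have hins : ∀ i ∈ t, ∀ x ∈ ball (a i) (R i), x ≠ a i →
      DifferentiableAt ℝ (T ∘ V ∘ P) x ∧
        ‖fderiv ℝ (T ∘ V ∘ P) x‖ ≤ 2 * L * M * b / ‖x - a i‖ := by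
    intro i hi x hx hxa
    have hxb := hsub i hi (ball_subset_closedBall hx)
    have hxa' : ∀ j ∈ t, x ≠ a j := by
      rintro j hj rfl
      have hji : j ≠ i := by rintro rfl; exact hxa rfl
      exact Set.disjoint_left.1 (hdisj j hj i hi hji) (mem_closedBall_self (hR j hj).le)
        (ball_subset_closedBall hx)
    obtain ⟨hs, P', hP', hP'n⟩ := hPin i hi x hx hxa
    have hPb := hPball x hxb hxa'
    have hd := hT _ (hPnear x hxb hxa')
    have hD := hd.1.hasFDerivAt.comp x ((hV _ hPb).hasFDerivAt.comp x hP')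
    refine ⟨hD.differentiableAt, ?_⟩
    rw [HasFDerivAt.fderiv hD]
    have hh := bdHeight_pos hPb
    have hRi := hR i hi
    have hpos : 0 < ‖x - a i‖ := norm_pos_iff.2 (sub_ne_zero.2 hxa)
    have hMb : M / bdHeight (P x) ≤ M * b / R i := by
      rw [div_le_div_iff₀ hh hRi, mul_assoc]
      exact mul_le_mul_of_nonneg_left (hRb i hi _ (sphere_subset_closedBall hs)) hM.le
    calc _ ≤ ‖fderiv ℝ T (V (P x))‖ * (‖fderiv ℝ V (P x)‖ * ‖P'‖) :=
          (ContinuousLinearMap.opNorm_comp_le _ _).trans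
            (mul_le_mul_of_nonneg_left (ContinuousLinearMap.opNorm_comp_le _ _) (norm_nonneg _))
      _ ≤ L * (M * b / R i * (2 * R i / ‖x - a i‖)) := by
          have := hd.2
          have := (hVM _ hPb).trans hMb
          gcongr
      _ = _ := by field_simp
  have hnull : ∀ i, volume (sphere (a i) (R i)) = 0 := fun i => Measure.addHaar_sphere _ _ _
  have hnullU : volume (⋃ i ∈ t, sphere (a i) (R i)) = 0 :=
    (measure_biUnion_null_iff t.countable_toSet).2 fun i _ => hnull i
  refine ⟨P, hPid, ?_, ?_, ?_⟩
  · intro x hx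
    have hxa : ∀ i ∈ t, x ≠ a i := fun i hi h => hx.2 ⟨i, hi, h.symm⟩
    have h1 := (hT _ (hPnear x hx.1 hxa)).1.continuousAt
    have h2 := (hV _ (hPball x hx.1 hxa)).continuousAt
    have h3 : ContinuousAt (V ∘ P) x := ContinuousAt.comp h2 (hPc x hxa)
    exact (ContinuousAt.comp (f := V ∘ P) h1 h3).continuousWithinAt
  · have hnull2 : volume (a '' t) = 0 := (t.finite_toSet.image a).measure_zero _
    rw [ae_restrict_iff' measurableSet_ball]
    filter_upwards [measure_eq_zero_iff_ae_notMem.1 hnullU,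
      measure_eq_zero_iff_ae_notMem.1 hnull2] with x hxs hxc hxb
    by_cases h : ∀ i ∈ t, x ∉ closedBall (a i) (R i)
    · exact (hfar x hxb h).differentiableAt
    · push Not at h
      obtain ⟨i, hi, hxi⟩ := h
      refine (hins i hi x ?_ ?_).1
      · rw [← ball_union_sphere] at hxi
        exact hxi.resolve_right fun h => hxs (mem_iUnion₂.2 ⟨i, hi, h⟩)
      · rintro rfl
        exact hxc ⟨i, hi, rfl⟩
  · intro s hs
    have hsp : 0 < s ^ (m + 1) := by positivity
    set c := 2 * L * M * b with hc
    have hc0 : 0 < c := by positivity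
    have hincl : {x : Euc (m + 1) | x ∈ ball (0 : Euc (m + 1)) 1 ∧
        DifferentiableAt ℝ (T ∘ V ∘ P) x ∧ s ≤ ‖fderiv ℝ (T ∘ V ∘ P) x‖} ⊆
        ({x | ENNReal.ofReal (s ^ (m + 1)) ≤ ENNReal.ofReal (L ^ (m + 1)) * g x} ∩ ball 0 1) ∪
          ((⋃ i ∈ t, closedBall (a i) (c / s)) ∪ ⋃ i ∈ t, sphere (a i) (R i)) := by
      rintro x ⟨hxb, -, hsx⟩
      by_cases h : ∀ i ∈ t, x ∉ closedBall (a i) (R i)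
      · refine Or.inl ⟨?_, hxb⟩
        rw [(hfar x hxb h).fderiv] at hsx
        have hd := hT _ (hnear x hxb fun i hi hi' => h i hi (ball_subset_closedBall hi'))
        have h1 : s ≤ L * ‖fderiv ℝ V x‖ := by
          refine hsx.trans ((ContinuousLinearMap.opNorm_comp_le _ _).trans ?_)
          exact mul_le_mul_of_nonneg_right hd.2 (norm_nonneg _)
        calc ENNReal.ofReal (s ^ (m + 1)) ≤ ENNReal.ofReal ((L * ‖fderiv ℝ V x‖) ^ (m + 1)) := by
              gcongr
          _ = ENNReal.ofReal (L ^ (m + 1)) * ‖fderiv ℝ V x‖ₑ ^ (m + 1) := by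
              rw [mul_pow, ENNReal.ofReal_mul (by positivity),
                ENNReal.ofReal_pow (norm_nonneg _), ofReal_norm]
          _ ≤ _ := mul_le_mul' le_rfl (hVg x hxb)
      · push Not at h
        obtain ⟨i, hi, hxi⟩ := h
        rw [← ball_union_sphere] at hxi
        refine Or.inr (hxi.elim (fun hxi => Or.inl ?_) fun hxi => Or.inr ?_)
        · refine mem_iUnion₂.2 ⟨i, hi, ?_⟩
          rw [mem_closedBall, dist_eq_norm]
          by_cases hxa : x = a i
          · rw [hxa, sub_self, norm_zero]; positivity
          · have hpos : 0 < ‖x - a i‖ := norm_pos_iff.2 (sub_ne_zero.2 hxa)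
            have := hsx.trans (hins i hi x hxi hxa).2
            rw [le_div_iff₀ hpos] at this
            rw [le_div_iff₀ hs]
            linarith
        · exact mem_iUnion₂.2 ⟨i, hi, hxi⟩
    have hmk : ENNReal.ofReal (s ^ (m + 1)) *
        volume ({x | ENNReal.ofReal (s ^ (m + 1)) ≤ ENNReal.ofReal (L ^ (m + 1)) * g x} ∩
          ball (0 : Euc (m + 1)) 1) ≤
        ENNReal.ofReal (L ^ (m + 1)) * ∫⁻ x in ball (0 : Euc (m + 1)) 1, g x := by
      rw [← lintegral_const_mul _ hg, ← Measure.restrict_apply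
        (measurableSet_le measurable_const (hg.const_mul _))]
      exact mul_meas_ge_le_lintegral (hg.const_mul _) _
    have hballs : ENNReal.ofReal (s ^ (m + 1)) * volume (⋃ i ∈ t, closedBall (a i) (c / s)) ≤
        t.card * (ENNReal.ofReal (c ^ (m + 1)) * volume (ball (0 : Euc (m + 1)) 1)) := by
      calc _ ≤ ENNReal.ofReal (s ^ (m + 1)) * ∑ i ∈ t, volume (closedBall (a i) (c / s)) :=
            mul_le_mul' le_rfl (measure_biUnion_finset_le _ _)
        _ = t.card * (ENNReal.ofReal (s ^ (m + 1)) * (ENNReal.ofReal ((c / s) ^ (m + 1)) *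
            volume (ball (0 : Euc (m + 1)) 1))) := by
            simp_rw [Measure.addHaar_closedBall _ _ (div_pos hc0 hs).le, finrank_euclideanSpace_fin]
            rw [Finset.sum_const, nsmul_eq_mul]
            ring
        _ = _ := by
            rw [← mul_assoc (ENNReal.ofReal (s ^ (m + 1))), ← ENNReal.ofReal_mul hsp.le, ← mul_pow,
              mul_div_cancel₀ _ hs.ne']
    calc _ ≤ ENNReal.ofReal (s ^ (m + 1)) * (volume
          ({x | ENNReal.ofReal (s ^ (m + 1)) ≤ ENNReal.ofReal (L ^ (m + 1)) * g x} ∩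
            ball (0 : Euc (m + 1)) 1) + (volume (⋃ i ∈ t, closedBall (a i) (c / s)) + 0)) := by
          refine mul_le_mul' le_rfl ((measure_mono hincl).trans ?_)
          refine (measure_union_le _ _).trans (add_le_add_right ?_ _)
          exact (measure_union_le _ _).trans_eq (by rw [hnullU])
      _ ≤ _ := by
          rw [add_zero, mul_add]
          exact add_le_add hmk hballs

end SingularComposition

section Trace

variable {m ν : ℕ}

/-- The inner integral of the Gagliardo energy. -/
def energyDensity (u : Euc (m + 1) → Euc ν) (θ₀ : Euc (m + 1)) : ℝ≥0∞ :=
  ∫⁻ θ, powDiff u (θ₀, θ) * (ENNReal.ofReal (dist θ₀ θ ^ (2 * m)))⁻¹ ∂(sphereMeasure m)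

theorem measurable_energyDensity {u : Euc (m + 1) → Euc ν} (hu : Measurable u) :
    Measurable (energyDensity u) := by
  have hm : Measurable fun p : Euc (m + 1) × Euc (m + 1) =>
      powDiff u p * (ENNReal.ofReal (dist p.1 p.2 ^ (2 * m)))⁻¹ :=
    (measurable_powDiff hu).mul measurable_distKernel
  exact hm.lintegral_prod_right'

theorem lintegral_energyDensity (u : Euc (m + 1) → Euc ν) :
    ∫⁻ θ in sphere (0 : Euc (m + 1)) 1, energyDensity u θ ∂μH[(m : ℝ)] =
      gagliardoEnergySphere m ν u := by
  simp only [gagliardoEnergySphere, energyDensity, powDiff, div_eq_mul_inv]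

theorem le_add_inv_pow_mul_pow {η : ℝ≥0∞} (h0 : η ≠ 0) (ht : η ≠ ⊤) (a : ℝ≥0∞) (n : ℕ) :
    a ≤ η + η⁻¹ ^ n * a ^ (n + 1) := by
  rcases le_total a η with h | h
  · exact h.trans le_self_add
  · have h1 : 1 ≤ η⁻¹ * a := by
      rw [← ENNReal.inv_mul_cancel h0 ht]
      exact mul_le_mul' le_rfl h
    calc a = 1 ^ n * a := by simp
      _ ≤ (η⁻¹ * a) ^ n * a := mul_le_mul' (pow_le_pow_left' h1 n) le_rfl
      _ = η⁻¹ ^ n * a ^ (n + 1) := by ring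
      _ ≤ _ := le_add_self

theorem lintegral_powDiff_le {u : Euc (m + 1) → Euc ν} {θ₀ x : Euc (m + 1)} {r d : ℝ}
    (hd : dist θ₀ x + r ≤ d) :
    ∫⁻ θ in closedBall x r, powDiff u (θ₀, θ) ∂(sphereMeasure m) ≤
      ENNReal.ofReal d ^ (2 * m) * energyDensity u θ₀ := by
  rw [energyDensity, ← lintegral_const_mul' _ _ (by simp)]
  refine (setLIntegral_mono' measurableSet_closedBall fun θ hθ => ?_).trans
    (setLIntegral_le_lintegral _ _)
  by_cases h0 : θ₀ = θ
  · rw [h0, powDiff_self]; exact zero_le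
  have hpos : 0 < dist θ₀ θ := dist_pos.2 h0
  have hle : dist θ₀ θ ≤ d := by
    have h1 := dist_triangle θ₀ x θ
    rw [dist_comm x θ] at h1
    have := mem_closedBall.1 hθ
    linarith
  have h1 : (1 : ℝ≥0∞) ≤ ENNReal.ofReal d ^ (2 * m) * (ENNReal.ofReal (dist θ₀ θ ^ (2 * m)))⁻¹ := by
    rw [ENNReal.ofReal_pow dist_nonneg, ENNReal.inv_pow, ← mul_pow]
    refine one_le_pow₀ ?_
    rw [← ENNReal.mul_inv_cancel (ENNReal.ofReal_pos.2 hpos).ne' ENNReal.ofReal_ne_top]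
    gcongr
  calc powDiff u (θ₀, θ) = 1 * powDiff u (θ₀, θ) := (one_mul _).symm
    _ ≤ _ := mul_le_mul' h1 le_rfl
    _ = _ := by ring

theorem lintegral_enorm_sub_le {u : Euc (m + 1) → Euc ν} (hu : Measurable u) {x : Euc (m + 1)}
    (hx : x ∈ ball (0 : Euc (m + 1)) 1) (hx0 : x ≠ 0) {η : ℝ≥0∞} (h0 : η ≠ 0) (ht : η ≠ ⊤) :
    ∫⁻ z, ‖radialExt u z - u (‖x‖⁻¹ • x)‖ₑ ∂(ballUniform x) ≤
      η + η⁻¹ ^ m * (pairConst m * 12 ^ (2 * m) * (ENNReal.ofReal (bdHeight x) ^ m *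
        energyDensity u (‖x‖⁻¹ • x))) := by
  have := isProbabilityMeasure_ballUniform hx
  have hh := bdHeight_pos hx
  set H := ENNReal.ofReal (bdHeight x) with hH
  have hH0 : H ≠ 0 := (ENNReal.ofReal_pos.2 hh).ne'
  set θ₀ := ‖x‖⁻¹ • x with hθ
  have hp : Measurable fun θ : Euc (m + 1) => powDiff u (θ₀, θ) :=
    (measurable_powDiff hu).comp measurable_prodMk_left
  have hpz : Measurable fun z : Euc (m + 1) => powDiff u (θ₀, ‖z‖⁻¹ • z) :=
    hp.comp measurable_normalize
  have hd : dist θ₀ x + 8 * bdHeight x ≤ 12 * bdHeight x := by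
    have h1 : dist θ₀ x = 1 - ‖x‖ := by
      have hxp : 0 < ‖x‖ := norm_pos_iff.2 hx0
      have hx1 := mem_ball_zero_iff.1 hx
      have : θ₀ - x = (1 - ‖x‖) • (‖x‖⁻¹ • x) := by
        rw [sub_smul, one_smul, smul_smul, mul_inv_cancel₀ hxp.ne', one_smul]
      rw [dist_eq_norm, this, norm_smul, norm_smul, norm_inv, norm_norm,
        inv_mul_cancel₀ hxp.ne', mul_one, Real.norm_eq_abs, abs_of_pos (by linarith)]
    have := one_sub_norm_le_bdHeight hx
    linarith
  have h1 : ∫⁻ z, powDiff u (θ₀, ‖z‖⁻¹ • z) ∂(ballUniform x) ≤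
      pairConst m * 12 ^ (2 * m) * (H ^ m * energyDensity u θ₀) := by
    calc _ ≤ pairConst m * H⁻¹ ^ m * (ENNReal.ofReal (12 * bdHeight x) ^ (2 * m) *
          energyDensity u θ₀) :=
          (singleAverage_le hp hx).trans (mul_le_mul' le_rfl (lintegral_powDiff_le hd))
      _ = pairConst m * 12 ^ (2 * m) * ((H⁻¹ * H) ^ m * H ^ m * energyDensity u θ₀) := by
          rw [ENNReal.ofReal_mul (by norm_num), ← hH]
          have : ENNReal.ofReal 12 = 12 := by norm_num
          rw [this]
          ring
      _ = _ := by rw [ENNReal.inv_mul_cancel hH0 ENNReal.ofReal_ne_top, one_pow, one_mul]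
  calc _ ≤ ∫⁻ z, (η + η⁻¹ ^ m * powDiff u (θ₀, ‖z‖⁻¹ • z)) ∂(ballUniform x) := by
        refine lintegral_mono fun z => (le_add_inv_pow_mul_pow h0 ht _ m).trans_eq ?_
        rw [enorm_sub_rev, ← enorm_sub_pow_eq]
        rfl
    _ = η + η⁻¹ ^ m * ∫⁻ z, powDiff u (θ₀, ‖z‖⁻¹ • z) ∂(ballUniform x) := by
        rw [lintegral_add_left measurable_const, lintegral_const, measure_univ, mul_one,
          lintegral_const_mul _ hpz]
    _ ≤ _ := by gcongr

theorem lintegral_shell_le {u : Euc (m + 1) → Euc ν} (hu : Measurable u)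
    {U : Euc (m + 1) → Euc ν} {C : ℝ≥0∞} {s : ℝ} (hs0 : 0 < s) (hs1 : s ^ 2 < 1)
    (hU : ∀ x : Euc (m + 1), 1 - s ^ 2 < ‖x‖ → ‖x‖ < 1 → ‖U x - u (‖x‖⁻¹ • x)‖ₑ ≤
      C * ∫⁻ z, ‖radialExt u z - u (‖x‖⁻¹ • x)‖ₑ ∂(ballUniform x)) :
    ENNReal.ofReal (s ^ 2)⁻¹ * ∫⁻ x in {x : Euc (m + 1) | 1 - s ^ 2 < ‖x‖ ∧ ‖x‖ < 1},
        ‖U x - u (‖x‖⁻¹ • x)‖ₑ ≤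
      C * shellConst m * (ENNReal.ofReal s * μH[(m : ℝ)] (sphere (0 : Euc (m + 1)) 1) +
        ENNReal.ofReal s ^ m * (pairConst m * 12 ^ (2 * m) * gagliardoEnergySphere m ν u)) := by
  set σ := ENNReal.ofReal s with hσ
  have hσ0 : σ ≠ 0 := (ENNReal.ofReal_pos.2 hs0).ne'
  have hσt : σ ≠ ⊤ := ENNReal.ofReal_ne_top
  set k := pairConst m * 12 ^ (2 * m) with hk
  have hme := measurable_energyDensity hu
  have hsm : MeasurableSet {x : Euc (m + 1) | 1 - s ^ 2 < ‖x‖ ∧ ‖x‖ < 1} :=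
    (measurableSet_lt measurable_const measurable_norm).inter
      (measurableSet_lt measurable_norm measurable_const)
  have hpt : ∀ x ∈ {x : Euc (m + 1) | 1 - s ^ 2 < ‖x‖ ∧ ‖x‖ < 1}, ‖U x - u (‖x‖⁻¹ • x)‖ₑ ≤
      (fun θ => C * (σ + σ ^ m * (k * energyDensity u θ))) (‖x‖⁻¹ • x) := by
    rintro x ⟨hx1, hx2⟩
    have hxb : x ∈ ball (0 : Euc (m + 1)) 1 := mem_ball_zero_iff.2 hx2
    have hx0 : x ≠ 0 := by
      rintro rfl
      rw [norm_zero] at hx1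
      linarith
    refine (hU x hx1 hx2).trans (mul_le_mul' le_rfl ?_)
    refine (lintegral_enorm_sub_le hu hxb hx0 hσ0 hσt).trans (add_le_add le_rfl ?_)
    have hH : ENNReal.ofReal (bdHeight x) ≤ σ * σ := by
      rw [hσ, ← ENNReal.ofReal_mul hs0.le]
      refine ENNReal.ofReal_le_ofReal ?_
      have := two_mul_bdHeight_lt hxb
      have := bdHeight_pos hxb
      nlinarith
    calc _ ≤ σ⁻¹ ^ m * (k * ((σ * σ) ^ m * energyDensity u (‖x‖⁻¹ • x))) := by gcongr
      _ = (σ⁻¹ * σ) ^ m * (σ ^ m * (k * energyDensity u (‖x‖⁻¹ • x))) := by ring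
      _ = _ := by rw [ENNReal.inv_mul_cancel hσ0 hσt, one_pow, one_mul]
  have hmg : Measurable fun θ => C * (σ + σ ^ m * (k * energyDensity u θ)) := by fun_prop
  have h1 := lintegral_shell_normalize_le (m := m) (a := 1 - s ^ 2) (b := 1) (by linarith) le_rfl hmg
  rw [sub_sub_cancel] at h1
  have hcancel : ENNReal.ofReal (s ^ 2)⁻¹ * ENNReal.ofReal (s ^ 2) = 1 := by
    rw [← ENNReal.ofReal_mul (by positivity), inv_mul_cancel₀ (by positivity), ENNReal.ofReal_one]
  calc _ ≤ ENNReal.ofReal (s ^ 2)⁻¹ * (shellConst m * ENNReal.ofReal (s ^ 2) *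
        ∫⁻ θ in sphere (0 : Euc (m + 1)) 1, C * (σ + σ ^ m * (k * energyDensity u θ))
          ∂μH[(m : ℝ)]) :=
        mul_le_mul' le_rfl ((setLIntegral_mono' hsm hpt).trans h1)
    _ = (ENNReal.ofReal (s ^ 2)⁻¹ * ENNReal.ofReal (s ^ 2)) * (shellConst m *
        ∫⁻ θ in sphere (0 : Euc (m + 1)) 1, C * (σ + σ ^ m * (k * energyDensity u θ))
          ∂μH[(m : ℝ)]) := by ring
    _ = shellConst m * (C * (σ * μH[(m : ℝ)] (sphere (0 : Euc (m + 1)) 1) +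
        σ ^ m * (k * gagliardoEnergySphere m ν u))) := by
        rw [hcancel, one_mul, lintegral_const_mul _ (by fun_prop),
          lintegral_add_left measurable_const, setLIntegral_const,
          lintegral_const_mul _ (by fun_prop), lintegral_const_mul _ hme, lintegral_energyDensity]
    _ = _ := by ring

/-- A map controlled by local averages near the sphere has trace `u`. -/
theorem tendsto_trace (hm : 1 ≤ m) {u : Euc (m + 1) → Euc ν} (hu : Measurable u)
    (hE : gagliardoEnergySphere m ν u ≠ ⊤) {U : Euc (m + 1) → Euc ν} {C : ℝ≥0∞} (hC : C ≠ ⊤)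
    {r : ℝ} (hr : r < 1)
    (hU : ∀ x : Euc (m + 1), r < ‖x‖ → ‖x‖ < 1 → ‖U x - u (‖x‖⁻¹ • x)‖ₑ ≤
      C * ∫⁻ z, ‖radialExt u z - u (‖x‖⁻¹ • x)‖ₑ ∂(ballUniform x)) :
    Tendsto (fun ε : ℝ => ENNReal.ofReal ε⁻¹ *
        ∫⁻ x in {x : Euc (m + 1) | 1 - ε < ‖x‖ ∧ ‖x‖ < 1}, ‖U x - u (‖x‖⁻¹ • x)‖ₑ)
      (𝓝[>] 0) (𝓝 0) := by
  have hfin : μH[(m : ℝ)] (sphere (0 : Euc (m + 1)) 1) ≠ ⊤ := by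
    have := measure_ne_top (sphereMeasure m) univ
    rwa [Measure.restrict_apply_univ] at this
  have hσ : Tendsto (fun ε : ℝ => ENNReal.ofReal (√ε)) (𝓝[>] 0) (𝓝 0) := by
    have h1 : Continuous fun ε : ℝ => ENNReal.ofReal (√ε) :=
      ENNReal.continuous_ofReal.comp Real.continuous_sqrt
    have h2 := (h1.tendsto 0).mono_left (nhdsWithin_le_nhds (s := Ioi 0))
    simpa using h2
  have hlim : Tendsto (fun ε : ℝ => C * shellConst m *
      (ENNReal.ofReal (√ε) * μH[(m : ℝ)] (sphere (0 : Euc (m + 1)) 1) +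
        ENNReal.ofReal (√ε) ^ m * (pairConst m * 12 ^ (2 * m) * gagliardoEnergySphere m ν u)))
      (𝓝[>] 0) (𝓝 0) := by
    have h1 := ENNReal.Tendsto.mul_const hσ (Or.inr hfin)
    have h2 := ENNReal.Tendsto.mul_const (ENNReal.Tendsto.pow (n := m) hσ) (Or.inr
      (ENNReal.mul_ne_top (ENNReal.mul_ne_top (pairConst_ne_top (m := m))
        (by simp : (12 : ℝ≥0∞) ^ (2 * m) ≠ ⊤)) hE))
    have h3 := ENNReal.Tendsto.const_mul (h1.add h2) (Or.inr (ENNReal.mul_ne_top hC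
      (shellConst_ne_top (m := m))))
    simpa [zero_pow (by lia : m ≠ 0)] using h3
  refine tendsto_of_tendsto_of_tendsto_of_le_of_le' tendsto_const_nhds hlim
    (Eventually.of_forall fun _ => zero_le) ?_
  have hev : ∀ᶠ ε : ℝ in 𝓝[>] 0, ε < min 1 (1 - r) :=
    nhdsWithin_le_nhds (eventually_lt_nhds (lt_min one_pos (by linarith)))
  filter_upwards [hev, self_mem_nhdsWithin] with ε hε hε0
  have hsq : √ε ^ 2 = ε := Real.sq_sqrt (le_of_lt hε0)
  have h1 := lt_of_lt_of_le hε (min_le_left _ _)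
  have h2 := lt_of_lt_of_le hε (min_le_right _ _)
  have := lintegral_shell_le hu (U := U) (C := C) (s := √ε) (Real.sqrt_pos.2 hε0)
    (by rwa [hsq]) (fun x hx hx' => hU x (by rw [hsq] at hx; linarith) hx')
  rwa [hsq] at this

end Trace

section Modification

variable {m ν : ℕ}

theorem gagliardoEnergySphere_congr {u u' : Euc (m + 1) → Euc ν}
    (h : u =ᵐ[sphereMeasure m] u') :
    gagliardoEnergySphere m ν u = gagliardoEnergySphere m ν u' := by
  refine lintegral_congr_ae ?_
  filter_upwards [h] with x hx
  refine lintegral_congr_ae ?_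
  filter_upwards [h] with y hy
  rw [hx, hy]

theorem gapPotentialSphere_congr (δ : ℝ) {u u' : Euc (m + 1) → Euc ν}
    (h : u =ᵐ[sphereMeasure m] u') :
    gapPotentialSphere m ν δ u = gapPotentialSphere m ν δ u' := by
  refine lintegral_congr_ae ?_
  filter_upwards [h] with x hx
  refine lintegral_congr_ae ?_
  filter_upwards [h] with y hy
  rw [hx, hy]

theorem ae_shell_normalize_eq {u u' : Euc (m + 1) → Euc ν} (hu : Measurable u)
    (hu' : Measurable u') (h : u =ᵐ[sphereMeasure m] u') {a b : ℝ} (ha : 0 ≤ a) (hb : b ≤ 1) :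
    ∀ᵐ x ∂(volume.restrict {x : Euc (m + 1) | a < ‖x‖ ∧ ‖x‖ < b}),
      u (‖x‖⁻¹ • x) = u' (‖x‖⁻¹ • x) := by
  have hms : MeasurableSet {θ | u θ ≠ u' θ} := (measurableSet_eq_fun hu hu').compl
  have hg : Measurable ({θ | u θ ≠ u' θ}.indicator (1 : Euc (m + 1) → ℝ≥0∞)) :=
    measurable_one.indicator hms
  have h0 : ∫⁻ θ in sphere (0 : Euc (m + 1)) 1,
      {θ | u θ ≠ u' θ}.indicator (1 : Euc (m + 1) → ℝ≥0∞) θ ∂μH[(m : ℝ)] = 0 := by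
    rw [lintegral_eq_zero_iff hg]
    filter_upwards [h] with θ hθ
    exact indicator_of_notMem (by simpa using hθ) _
  have h1 := lintegral_shell_normalize_le ha hb hg
  have hgn : Measurable fun z : Euc (m + 1) =>
      {θ | u θ ≠ u' θ}.indicator (1 : Euc (m + 1) → ℝ≥0∞) (‖z‖⁻¹ • z) :=
    hg.comp measurable_normalize
  rw [h0, mul_zero, nonpos_iff_eq_zero, lintegral_eq_zero_iff hgn] at h1
  filter_upwards [h1] with x hx
  by_contra hne
  simp only [indicator, mem_ofPred_eq, Pi.zero_apply] at hx
  rw [if_pos hne] at hx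
  exact one_ne_zero hx

end Modification

section Extension

variable {m ν : ℕ}

theorem exists_lt_of_finset_closedBall_subset {ι : Type*} {E : Type*} [PseudoMetricSpace E]
    [ProperSpace E] {c : E} {t : Finset ι} {a : ι → E} {R : ι → ℝ} {ρ : ℝ}
    (hsub : ∀ i ∈ t, closedBall (a i) (R i) ⊆ ball c ρ) :
    ∃ r < ρ, ∀ i ∈ t, closedBall (a i) (R i) ⊆ ball c r := by
  have hcl : IsClosed (⋃ i ∈ t, closedBall (a i) (R i)) :=
    t.finite_toSet.isClosed_biUnion fun i _ => isClosed_closedBall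
  obtain ⟨r, hr, h⟩ := exists_lt_subset_ball hcl (iUnion₂_subset hsub)
  exact ⟨r, hr, fun i hi => (subset_biUnion_of_mem (u := fun i => closedBall (a i) (R i)) hi).trans h⟩

/-- The singular extension of an everywhere `N`-valued map. -/
theorem exists_extension (hm : 1 ≤ m) {N : Set (Euc ν)} (hNne : N.Nonempty)
    (hNcomp : IsCompact N) {ρ : ℝ} (hρ : 0 < ρ) {T : Euc ν → Euc ν} {L : ℝ} (hL : 0 < L)
    (hTN : ∀ v, T v ∈ N)
    (hT : ∀ v, infDist v N < ρ → DifferentiableAt ℝ T v ∧ ‖fderiv ℝ T v‖ ≤ L)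
    (hTL : ∀ v, ∀ p ∈ N, ‖T v - p‖ ≤ L * ‖v - p‖) :
    ∃ A B δ : ℝ, 0 < A ∧ 0 < B ∧ 0 < δ ∧ ∀ u : Euc (m + 1) → Euc ν, Measurable u →
      (∀ x, u x ∈ N) → gagliardoEnergySphere m ν u ≠ ⊤ →
      ∃ (S : Set (Euc (m + 1))) (U : Euc (m + 1) → Euc ν),
        S.Finite ∧ S ⊆ ball (0 : Euc (m + 1)) 1 ∧
        (S.ncard : ℝ≥0∞) ≤ gapBoundSphere m ν A B δ u ∧
        (∀ x, U x ∈ N) ∧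
        ContinuousOn U (ball (0 : Euc (m + 1)) 1 \ S) ∧
        (∀ᵐ x ∂(volume.restrict (ball (0 : Euc (m + 1)) 1)), DifferentiableAt ℝ U x) ∧
        (∀ t : ℝ, 0 < t → ENNReal.ofReal (t ^ (m + 1)) *
          volume {x : Euc (m + 1) | x ∈ ball (0 : Euc (m + 1)) 1 ∧
            DifferentiableAt ℝ U x ∧ t ≤ ‖fderiv ℝ U x‖} ≤ gapBoundSphere m ν A B δ u) ∧
        Tendsto (fun ε : ℝ => ENNReal.ofReal ε⁻¹ *
            ∫⁻ x in {x : Euc (m + 1) | 1 - ε < ‖x‖ ∧ ‖x‖ < 1}, ‖U x - u (‖x‖⁻¹ • x)‖ₑ)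
          (𝓝[>] 0) (𝓝 0) := by
  classical
  obtain ⟨K, hK, hav⟩ := exists_ballAverage_bound m
  obtain ⟨D, hD0, hD⟩ : ∃ D : ℝ, 0 < D ∧ ∀ y ∈ N, ∀ y' ∈ N, dist y y' ≤ D := by
    obtain ⟨D, hD⟩ := isBounded_iff.1 hNcomp.isBounded
    exact ⟨max D 1, by positivity, fun y hy y' hy' => (hD hy hy').trans (le_max_left _ _)⟩
  obtain ⟨n₀, hn₀⟩ := hNne
  set δ := ρ / (4 * K) with hδ
  have hδ0 : 0 < δ := by positivity
  set c := ρ / (4 * K * D) with hc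
  have hc0 : 0 < c := by positivity
  set C₁ := (countConst m).toReal / c with hC₁
  have hC₁0 : 0 ≤ C₁ := by positivity
  set C₂ := C₁ * δ⁻¹ ^ (m + 1) with hC₂
  have hC₂0 : 0 ≤ C₂ := by positivity
  set Kg : ℝ := (ENNReal.ofReal K ^ (m + 1) * pairConst m ^ 2 * kernelConst m).toReal with hKg
  have hKgt : ENNReal.ofReal K ^ (m + 1) * pairConst m ^ 2 * kernelConst m ≠ ⊤ :=
    ENNReal.mul_ne_top (ENNReal.mul_ne_top (by simp) (ENNReal.pow_ne_top pairConst_ne_top))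
      (kernelConst_ne_top hm)
  set ω : ℝ := (volume (ball (0 : Euc (m + 1)) 1)).toReal with hω
  have hωt : volume (ball (0 : Euc (m + 1)) 1) ≠ ⊤ := measure_ball_lt_top.ne
  set Q := (2 * L * (K * D) * 64) ^ (m + 1) with hQ
  set A := L ^ (m + 1) * Kg + C₂ * (Q * ω) + C₂ + 1 with hA
  set B := 2 * (m + 1) * C₁ + 1 with hB
  have hKg0 : 0 ≤ Kg := ENNReal.toReal_nonneg
  have hω0 : 0 ≤ ω := ENNReal.toReal_nonneg
  have hQ0 : 0 ≤ Q := by positivity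
  refine ⟨A, B, δ, by positivity, by positivity, hδ0, fun u hu huN hE => ?_⟩
  have hw := measurable_radialExt hu
  have hwb : ∃ C, ∀ z, ‖radialExt u z‖ ≤ C := by
    obtain ⟨C, hC⟩ := hNcomp.isBounded.exists_norm_le
    exact ⟨C, fun z => hC _ (huN _)⟩
  have hwb' := hwb
  obtain ⟨C, hC⟩ := hwb
  have hbound := hav ν (radialExt u) hw hwb'
  set V := ballAverage (radialExt u) with hV
  have hGE := gapPotentialSphere_le hδ0 hu
  have hGt : gapPotentialSphere m ν δ u ≠ ⊤ :=
    ne_top_of_le_ne_top (ENNReal.mul_ne_top ENNReal.ofReal_ne_top hE) hGE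
  have hGt' := hGt
  rw [gapPotentialSphere_eq δ hu] at hGt'
  obtain ⟨n, t, a, R, hn, htn, hR, hdisj, hsub, hRb, hcov⟩ := exists_ball_cover hm
    (measurable_gapIndicator δ hu) (gapIndicator_self hδ0 u) (ENNReal.ofReal_pos.2 hc0).ne'
    ENNReal.ofReal_ne_top hGt'
  rw [← gapPotentialSphere_eq δ hu] at hn
  have hnG : (n : ℝ) ≤ C₁ * (gapPotentialSphere m ν δ u).toReal := by
    have h1 := ENNReal.toReal_mono (ENNReal.mul_ne_top (countConst_ne_top hm) hGt) hn
    rw [ENNReal.toReal_mul, ENNReal.toReal_mul, ENNReal.toReal_natCast,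
      ENNReal.toReal_ofReal hc0.le] at h1
    rw [hC₁, div_mul_eq_mul_div, le_div_iff₀ hc0]
    exact h1
  have hnE : (n : ℝ≥0∞) ≤ ENNReal.ofReal C₂ * gagliardoEnergySphere m ν u := by
    calc (n : ℝ≥0∞) = ENNReal.ofReal n := (ENNReal.ofReal_natCast n).symm
      _ ≤ ENNReal.ofReal (C₁ * (gapPotentialSphere m ν δ u).toReal) :=
          ENNReal.ofReal_le_ofReal hnG
      _ = ENNReal.ofReal C₁ * gapPotentialSphere m ν δ u := by
          rw [ENNReal.ofReal_mul hC₁0, ENNReal.ofReal_toReal hGt]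
      _ ≤ ENNReal.ofReal C₁ *
          (ENNReal.ofReal (δ⁻¹ ^ (m + 1)) * gagliardoEnergySphere m ν u) :=
          mul_le_mul' le_rfl hGE
      _ = _ := by rw [hC₂, ENNReal.ofReal_mul hC₁0, mul_assoc]
  have hVd : ∀ x ∈ ball (0 : Euc (m + 1)) 1, DifferentiableAt ℝ V x := fun x hx =>
    (hasFDerivAt_ballAverage hw hC hx).differentiableAt
  have hVM : ∀ x ∈ ball (0 : Euc (m + 1)) 1, ‖fderiv ℝ V x‖ ≤ K * D / bdHeight x := by
    intro x hx
    have hh := bdHeight_pos hx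
    have := isProbabilityMeasure_ballUniform hx
    have h1 : ∫⁻ z, ‖radialExt u z - n₀‖ₑ ∂(ballUniform x) ≤ ENNReal.ofReal D := by
      calc _ ≤ ∫⁻ _, ENNReal.ofReal D ∂(ballUniform x) := by
            refine lintegral_mono fun z => ?_
            rw [← ofReal_norm, ← dist_eq_norm]
            exact ENNReal.ofReal_le_ofReal (hD _ (huN _) _ hn₀)
        _ = _ := by rw [lintegral_const, measure_univ, mul_one]
    have h2 := (hbound x hx n₀).2.trans (mul_le_mul' le_rfl h1)
    rw [← ENNReal.ofReal_inv_of_pos hh, ← ENNReal.ofReal_mul hK.le,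
      ← ENNReal.ofReal_mul (by positivity), ← ofReal_norm,
      ENNReal.ofReal_le_ofReal_iff (by positivity)] at h2
    refine h2.trans_eq ?_
    field_simp
  have hgm : Measurable fun x : Euc (m + 1) => ENNReal.ofReal K ^ (m + 1) * pairConst m ^ 2 *
      ((ENNReal.ofReal (bdHeight x))⁻¹ ^ (3 * m + 1) * sphereEnergy (powDiff u) x) := by
    have := measurable_bdHeight (m := m)
    have := measurable_sphereEnergy (measurable_powDiff hu)
    fun_prop
  have hgint : ∫⁻ x in ball (0 : Euc (m + 1)) 1, ENNReal.ofReal K ^ (m + 1) * pairConst m ^ 2 *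
      ((ENNReal.ofReal (bdHeight x))⁻¹ ^ (3 * m + 1) * sphereEnergy (powDiff u) x) ≤
      ENNReal.ofReal Kg * gagliardoEnergySphere m ν u := by
    rw [lintegral_const_mul' _ _ (ENNReal.mul_ne_top (by simp)
      (ENNReal.pow_ne_top pairConst_ne_top)), hKg, ENNReal.ofReal_toReal hKgt, mul_assoc _ (kernelConst m),
      gagliardoEnergySphere_eq hu]
    exact mul_le_mul' le_rfl
      (lintegral_sphereEnergy_le (measurable_powDiff hu) (powDiff_self u))
  have hnear : ∀ x ∈ ball (0 : Euc (m + 1)) 1, (∀ i ∈ t, x ∉ ball (a i) (R i)) →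
      infDist (V x) N < ρ := by
    intro x hx hxt
    by_contra hge
    have h1 : ¬ ENNReal.ofReal c ≤ ∫⁻ z, ∫⁻ z', gapIndicator δ u (‖z‖⁻¹ • z, ‖z'‖⁻¹ • z')
        ∂(ballUniform x) ∂(ballUniform x) := fun h => by
      obtain ⟨i, hi, hxi⟩ := hcov x hx h
      exact hxt i hi hxi
    have h2 := infDist_le_gapAverage hx hu huN hD (δ := δ) (fun c => (hbound x hx c).1)
    have h3 := h2.trans (mul_le_mul' le_rfl (add_le_add le_rfl
      (mul_le_mul' le_rfl (not_le.1 h1).le)))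
    rw [← ENNReal.ofReal_mul hD0.le, ← ENNReal.ofReal_add hδ0.le (by positivity),
      ← ENNReal.ofReal_mul hK.le, ENNReal.ofReal_le_ofReal_iff (by positivity)] at h3
    have h4 : K * (δ + D * c) = ρ / 2 := by
      rw [hδ, hc]; field_simp; norm_num
    linarith
  obtain ⟨P, hPid, hcont, hdiff, hweak⟩ := exists_singular_composition hL hT hVd
    (by positivity : 0 < K * D) hVM hgm
    (fun x hx => enorm_pow_le_of_forall_le hx hu fun c => (hbound x hx c).2) hR hdisj hsub
    (by positivity : 0 < 64 * Real.exp (2 * n)) hRb hnear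
  have hexp : 1 ≤ Real.exp (B * (gapPotentialSphere m ν δ u).toReal) :=
    Real.one_le_exp (by positivity)
  have hexpn : Real.exp (2 * n) ^ (m + 1) ≤ Real.exp (B * (gapPotentialSphere m ν δ u).toReal) := by
    rw [← Real.exp_nat_mul]
    refine Real.exp_le_exp.2 ?_
    have hG0 : 0 ≤ (gapPotentialSphere m ν δ u).toReal := ENNReal.toReal_nonneg
    have h1 := mul_le_mul_of_nonneg_left hnG (by positivity : (0 : ℝ) ≤ 2 * (m + 1))
    rw [hB]
    push_cast
    linarith
  obtain ⟨r, hr1, hr⟩ := exists_lt_of_finset_closedBall_subset hsub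
  refine ⟨a '' t, T ∘ V ∘ P, t.finite_toSet.image a, ?_, ?_, fun x => hTN _, hcont, hdiff,
    fun s hs => (hweak s hs).trans ?_, ?_⟩
  · rintro _ ⟨i, hi, rfl⟩
    exact hsub i hi (mem_closedBall_self (hR i hi).le)
  · calc ((a '' t).ncard : ℝ≥0∞) ≤ n := by
          have h1 := (ncard_image_le t.finite_toSet (f := a)).trans_eq (ncard_coe_finset t)
          exact_mod_cast h1.trans htn
      _ ≤ _ := hnE
      _ ≤ _ := by
          refine mul_le_mul' (ENNReal.ofReal_le_ofReal ?_) le_rfl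
          have h1 : C₂ ≤ A := by
            have : 0 ≤ L ^ (m + 1) * Kg + C₂ * (Q * ω) := by positivity
            linarith
          have h2 : 0 ≤ A := hC₂0.trans h1
          nlinarith
  · calc _ ≤ ENNReal.ofReal (L ^ (m + 1)) * (ENNReal.ofReal Kg * gagliardoEnergySphere m ν u) +
          ENNReal.ofReal C₂ * gagliardoEnergySphere m ν u *
            (ENNReal.ofReal (Q * Real.exp (B * (gapPotentialSphere m ν δ u).toReal)) *
              ENNReal.ofReal ω) := by
          refine add_le_add (mul_le_mul' le_rfl hgint) (mul_le_mul' ?_ (mul_le_mul' ?_ ?_))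
          · refine le_trans ?_ hnE
            exact_mod_cast htn
          · refine ENNReal.ofReal_le_ofReal ?_
            rw [← mul_assoc, mul_pow, ← hQ]
            exact mul_le_mul_of_nonneg_left hexpn hQ0
          · rw [hω, ENNReal.ofReal_toReal hωt]
      _ = ENNReal.ofReal (L ^ (m + 1) * Kg +
          C₂ * (Q * Real.exp (B * (gapPotentialSphere m ν δ u).toReal) * ω)) *
            gagliardoEnergySphere m ν u := by
          rw [ENNReal.ofReal_add (by positivity) (by positivity),
            ENNReal.ofReal_mul (p := L ^ (m + 1)) (by positivity), ENNReal.ofReal_mul hC₂0,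
            ENNReal.ofReal_mul (p := Q * _) (by positivity)]
          ring
      _ ≤ _ := by
          refine mul_le_mul' (ENNReal.ofReal_le_ofReal ?_) le_rfl
          have h1 : 0 ≤ L ^ (m + 1) * Kg := by positivity
          rw [hA]
          nlinarith
  · refine tendsto_trace hm hu hE (C := ENNReal.ofReal (L * K)) ENNReal.ofReal_ne_top hr1
      fun x hxr hx1 => ?_
    have hxb : x ∈ ball (0 : Euc (m + 1)) 1 := mem_ball_zero_iff.2 hx1
    have hPx : P x = x := hPid x fun i hi hxi =>
      absurd (mem_ball_zero_iff.1 (hr i hi (ball_subset_closedBall hxi))) (not_lt.2 hxr.le)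
    calc ‖(T ∘ V ∘ P) x - u (‖x‖⁻¹ • x)‖ₑ = ‖T (V x) - u (‖x‖⁻¹ • x)‖ₑ := by
          rw [Function.comp_apply, Function.comp_apply, hPx]
      _ ≤ ENNReal.ofReal L * ‖V x - u (‖x‖⁻¹ • x)‖ₑ := by
          rw [← ofReal_norm, ← ofReal_norm, ← ENNReal.ofReal_mul hL.le]
          exact ENNReal.ofReal_le_ofReal (hTL _ _ (huN _))
      _ ≤ _ := by
          rw [ENNReal.ofReal_mul hL.le, mul_assoc]
          exact mul_le_mul' le_rfl (hbound x hxb _).1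

end Extension

/-- Theorem 1: controlled singular extension to the unit ball `B^{m+1}_1` with an
exponential weak-type Sobolev estimate. -/
theorem singular_extension_ball (m ν : ℕ) (hm : 1 ≤ m) (hν : 1 ≤ ν)
    (N : Set (Euc ν)) (hNne : N.Nonempty) (hNcomp : IsCompact N)
    (ρN : ℝ) (hρN : 0 < ρN) (retr : Euc ν → Euc ν)
    (hretrC1 : ContDiffOn ℝ 1 retr {y | Metric.infDist y N < ρN})
    (hretrbd : ∃ L : ℝ, ∀ y ∈ {y : Euc ν | Metric.infDist y N < ρN},
      ‖fderiv ℝ retr y‖ ≤ L)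
    (hretrmaps : ∀ y ∈ {y : Euc ν | Metric.infDist y N < ρN}, retr y ∈ N)
    (hretrid : ∀ y ∈ N, retr y = y) :
    ∃ A B δ : ℝ, 0 < A ∧ 0 < B ∧ 0 < δ ∧
      ∀ u : Euc (m + 1) → Euc ν, Measurable u →
        (∀ᵐ x ∂(μH[(m : ℝ)].restrict (sphere (0 : Euc (m + 1)) 1)), u x ∈ N) →
        gagliardoEnergySphere m ν u ≠ ⊤ →
        ∃ (S : Set (Euc (m + 1))) (U : Euc (m + 1) → Euc ν),
          S.Finite ∧ S ⊆ ball (0 : Euc (m + 1)) 1 ∧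
          (S.ncard : ℝ≥0∞) ≤ gapBoundSphere m ν A B δ u ∧
          (∀ x ∈ ball (0 : Euc (m + 1)) 1, U x ∈ N) ∧
          ContinuousOn U (ball (0 : Euc (m + 1)) 1 \ S) ∧
          (∀ᵐ x ∂(volume.restrict (ball (0 : Euc (m + 1)) 1)),
            DifferentiableAt ℝ U x) ∧
          (∀ t : ℝ, 0 < t →
            ENNReal.ofReal (t ^ (m + 1)) *
              volume {x : Euc (m + 1) | x ∈ ball (0 : Euc (m + 1)) 1 ∧
                DifferentiableAt ℝ U x ∧ t ≤ ‖fderiv ℝ U x‖}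
              ≤ gapBoundSphere m ν A B δ u) ∧
          Tendsto (fun ε : ℝ => ENNReal.ofReal ε⁻¹ *
              ∫⁻ x in {x : Euc (m + 1) | 1 - ε < ‖x‖ ∧ ‖x‖ < 1},
                ENNReal.ofReal ‖U x - u (‖x‖⁻¹ • x)‖)
            (nhdsWithin 0 (Ioi 0)) (nhds 0) := by
  classical
  obtain ⟨T, L, hL, hTN, hT, hTL⟩ :=
    exists_retraction_extension hNne hNcomp hρN hretrC1 hretrbd hretrmaps hretrid
  obtain ⟨A, B, δ, hA, hB, hδ, hext⟩ := exists_extension hm hNne hNcomp hρN hL hTN hT hTL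
  obtain ⟨n₀, hn₀⟩ := hNne
  refine ⟨A, B, δ, hA, hB, hδ, fun u hu huN hE => ?_⟩
  let u' : Euc (m + 1) → Euc ν := fun x => if u x ∈ N then u x else n₀
  have hu' : Measurable u' :=
    Measurable.ite (hu hNcomp.isClosed.measurableSet) hu measurable_const
  have hu'N : ∀ x, u' x ∈ N := fun x => by
    by_cases h : u x ∈ N
    · simpa only [u', if_pos h] using h
    · simpa only [u', if_neg h] using hn₀
  have hae : u =ᵐ[sphereMeasure m] u' := by
    filter_upwards [huN] with x hx
    exact (if_pos hx).symm
  have hbd : gapBoundSphere m ν A B δ u = gapBoundSphere m ν A B δ u' := by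
    rw [gapBoundSphere, gapBoundSphere, gagliardoEnergySphere_congr hae,
      gapPotentialSphere_congr δ hae]
  rw [gagliardoEnergySphere_congr hae] at hE
  obtain ⟨S, U, hS, hSb, hcard, hUN, hcont, hdiff, hweak, htr⟩ := hext u' hu' hu'N hE
  rw [hbd]
  refine ⟨S, U, hS, hSb, hcard, fun x _ => hUN x, hcont, hdiff, hweak, htr.congr' ?_⟩
  have hev : ∀ᶠ ε : ℝ in 𝓝[>] 0, ε < 1 := nhdsWithin_le_nhds (eventually_lt_nhds one_pos)
  filter_upwards [hev] with ε hε
  congr 1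
  refine lintegral_congr_ae ?_
  filter_upwards [ae_shell_normalize_eq hu hu' hae (by linarith : 0 ≤ 1 - ε) le_rfl] with x hx
  rw [hx, ofReal_norm]
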